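/- Let q ≥ 3 and a ≢ b (mod q) invertible classes. Suppose that for every finitely supported family of integers (k_γ)_{γ ∈ Z*_q} with Σ_γ k_γ γ = 0 one has Σ_γ k_γ ≡ 0 (mod 2). Then the limiting logarithmic distribution μ_{q;a,b} is symmetric with respect to its mean m_{q;a,b}, i.e. the pushforward of μ_{q;a,b} under t ↦ 2m_{q;a,b} − t equals μ_{q;a,b}. -/

import Mathlib

open MeasureTheory Filter Topology Complex

noncomputable section

/-- `F : ℝ → ℝ` admits the Borel probability measure `μ` as limiting logarithmic
distribution: for every bounded Lipschitz `g : ℝ → ℝ`,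
`(1/Y) ∫₂^Y g(F(e^y)) dy → ∫ g dμ` as `Y → ∞`. -/
def HasLimitingLogDistribution (F : ℝ → ℝ) (μ : Measure ℝ) : Prop :=
  IsProbabilityMeasure μ ∧
  ∀ g : ℝ → ℝ, (∃ C, LipschitzWith C g) → (∃ B, ∀ x, |g x| ≤ B) →
    Tendsto (fun Y : ℝ => (1 / Y) * ∫ y in (2:ℝ)..Y, g (F (Real.exp y)))
      atTop (𝓝 (∫ t, g t ∂μ))

/-- `π(x; q, a)`: the number of primes `p ≤ x` with `p ≡ a (mod q)`. -/
def piMod (q : ℕ) (a : ZMod q) (x : ℝ) : ℕ :=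
  ((Finset.range (⌊x⌋₊ + 1)).filter (fun p : ℕ => p.Prime ∧ (p : ZMod q) = a)).card

/-- `β_{q,0}`: the supremum of the real parts of the critical-strip zeros of the
`L`-functions of non-principal Dirichlet characters mod `q`. -/
def betaQ (q : ℕ) [NeZero q] : ℝ :=
  sSup {b : ℝ | ∃ χ : DirichletCharacter ℂ q, χ ≠ 1 ∧
    ∃ ρ : ℂ, χ.LFunction ρ = 0 ∧ 0 < ρ.re ∧ ρ.re < 1 ∧ ρ.re = b}

/-- `E_{q;a,b}(x) = (log x / x^{β_{q,0}}) (π(x;q,a) − π(x;q,b))`. -/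
def Eab (q : ℕ) [NeZero q] (a b : ZMod q) (x : ℝ) : ℝ :=
  (Real.log x / x ^ betaQ q) * ((piMod q a x : ℝ) - (piMod q b x : ℝ))

/-- `Z*_q`: the set of `γ > 0` such that `L(χ, β_{q,0} + iγ) = 0` for some
non-principal `χ` mod `q`. -/
def Zq (q : ℕ) [NeZero q] : Set ℝ :=
  {γ : ℝ | 0 < γ ∧ ∃ χ : DirichletCharacter ℂ q, χ ≠ 1 ∧
    χ.LFunction ((betaQ q : ℂ) + Complex.I * (γ : ℂ)) = 0}

namespace S12

lemma blaschke_step {R r₁ R' M : ℝ} (h0 : 0 < r₁) (h1 : r₁ < R) (h2 : R < R') {f : ℂ → ℂ}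
    (hf : DifferentiableOn ℂ f (Metric.ball 0 R'))
    (hM : ∀ z ∈ Metric.closedBall (0:ℂ) R, ‖f z‖ ≤ M) (hf0 : f 0 ≠ 0) {ρ : ℂ} (hρ : ‖ρ‖ ≤ r₁)
    (hfρ : f ρ = 0) :
    ∃ g : ℂ → ℂ, DifferentiableOn ℂ g (Metric.ball 0 R') ∧
      (∀ z ∈ Metric.closedBall (0:ℂ) R, ‖g z‖ ≤ M) ∧
      (R / r₁) * ‖f 0‖ ≤ ‖g 0‖ ∧
      (∀ z, (R:ℂ) * f z = g z * (R * (R * (z - ρ) / (R ^ 2 - starRingEnd ℂ ρ * z))) ∨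
        ¬ ‖z‖ ≤ R) := by
  have hR : 0 < R := h0.trans h1
  have hρ0 : ρ ≠ 0 := by rintro rfl; exact hf0 hfρ
  have hρR' : ρ ∈ Metric.ball (0:ℂ) R' := by simp; linarith
  have hden : ∀ z : ℂ, ‖z‖ ≤ R → (R:ℂ) ^ 2 - starRingEnd ℂ ρ * z ≠ 0 := by
    intro z hz h
    have : ‖(R:ℂ)^2‖ = ‖starRingEnd ℂ ρ * z‖ := by rw [sub_eq_zero.mp h]
    rw [norm_mul, norm_pow, RCLike.norm_conj, Complex.norm_real, Real.norm_of_nonneg hR.le] at this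
    nlinarith [norm_nonneg z, norm_nonneg ρ]
  have hds : ∀ z, dslope f ρ z * (z - ρ) = f z := by
    intro z
    have := sub_smul_dslope f ρ z
    rw [hfρ, sub_zero, smul_eq_mul] at this
    rw [mul_comm]; exact this
  set g : ℂ → ℂ := fun z => dslope f ρ z * (((R:ℂ) ^ 2 - starRingEnd ℂ ρ * z) / R) with hg
  have hgd : DifferentiableOn ℂ g (Metric.ball 0 R') := by
    have : DifferentiableOn ℂ (dslope f ρ) (Metric.ball 0 R') :=
      (Complex.differentiableOn_dslope (Metric.isOpen_ball.mem_nhds hρR')).mpr hf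
    apply this.mul
    fun_prop
  have hRC : (R:ℂ) ≠ 0 := by exact_mod_cast hR.ne'
  have hfg : ∀ z, ‖z‖ ≤ R → (R:ℂ) * f z = g z * (R * (R * (z - ρ) / (R ^ 2 - starRingEnd ℂ ρ * z))) := by
    intro z hz
    have := hden z hz
    simp only [hg]
    rw [← hds z]
    generalize (R:ℂ) ^ 2 - starRingEnd ℂ ρ * z = D at this ⊢
    field_simp
  clear_value g
  refine ⟨g, hgd, ?_, ?_, ?_⟩
  · intro z hz
    have hcl : closure (Metric.ball (0:ℂ) R) = Metric.closedBall 0 R := closure_ball _ hR.ne'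
    refine Complex.norm_le_of_forall_mem_frontier_norm_le (U := Metric.ball 0 R)
      Metric.isBounded_ball ?_ ?_ (hcl ▸ hz)
    · apply DifferentiableOn.diffContOnCl
      rw [hcl]
      exact hgd.mono (Metric.closedBall_subset_ball h2)
    · intro w hw
      rw [frontier_ball _ hR.ne'] at hw
      have hwR : ‖w‖ = R := by simpa using hw
      have hne := hden w hwR.le
      have h3 := hfg w hwR.le
      have hwρ : ‖w - ρ‖ ≠ 0 := by
        rw [norm_ne_zero_iff, sub_ne_zero]; rintro rfl; linarith
      have h4 : ‖(R:ℂ)^2 - starRingEnd ℂ ρ * w‖ = R * ‖w - ρ‖ := by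
        have : (R:ℂ)^2 = starRingEnd ℂ w * w := by
          rw [← Complex.normSq_eq_conj_mul_self, Complex.normSq_eq_norm_sq, hwR]; push_cast; rfl
        rw [this, ← sub_mul, norm_mul, ← map_sub, RCLike.norm_conj, hwR, mul_comm]
      have h5 : ‖(R:ℂ) * f w‖ = ‖g w‖ * R := by
        rw [h3, norm_mul, norm_mul, norm_div, norm_mul, h4, Complex.norm_real,
          Real.norm_of_nonneg hR.le]
        field_simp
      rw [norm_mul, Complex.norm_real, Real.norm_of_nonneg hR.le] at h5
      have : ‖g w‖ = ‖f w‖ := by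
        apply mul_right_cancel₀ hR.ne'; rw [← h5, mul_comm]
      rw [this]
      exact hM w (by simp [hwR])
  · have h3 := hfg 0 (by simpa using hR.le)
    have h5 : ‖(R:ℂ) * f 0‖ = ‖g 0‖ * ‖ρ‖ := by
      rw [h3, norm_mul]; simp only [zero_sub, mul_zero, sub_zero]
      congr 1
      rw [show (R:ℂ) * (R * -ρ / R^2) = -ρ by field_simp, norm_neg]
    rw [norm_mul, Complex.norm_real, Real.norm_of_nonneg hR.le] at h5
    rw [div_mul_eq_mul_div, div_le_iff₀ h0, h5]
    gcongr
  · intro z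
    by_cases hz : ‖z‖ ≤ R
    · exact Or.inl (hfg z hz)
    · exact Or.inr hz

lemma factor {R r₁ R' M : ℝ} (h0 : 0 < r₁) (h1 : r₁ < R) (h2 : R < R') (n : ℕ) :
    ∀ f : ℂ → ℂ, DifferentiableOn ℂ f (Metric.ball 0 R') →
    (∀ z ∈ Metric.closedBall (0:ℂ) R, ‖f z‖ ≤ M) → f 0 ≠ 0 → M < (R / r₁) ^ n * ‖f 0‖ →
    ∃ Z : Multiset ℂ, (∀ ρ ∈ Z, ‖ρ‖ ≤ r₁ ∧ f ρ = 0) ∧ (R / r₁) ^ (Multiset.card Z) * ‖f 0‖ ≤ M ∧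
    ∃ g : ℂ → ℂ, DifferentiableOn ℂ g (Metric.ball 0 R') ∧
      (∀ z ∈ Metric.closedBall (0:ℂ) R, ‖g z‖ ≤ M) ∧ ‖f 0‖ ≤ ‖g 0‖ ∧
      (∀ z ∈ Metric.closedBall (0:ℂ) r₁, g z ≠ 0) ∧
      ∀ z, ‖z‖ < r₁ → f z ≠ 0 → logDeriv f z = logDeriv g z +
        (Z.map (fun ρ => 1 / (z - ρ) + starRingEnd ℂ ρ / (R ^ 2 - starRingEnd ℂ ρ * z))).sum := by
  have hR : 0 < R := h0.trans h1
  have hq : 1 < R / r₁ := by rwa [one_lt_div h0]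
  induction n with
  | zero =>
    intro f hf hM hf0 hlt
    have := hM 0 (by simpa using hR.le)
    simp at hlt; linarith
  | succ n ih =>
    intro f hf hM hf0 hlt
    by_cases hz : ∃ ρ, ‖ρ‖ ≤ r₁ ∧ f ρ = 0
    · obtain ⟨ρ, hρ, hfρ⟩ := hz
      obtain ⟨g, hgd, hgM, hg0, hfg⟩ := blaschke_step h0 h1 h2 hf hM hf0 hρ hfρ
      have hf0' : 0 < ‖f 0‖ := norm_pos_iff.mpr hf0
      have hg0' : 0 < ‖g 0‖ := lt_of_lt_of_le (by positivity) hg0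
      obtain ⟨Z, hZ, hZc, k, hkd, hkM, hk0, hkn, hkl⟩ := ih g hgd hgM (norm_pos_iff.mp hg0') (by
        refine hlt.trans_le ?_
        rw [pow_succ, mul_assoc]
        gcongr)
      have hRC : (R:ℂ) ≠ 0 := by exact_mod_cast hR.ne'
      have hden : ∀ z : ℂ, ‖z‖ ≤ R → (R:ℂ) ^ 2 - starRingEnd ℂ ρ * z ≠ 0 := by
        intro z hz h
        have : ‖(R:ℂ)^2‖ = ‖starRingEnd ℂ ρ * z‖ := by rw [sub_eq_zero.mp h]
        rw [norm_mul, norm_pow, RCLike.norm_conj, Complex.norm_real, Real.norm_of_nonneg hR.le] at this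
        nlinarith [norm_nonneg z, norm_nonneg ρ]
      have hfg' : ∀ z, ‖z‖ ≤ R → f z = g z * (R * (z - ρ) / (R ^ 2 - starRingEnd ℂ ρ * z)) := by
        intro z hz
        have := (hfg z).resolve_right (not_not.mpr hz)
        apply mul_left_cancel₀ hRC
        rw [this]; ring
      refine ⟨ρ ::ₘ Z, ?_, ?_, k, hkd, hkM, ?_, hkn, ?_⟩
      · intro w hw
        rcases Multiset.mem_cons.mp hw with rfl | hw
        · exact ⟨hρ, hfρ⟩
        · refine ⟨(hZ w hw).1, ?_⟩
          rw [hfg' w ((hZ w hw).1.trans h1.le), (hZ w hw).2, zero_mul]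
      · rw [Multiset.card_cons, pow_succ, mul_assoc]
        refine le_trans ?_ hZc
        gcongr
      · refine le_trans ?_ hk0
        refine le_trans ?_ hg0
        nlinarith
      · intro z hz hfz
        have hzR : ‖z‖ < R := hz.trans h1
        have hgz : g z ≠ 0 := by
          intro h; apply hfz; rw [hfg' z hzR.le, h, zero_mul]
        have hzρ : z - ρ ≠ 0 := by
          intro h; apply hfz; rw [hfg' z hzR.le, h]; simp
        have hd := hden z hzR.le
        have hloc : f =ᶠ[𝓝 z] fun z => g z * (R * (z - ρ) / (R ^ 2 - starRingEnd ℂ ρ * z)) := by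
          filter_upwards [(isOpen_lt continuous_norm continuous_const).mem_nhds hzR] with w hw
          exact hfg' w (le_of_lt hw)
        have e1 : logDeriv f z = logDeriv g z +
            (1 / (z - ρ) + starRingEnd ℂ ρ / (R ^ 2 - starRingEnd ℂ ρ * z)) := by
          have : logDeriv f z =
              logDeriv (fun z => g z * (R * (z - ρ) / (R ^ 2 - starRingEnd ℂ ρ * z))) z := by
            rw [logDeriv_apply, logDeriv_apply, hloc.deriv_eq, hloc.eq_of_nhds]
          have hB : HasDerivAt (fun z => R * (z - ρ) / (R ^ 2 - starRingEnd ℂ ρ * z))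
              ((R * 1 * (R ^ 2 - starRingEnd ℂ ρ * z) - R * (z - ρ) * (-(starRingEnd ℂ ρ * 1)))
                / (R ^ 2 - starRingEnd ℂ ρ * z) ^ 2) z := by
            exact (((hasDerivAt_id z).sub_const ρ).const_mul (R:ℂ)).div
              (((hasDerivAt_id z).const_mul (starRingEnd ℂ ρ)).const_sub ((R:ℂ)^2)) hd
          rw [this, logDeriv_mul (f := g)
            (g := fun z => R * (z - ρ) / (R ^ 2 - starRingEnd ℂ ρ * z)) z hgz (div_ne_zero (mul_ne_zero hRC hzρ) hd)
            (hgd.differentiableAt (Metric.isOpen_ball.mem_nhds (by simp; linarith)))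
            hB.differentiableAt]
          congr 1
          rw [logDeriv_apply, hB.deriv]
          field_simp
          ring
        rw [e1, hkl z hz hgz, Multiset.map_cons, Multiset.sum_cons]
        ring
    · push Not at hz
      refine ⟨0, by simp, by simpa using hM 0 (by simpa using hR.le), f, hf, hM, le_rfl, ?_, ?_⟩
      · intro z hz'; exact hz z (by simpa using hz')
      · simp

lemma logDeriv_bound {r r₁ M : ℝ} (h0 : 0 < r) (h1 : r < r₁) {g : ℂ → ℂ}
    (hg : DifferentiableOn ℂ g (Metric.ball 0 r₁)) (hne : ∀ z ∈ Metric.ball (0:ℂ) r₁, g z ≠ 0)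
    (hM : ∀ z ∈ Metric.ball (0:ℂ) r₁, ‖g z‖ ≤ M) {m : ℝ} (hm : Real.log (M / ‖g 0‖) ≤ m)
    (hm0 : 0 < m) {z : ℂ} (hz : ‖z‖ ≤ r) :
    ‖logDeriv g z‖ ≤ (8 * r₁ / (r₁ - r) ^ 2) * m := by
  have hr₁ : 0 < r₁ := h0.trans h1
  have h0m : (0:ℂ) ∈ Metric.ball (0:ℂ) r₁ := by simpa using hr₁
  have hld : DifferentiableOn ℂ (logDeriv g) (Metric.ball 0 r₁) := by
    apply DifferentiableOn.div (hg.deriv Metric.isOpen_ball) hg hne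
  obtain ⟨l₀, hl₀⟩ := hld.isExactOn_ball
  set l : ℂ → ℂ := fun z => l₀ z - l₀ 0 with hl
  have hl' : ∀ w ∈ Metric.ball (0:ℂ) r₁, HasDerivAt l (logDeriv g w) w := fun w hw =>
    (hl₀ w hw).sub_const _
  have hlz : l 0 = 0 := by simp [hl]
  -- g = g 0 * exp l
  have hge : ∀ w ∈ Metric.ball (0:ℂ) r₁, g w * Complex.exp (-l w) = g 0 := by
    have hd : ∀ w ∈ Metric.ball (0:ℂ) r₁, HasDerivAt (fun w => g w * Complex.exp (-l w)) 0 w := by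
      intro w hw
      have h3 := (hg.differentiableAt (Metric.isOpen_ball.mem_nhds hw)).hasDerivAt.mul
        ((hl' w hw).neg.cexp)
      refine h3.congr_deriv ?_
      have := hne w hw
      rw [logDeriv_apply]
      field_simp
      ring
    intro w hw
    have := (convex_ball (0:ℂ) r₁).is_const_of_fderivWithin_eq_zero (𝕜 := ℂ)
      (f := fun w => g w * Complex.exp (-l w))
      (fun w hw => (hd w hw).differentiableAt.differentiableWithinAt)
      (fun w hw => by
        rw [fderivWithin_of_isOpen Metric.isOpen_ball hw]
        ext; simp [(hd w hw).hasFDerivAt.fderiv]) hw h0m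
    simpa [hlz] using this
  have hg0 : 0 < ‖g 0‖ := norm_pos_iff.mpr (hne 0 h0m)
  have hre : Set.MapsTo l (Metric.ball 0 r₁) {z | z.re ≤ m} := by
    intro w hw
    have h4 : ‖g w‖ = ‖g 0‖ * Real.exp (l w).re := by
      rw [← hge w hw, norm_mul, Complex.norm_exp, mul_assoc, ← Real.exp_add]; simp
    have h5 : Real.exp (l w).re ≤ M / ‖g 0‖ := by
      rw [le_div_iff₀ hg0, mul_comm, ← h4]; exact hM w hw
    have : (l w).re ≤ Real.log (M / ‖g 0‖) := by
      rw [← Real.log_exp (l w).re]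
      exact Real.log_le_log (Real.exp_pos _) h5
    exact this.trans hm
  have hBC : ∀ w ∈ Metric.ball (0:ℂ) r₁, ‖l w‖ ≤ 2 * m * ‖w‖ / (r₁ - ‖w‖) := fun w hw =>
    Complex.borelCaratheodory_zero hm0
      (fun w hw => (hl' w hw).differentiableAt.differentiableWithinAt) hre hr₁ hw hlz
  set d := (r₁ - r) / 2 with hd
  have hdp : 0 < d := by rw [hd]; linarith
  have hsub : Metric.closedBall z d ⊆ Metric.ball 0 r₁ := by
    intro w hw
    have : ‖w‖ ≤ ‖z‖ + d := by
      have := norm_le_norm_add_norm_sub' w z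
      rw [← dist_eq_norm] at this
      linarith [Metric.mem_closedBall.mp hw]
    simp; linarith
  have hC := Complex.norm_deriv_le_of_forall_mem_sphere_norm_le (f := l) (c := z) (R := d)
    (C := 2 * m * r₁ / d) hdp
    (DifferentiableOn.diffContOnCl (by
      rw [closure_ball _ hdp.ne']
      exact fun w hw => (hl' w (hsub hw)).differentiableAt.differentiableWithinAt)) (by
      intro w hw
      have hw' := hsub (Metric.sphere_subset_closedBall hw)
      refine (hBC w hw').trans ?_
      have h6 : ‖w‖ ≤ r + d := by
        have := norm_le_norm_add_norm_sub' w z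
        rw [← dist_eq_norm] at this
        linarith [Metric.mem_sphere.mp hw]
      have : d ≤ r₁ - ‖w‖ := by rw [hd] at *; linarith
      have h7 : ‖w‖ ≤ r₁ := by linarith
      gcongr)
  rw [(hl' z (by simp; linarith)).deriv] at hC
  refine hC.trans (le_of_eq ?_)
  rw [hd]
  have : r₁ - r ≠ 0 := by linarith
  field_simp
  norm_num

lemma local_logDeriv {r r₁ R R' : ℝ} (h0 : 0 < r) (h1 : r < r₁) (h2 : r₁ < R) (h3 : R < R') :
    ∃ K > 0, ∀ (f : ℂ → ℂ) (M : ℝ), DifferentiableOn ℂ f (Metric.ball 0 R') →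
    (∀ z ∈ Metric.closedBall (0:ℂ) R, ‖f z‖ ≤ M) → f 0 ≠ 0 →
    ∃ Z : Multiset ℂ, (∀ ρ ∈ Z, ‖ρ‖ ≤ r₁ ∧ f ρ = 0) ∧
      (Multiset.card Z : ℝ) ≤ K * (Real.log (M / ‖f 0‖) + 1) ∧
      ∀ z, ‖z‖ ≤ r → f z ≠ 0 →
        ‖logDeriv f z - (Z.map (fun ρ => 1 / (z - ρ))).sum‖ ≤ K * (Real.log (M / ‖f 0‖) + 1) := by
  have hr₁ : 0 < r₁ := h0.trans h1
  have hR : 0 < R := hr₁.trans h2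
  have hq : 1 < R / r₁ := by rwa [one_lt_div hr₁]
  have hlq : 0 < Real.log (R / r₁) := Real.log_pos hq
  set A := 8 * r₁ / (r₁ - r) ^ 2 with hA
  have hAp : 0 < A := by
    have : 0 < r₁ - r := by linarith
    positivity
  set B := 1 / Real.log (R / r₁) with hB
  have hBp : 0 < B := by positivity
  set D := r₁ / (R ^ 2 - r₁ * r) with hD
  have hDd : 0 < R ^ 2 - r₁ * r := by nlinarith
  have hDp : 0 < D := by positivity
  refine ⟨A + B + B * D, by positivity, ?_⟩
  intro f M hf hM hf0
  have hf0' : 0 < ‖f 0‖ := norm_pos_iff.mpr hf0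
  have hM0 : ‖f 0‖ ≤ M := hM 0 (by simpa using hR.le)
  have hMp : 0 < M := hf0'.trans_le hM0
  set m := Real.log (M / ‖f 0‖) + 1 with hm
  have hlog : 0 ≤ Real.log (M / ‖f 0‖) := Real.log_nonneg (by rwa [one_le_div hf0'])
  have hmp : 0 < m := by linarith
  obtain ⟨n, hn⟩ := pow_unbounded_of_one_lt (M / ‖f 0‖) hq
  obtain ⟨Z, hZ, hZc, g, hgd, hgM, hg0, hgn, hgl⟩ := factor hr₁ h2 h3 n f hf hM hf0
    (by rwa [div_lt_iff₀ hf0'] at hn)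
  have hcard : (Multiset.card Z : ℝ) ≤ B * m := by
    have : Real.log ((R / r₁) ^ (Multiset.card Z)) ≤ Real.log (M / ‖f 0‖) := by
      apply Real.log_le_log (by positivity)
      rwa [le_div_iff₀ hf0']
    rw [Real.log_pow] at this
    rw [hB, one_div, inv_mul_eq_div, le_div_iff₀ hlq]
    linarith
  refine ⟨Z, hZ, ?_, ?_⟩
  · have : 0 ≤ (A + B * D) * m := by positivity
    nlinarith
  · intro z hz hfz
    have hb1 := logDeriv_bound (M := M) (m := m) h0 h1
      (hgd.mono (Metric.ball_subset_ball (h2.trans h3).le))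
      (fun z hz => hgn z (Metric.ball_subset_closedBall hz))
      (fun z hz => hgM z (Metric.closedBall_subset_closedBall h2.le (Metric.ball_subset_closedBall hz)))
      (by
        have : Real.log (M / ‖g 0‖) ≤ Real.log (M / ‖f 0‖) := by
          apply Real.log_le_log (div_pos hMp (hf0'.trans_le hg0))
          gcongr
        linarith) hmp hz
    have e : logDeriv f z - (Z.map (fun ρ => 1 / (z - ρ))).sum = logDeriv g z +
        (Z.map (fun ρ => starRingEnd ℂ ρ / (R ^ 2 - starRingEnd ℂ ρ * z))).sum := by
      rw [hgl z (hz.trans_lt h1) hfz, Multiset.sum_map_add]; ring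
    rw [e]
    have hs : ‖(Z.map (fun ρ => starRingEnd ℂ ρ / (R ^ 2 - starRingEnd ℂ ρ * z))).sum‖
        ≤ (Multiset.card Z) * D := by
      have h8 := Multiset.le_sum_of_subadditive (f := fun w : ℂ => ‖w‖) (by simp) (fun a b => norm_add_le a b)
        (Z.map (fun ρ => starRingEnd ℂ ρ / (R ^ 2 - starRingEnd ℂ ρ * z)))
      refine h8.trans ?_
      have h9 := Multiset.sum_le_card_nsmul ((Z.map (fun ρ => starRingEnd ℂ ρ / (R ^ 2 - starRingEnd ℂ ρ * z))).map (fun w : ℂ => ‖w‖)) D (by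
        intro x hx
        simp only [Multiset.mem_map] at hx
        obtain ⟨_, ⟨ρ, hρ, rfl⟩, rfl⟩ := hx
        have hρ1 := (hZ ρ hρ).1
        rw [norm_div, RCLike.norm_conj]
        have : R ^ 2 - r₁ * r ≤ ‖(R:ℂ)^2 - starRingEnd ℂ ρ * z‖ := by
          have := norm_sub_norm_le ((R:ℂ)^2) (starRingEnd ℂ ρ * z)
          rw [norm_mul, norm_pow, RCLike.norm_conj, Complex.norm_real, Real.norm_of_nonneg hR.le] at this
          have : ‖ρ‖ * ‖z‖ ≤ r₁ * r := by gcongr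
          linarith
        rw [hD]
        gcongr)
      simpa using h9
    refine (norm_add_le _ _).trans ?_
    have : (Multiset.card Z : ℝ) * D ≤ B * m * D := by gcongr
    have h10 : 0 ≤ B * m := by positivity
    nlinarith
end S12

namespace S12

/-- two sided Laplace transform of a test function -/
def Ph (g : ℝ → ℝ) (s : ℂ) : ℂ := ∫ y : ℝ, (g y : ℂ) * Complex.exp (s * y)

lemma Ph_integrable {g : ℝ → ℝ} (hg : Continuous g) (hc : HasCompactSupport g) (s : ℂ) :
    Integrable (fun y : ℝ => (g y : ℂ) * Complex.exp (s * y)) := by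
  apply Continuous.integrable_of_hasCompactSupport
  · fun_prop
  · exact (hc.comp_left (g := fun x : ℝ => (x : ℂ)) (by simp)).mul_right

lemma Ph_bound {g : ℝ → ℝ} (hg : Continuous g) (hc : HasCompactSupport g) (c : ℝ) :
    ∃ B, 0 ≤ B ∧ ∀ s : ℂ, |s.re| ≤ c → ‖Ph g s‖ ≤ B := by
  refine ⟨∫ y : ℝ, |g y| * Real.exp (c * |y|), by positivity, fun s hs => ?_⟩
  refine norm_integral_le_of_norm_le ?_ (Eventually.of_forall fun y => ?_)
  · apply Continuous.integrable_of_hasCompactSupport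
    · fun_prop
    · exact (hc.comp_left (g := fun x : ℝ => |x|) (by simp)).mul_right
  · rw [norm_mul, Complex.norm_exp, Complex.norm_real, Real.norm_eq_abs]
    gcongr
    simp only [mul_re, ofReal_re, ofReal_im, mul_zero, sub_zero]
    calc s.re * y ≤ |s.re * y| := le_abs_self _
      _ = |s.re| * |y| := abs_mul _ _
      _ ≤ _ := by gcongr

lemma Ph_differentiable {g : ℝ → ℝ} (hg : Continuous g) (hc : HasCompactSupport g) :
    Differentiable ℂ (Ph g) := by
  intro s
  have := hasDerivAt_integral_of_dominated_loc_of_deriv_le (𝕜 := ℂ) (μ := volume)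
    (F := fun s (y : ℝ) => (g y : ℂ) * Complex.exp (s * y))
    (F' := fun s (y : ℝ) => (g y : ℂ) * (y * Complex.exp (s * y)))
    (x₀ := s) (s := Metric.ball s 1)
    (bound := fun y => |g y| * (|y| * Real.exp ((|s.re| + 1) * |y|)))
    (Metric.ball_mem_nhds _ one_pos)
    (Eventually.of_forall fun x => (Ph_integrable hg hc x).aestronglyMeasurable)
    (Ph_integrable hg hc s)
    (by apply Continuous.aestronglyMeasurable; fun_prop)
    (Eventually.of_forall fun y x hx => by
      rw [norm_mul, norm_mul, Complex.norm_exp, Complex.norm_real, Real.norm_eq_abs,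
        Complex.norm_real, Real.norm_eq_abs]
      gcongr
      simp only [mul_re, ofReal_re, ofReal_im, mul_zero, sub_zero]
      calc x.re * y ≤ |x.re * y| := le_abs_self _
        _ = |x.re| * |y| := abs_mul _ _
        _ ≤ _ := by
          gcongr
          have h1 : |(x - s).re| ≤ 1 := (Complex.abs_re_le_norm _).trans
            (by simpa [dist_eq_norm] using (Metric.mem_ball.mp hx).le)
          have h2 : x.re = s.re + (x - s).re := by simp
          rw [h2]
          exact (abs_add_le _ _).trans (by linarith))
    (by
      apply Continuous.integrable_of_hasCompactSupport
      · fun_prop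
      · exact (hc.comp_left (g := fun x : ℝ => |x|) (by simp)).mul_right)
    (Eventually.of_forall fun y x hx => by
      have h1 : HasDerivAt (fun x : ℂ => x * (y : ℂ)) (y : ℂ) x := by
        simpa using (hasDerivAt_id x).mul_const (y : ℂ)
      have := (h1.cexp.const_mul (g y : ℂ))
      exact this.congr_deriv (by ring))
  exact this.2.differentiableAt

lemma Ph_deriv {g : ℝ → ℝ} (hg : ContDiff ℝ 1 g) (hc : HasCompactSupport g) (s : ℂ) :
    s * Ph g s = - Ph (deriv g) s := by
  have hd : Continuous (deriv g) := hg.continuous_deriv le_rfl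
  have hdc : HasCompactSupport (deriv g) := hc.deriv
  have h1 := Ph_integrable hg.continuous hc s
  have h2 := Ph_integrable hd hdc s
  have := integral_mul_deriv_eq_deriv_mul_of_integrable
    (u := fun y : ℝ => (g y : ℂ)) (v := fun y : ℝ => Complex.exp (s * y))
    (u' := fun y : ℝ => ((deriv g y : ℝ) : ℂ)) (v' := fun y : ℝ => s * Complex.exp (s * y))
    (fun x _ => ((hg.differentiable one_ne_zero x).hasDerivAt).ofReal_comp)
    (fun x _ => by
      have h1 : HasDerivAt (fun x : ℝ => s * (x : ℂ)) s x := by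
        simpa using ((hasDerivAt_id x).ofReal_comp).const_mul s
      exact h1.cexp.congr_deriv (by ring))
    (by
      refine (h1.const_mul s).congr (Eventually.of_forall fun y => ?_)
      simp only [Pi.mul_apply]; ring)
    h2 h1
  simp only [Ph]
  rw [← this, ← integral_const_mul]
  congr 1; ext y; ring

lemma Ph_decay {g : ℝ → ℝ} (hg : ContDiff ℝ 2 g) (hc : HasCompactSupport g) (c : ℝ) :
    ∃ B, 0 ≤ B ∧ ∀ s : ℂ, |s.re| ≤ c → ‖s‖ ^ 2 * ‖Ph g s‖ ≤ B := by
  have hd : ContDiff ℝ 1 (deriv g) := by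
    have : ContDiff ℝ (1 + 1) g := by exact_mod_cast hg
    exact (contDiff_succ_iff_deriv.mp this).2.2
  obtain ⟨B, hB, h⟩ := Ph_bound (hd.continuous_deriv le_rfl) hc.deriv.deriv c
  refine ⟨B, hB, fun s hs => ?_⟩
  have h1 := Ph_deriv (hg.of_le (by norm_num)) hc s
  have h2 := Ph_deriv hd hc.deriv s
  have h3 : s ^ 2 * Ph g s = Ph (deriv (deriv g)) s := by
    rw [pow_two, mul_assoc, h1, mul_neg, h2, neg_neg]
  rw [← norm_pow, ← norm_mul, h3]
  exact h s hs

/-- contour shift -/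
lemma contour_shift {H : ℂ → ℂ} {σ σ' : ℝ} (hσ : σ ≤ σ')
    (hH : DifferentiableOn ℂ H {s | σ ≤ s.re}) {B : ℝ}
    (hB : ∀ s : ℂ, σ ≤ s.re → s.re ≤ σ' → s.im ^ 2 * ‖H s‖ ≤ B)
    (h1 : Integrable (fun t : ℝ => H (σ + t * I))) (h2 : Integrable (fun t : ℝ => H (σ' + t * I))) :
    ∫ t : ℝ, H (σ + t * I) = ∫ t : ℝ, H (σ' + t * I) := by
  have key : ∀ T : ℝ, (∫ t in (-T)..T, H (σ' + t * I)) - (∫ t in (-T)..T, H (σ + t * I)) =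
      I * ((∫ x in σ..σ', H (x + (-T : ℝ) * I)) - ∫ x in σ..σ', H (x + T * I)) := by
    intro T
    have := Complex.integral_boundary_rect_eq_zero_of_differentiableOn H (σ + (-T : ℝ) * I)
      (σ' + T * I) (hH.mono (by
        intro z hz
        have := hz.1
        simp [Set.uIcc_of_le hσ] at this
        exact this.1))
    simp only [add_re, ofReal_re, mul_re, I_re, mul_zero, ofReal_im, I_im, mul_one, sub_self,
      add_zero, add_im, mul_im, zero_add, smul_eq_mul] at this
    linear_combination (-I) * this + (( ∫ t in (-T)..T, H (σ' + t * I)) - (∫ t in (-T)..T, H (σ + t * I))) * I_sq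
  have t1 : Tendsto (fun T : ℝ => ∫ t in (-T)..T, H (σ + t * I)) atTop (𝓝 (∫ t : ℝ, H (σ + t * I))) :=
    intervalIntegral_tendsto_integral h1 tendsto_neg_atTop_atBot tendsto_id
  have t2 : Tendsto (fun T : ℝ => ∫ t in (-T)..T, H (σ' + t * I)) atTop (𝓝 (∫ t : ℝ, H (σ' + t * I))) :=
    intervalIntegral_tendsto_integral h2 tendsto_neg_atTop_atBot tendsto_id
  have t3 := t2.sub t1
  have hz : ∀ᶠ T : ℝ in atTop, ‖(∫ t in (-T)..T, H (σ' + t * I)) - (∫ t in (-T)..T, H (σ + t * I))‖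
      ≤ 2 * (B * (σ' - σ)) * (T ^ 2)⁻¹ := by
    filter_upwards [eventually_gt_atTop 0] with T hT
    rw [key, norm_mul, norm_I, one_mul]
    have bd : ∀ T' : ℝ, T' ^ 2 = T ^ 2 → ‖∫ x in σ..σ', H (x + T' * I)‖ ≤ B * (T ^ 2)⁻¹ * (σ' - σ) := by
      intro T' hT'
      have := intervalIntegral.norm_integral_le_of_norm_le_const (a := σ) (b := σ')
        (f := fun x : ℝ => H (x + T' * I)) (C := B * (T ^ 2)⁻¹) (fun x hx => by
          rw [Set.uIoc_of_le hσ] at hx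
          have := hB (x + T' * I) (by simpa using hx.1.le) (by simpa using hx.2)
          simp [hT'] at this
          rw [← div_eq_mul_inv, le_div_iff₀ (by positivity)]
          linarith)
      rwa [abs_of_nonneg (by linarith)] at this
    refine (norm_sub_le _ _).trans ?_
    have := bd T rfl
    have := bd (-T) (by ring)
    linarith
  have t4 : Tendsto (fun T : ℝ => 2 * (B * (σ' - σ)) * (T ^ 2)⁻¹) atTop (𝓝 0) := by
    have : Tendsto (fun T : ℝ => (T ^ 2)⁻¹) atTop (𝓝 0) :=
      (tendsto_pow_atTop (two_ne_zero)).inv_tendsto_atTop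
    simpa using this.const_mul (2 * (B * (σ' - σ)))
  have t5 := squeeze_zero_norm' hz t4
  exact (sub_eq_zero.mp (tendsto_nhds_unique t3 t5)).symm

end S12

namespace S12

lemma GPh_integrable {G : ℂ → ℂ} (hG : DifferentiableOn ℂ G {s | 0 < s.re})
    {B : ℝ} {x : ℝ} (hx : 0 < x) (hB : ∀ s : ℂ, s.re = x → ‖G s‖ ≤ B) {g : ℝ → ℝ}
    (hg : ContDiff ℝ 2 g) (hc : HasCompactSupport g) (σ : ℝ) :
    Integrable (fun t : ℝ => G (x + t * I) * Ph g (x + t * I - σ)) := by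
  obtain ⟨B1, hB1, h1⟩ := Ph_bound hg.continuous hc |x - σ|
  obtain ⟨B2, hB2, h2⟩ := Ph_decay hg hc |x - σ|
  have hB0 : 0 ≤ B := (norm_nonneg _).trans (hB x (by simp))
  have hcont : Continuous (fun t : ℝ => G (x + t * I)) := by
    rw [← continuousOn_univ]
    exact hG.continuousOn.comp (by fun_prop) (fun t _ => by simpa using hx)
  have hc2 := (Ph_differentiable hg.continuous hc).continuous
  refine Integrable.mono' (g := fun t : ℝ => B * (B1 + B2) * (1 + t ^ 2)⁻¹)
    (integrable_inv_one_add_sq.const_mul _) ?_ (Eventually.of_forall fun t => ?_)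
  · apply Continuous.aestronglyMeasurable
    exact hcont.mul (hc2.comp (by fun_prop))
  · have a1 := h1 (x + t * I - σ) (by simp)
    have a2 := h2 (x + t * I - σ) (by simp)
    have a3 : t ^ 2 ≤ ‖(x + t * I - σ : ℂ)‖ ^ 2 := by
      rw [Complex.sq_norm, Complex.normSq_apply]
      simp
      nlinarith [sq_nonneg (x - σ)]
    have a4 := hB (x + t * I) (by simp)
    rw [norm_mul, mul_assoc]
    gcongr
    rw [← div_eq_mul_inv, le_div_iff₀ (by positivity)]
    have : t ^ 2 * ‖Ph g (x + t * I - σ)‖ ≤ B2 := le_trans (by gcongr) a2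
    linarith

open FourierTransform

lemma pw_upper {h : ℝ → ℂ} (hm : Measurable h) (h0 : ∀ y < 0, h y = 0) {A C : ℝ}
    (hb : ∀ y, 0 ≤ y → ‖h y‖ ≤ C * Real.exp (A * y)) {G : ℂ → ℂ} 
    (hL : ∀ s : ℂ, A < s.re → G s = ∫ y : ℝ, h y * Complex.exp (-s * y))
    {σ' : ℝ} (hσA : A < σ')
    {g : ℝ → ℝ} (hg : ContDiff ℝ ((⊤ : ℕ∞) : WithTop ℕ∞) g) (hc : HasCompactSupport g) (σ : ℝ) :
    Integrable (fun y : ℝ => h y * Complex.exp (-σ' * y)) ∧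
    ∫ y : ℝ, (g y : ℂ) * (h y * Complex.exp (-σ * y)) =
      (2 * Real.pi : ℝ)⁻¹ • ∫ t : ℝ, G (σ' + t * I) * Ph g (σ' + t * I - σ) := by
  have hk : Integrable (fun y : ℝ => h y * Complex.exp (-σ' * y)) := by
    have h1 : IntegrableOn (fun y : ℝ => C * Real.exp (-(σ' - A) * y)) (Set.Ioi 0) :=
      (exp_neg_integrableOn_Ioi 0 (by linarith)).const_mul C
    have h2 : IntegrableOn (fun y : ℝ => C * Real.exp (-(σ' - A) * y)) (Set.Ici 0) :=
      by rwa [integrableOn_Ici_iff_integrableOn_Ioi]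
    have h3 := h2.integrable_indicator measurableSet_Ici
    refine h3.mono' ?_ (Eventually.of_forall fun y => ?_)
    · apply Measurable.aestronglyMeasurable; fun_prop
    · by_cases hy : y < 0
      · simp [h0 y hy, Set.indicator_of_notMem (show y ∉ Set.Ici (0:ℝ) from not_le.mpr hy)]
      · push Not at hy
        rw [Set.indicator_of_mem (show y ∈ Set.Ici (0:ℝ) from hy), norm_mul, Complex.norm_exp]
        have := hb y hy
        have e : (-(σ':ℂ) * y).re = -σ' * y := by simp
        rw [e]
        calc _ ≤ C * Real.exp (A * y) * Real.exp (-σ' * y) := by gcongr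
          _ = _ := by rw [mul_assoc, ← Real.exp_add]; ring_nf
  refine ⟨hk, ?_⟩
  -- the Schwartz function w
  set w : ℝ → ℂ := fun y => (g y : ℂ) * Complex.exp (((σ' - σ : ℝ) : ℂ) * y) with hw
  have hwc : HasCompactSupport w :=
    (hc.comp_left (g := fun x : ℝ => (x : ℂ)) (by simp)).mul_right
  have hwd : ContDiff ℝ ((⊤ : ℕ∞) : WithTop ℕ∞) w := by
    have h1 : ContDiff ℝ ((⊤ : ℕ∞) : WithTop ℕ∞) (fun y : ℝ => (g y : ℂ)) := Complex.ofRealCLM.contDiff.comp hg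
    have h2 : ContDiff ℝ ((⊤ : ℕ∞) : WithTop ℕ∞) (fun y : ℝ => Complex.exp (((σ' - σ : ℝ) : ℂ) * y)) := by
      apply ContDiff.cexp
      exact contDiff_const.mul Complex.ofRealCLM.contDiff
    exact h1.mul h2
  have hinv : ∀ ξ : ℝ, 𝓕⁻ w ξ = Ph g (σ' + (2 * Real.pi * ξ : ℝ) * I - σ) := by
    intro ξ
    rw [Real.fourierInv_eq', Ph]
    congr 1; ext y
    simp only [hw, smul_eq_mul]
    rw [mul_left_comm, ← Complex.exp_add]
    congr 2
    simp; ring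
  have hfour : ∀ ξ : ℝ, 𝓕 (fun y : ℝ => h y * Complex.exp (-σ' * y)) ξ
      = G (σ' + (2 * Real.pi * ξ : ℝ) * I) := by
    intro ξ
    rw [Real.fourier_real_eq_integral_exp_smul, hL _ (by simpa using hσA)]
    congr 1; ext y
    simp only [smul_eq_mul]
    rw [mul_left_comm, ← Complex.exp_add]
    congr 2
    push_cast; ring
  let S := hwc.toSchwartzMap hwd
  have hS : (S : ℝ → ℂ) = w := rfl
  have e1 : 𝓕 (𝓕⁻ w) = w := by
    rw [← hS, ← SchwartzMap.fourierInv_coe, ← SchwartzMap.fourier_coe]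
    simp
  have i2 : Integrable (𝓕⁻ w) := by
    rw [← hS, ← SchwartzMap.fourierInv_coe]
    exact SchwartzMap.integrable _
  have adj := VectorFourier.integral_fourierIntegral_smul_eq_flip (μ := volume) (ν := volume)
    (L := innerₗ ℝ) Real.continuous_fourierChar (by fun_prop) hk i2
  have adj' : ∫ ξ : ℝ, 𝓕 (fun y : ℝ => h y * Complex.exp (-σ' * y)) ξ * 𝓕⁻ w ξ =
      ∫ y : ℝ, (h y * Complex.exp (-σ' * y)) * 𝓕 (𝓕⁻ w) y := by
    simpa using! adj
  rw [e1] at adj'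
  simp only [hfour, hinv] at adj'
  have sc := Measure.integral_comp_mul_left
    (fun t : ℝ => G (σ' + t * I) * Ph g (σ' + t * I - σ)) (2 * Real.pi)
  rw [sc, abs_of_pos (by positivity)] at adj'
  rw [adj']
  congr 1; ext y
  simp only [hw]
  have : Complex.exp (-σ * y) = Complex.exp (-σ' * y) * Complex.exp (((σ' - σ : ℝ) : ℂ) * y) := by
    rw [← Complex.exp_add]; congr 1; push_cast; ring
  rw [this]; ring

lemma pw {h : ℝ → ℂ} (hm : Measurable h) (h0 : ∀ y < 0, h y = 0) {A C : ℝ}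
    (hb : ∀ y, 0 ≤ y → ‖h y‖ ≤ C * Real.exp (A * y)) {G : ℂ → ℂ}
    (hG : DifferentiableOn ℂ G {s | 0 < s.re})
    (hGb : ∀ δ : ℝ, 0 < δ → ∃ B, ∀ s : ℂ, δ ≤ s.re → ‖G s‖ ≤ B)
    (hL : ∀ s : ℂ, A < s.re → G s = ∫ y : ℝ, h y * Complex.exp (-s * y))
    {σ : ℝ} (hσ : 0 < σ) (h2 : Integrable (fun t : ℝ => ‖G (σ + t * I)‖ ^ 2)) :
    Integrable (fun y : ℝ => ‖h y‖ ^ 2 * Real.exp (-2 * σ * y)) ∧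
    ∫ y : ℝ, ‖h y‖ ^ 2 * Real.exp (-2 * σ * y) =
      (2 * Real.pi : ℝ)⁻¹ * ∫ t : ℝ, ‖G (σ + t * I)‖ ^ 2 := by
  set k : ℝ → ℂ := fun y => h y * Complex.exp (-σ * y) with hk
  have hcont : Continuous (fun t : ℝ => G (σ + t * I)) := by
    rw [← continuousOn_univ]
    exact hG.continuousOn.comp (by fun_prop) (fun t _ => by simpa using hσ)
  set Gs : ℝ → ℂ := fun ξ => G (σ + ((2 * Real.pi) * ξ : ℝ) * I) with hGs
  have hGsc : Continuous Gs := hcont.comp (continuous_const.mul continuous_id)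
  have hGs2 : MemLp Gs 2 := by
    rw [memLp_two_iff_integrable_sq_norm hGsc.aestronglyMeasurable]
    exact h2.comp_mul_left' (R := 2 * Real.pi) (by positivity)
  let Gl : Lp ℂ 2 (volume : Measure ℝ) := hGs2.toLp Gs
  let kl : Lp ℂ 2 (volume : Measure ℝ) := 𝓕⁻ Gl
  have hkl : 𝓕 kl = Gl := by simp [kl]
  obtain ⟨B, hB⟩ := hGb σ hσ
  set σ' := max (A + 1) σ with hσ'
  have hA' : A < σ' := lt_of_lt_of_le (by linarith) (le_max_left _ _)
  have hσσ' : σ ≤ σ' := le_max_right _ _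
  have hke : ∀ᵐ y : ℝ, k y = kl y := by
    apply ae_eq_of_integral_contDiff_smul_eq
    · have hmk : Measurable k := by fun_prop
      rw [MeasureTheory.locallyIntegrable_iff]
      intro K hK
      obtain ⟨R, hR⟩ := hK.isBounded.exists_norm_le
      apply Measure.integrableOn_of_bounded (M := |C| * Real.exp (|A| * R) * Real.exp (|σ| * R))
        hK.measure_lt_top.ne hmk.aestronglyMeasurable
      filter_upwards [ae_restrict_mem hK.measurableSet] with y hy
      have hyR := hR y hy
      rw [Real.norm_eq_abs] at hyR
      have hR0 : 0 ≤ R := (abs_nonneg _).trans hyR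
      rw [hk, norm_mul, Complex.norm_exp]
      by_cases hy0 : y < 0
      · simp [h0 y hy0]; positivity
      · push Not at hy0
        have aux : ∀ a : ℝ, a * y ≤ |a| * R := fun a => by
          calc a * y ≤ |a * y| := le_abs_self _
            _ = |a| * |y| := abs_mul _ _
            _ ≤ _ := by gcongr
        have := hb y hy0
        gcongr
        · calc ‖h y‖ ≤ C * Real.exp (A * y) := this
            _ ≤ |C| * Real.exp (|A| * R) := by
              exact mul_le_mul (le_abs_self _) (Real.exp_le_exp.mpr (aux A)) (Real.exp_pos _).le
                (abs_nonneg _)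
        · have := aux (-σ)
          simpa using this
    · exact (Lp.memLp kl).locallyIntegrable (by norm_num)
    intro g hg hc
    have hg2 : ContDiff ℝ 2 g := contDiff_infty.mp hg 2
    obtain ⟨hintg, e1⟩ := pw_upper hm h0 hb hL hA' hg hc σ
    obtain ⟨B1, hB1, hPh⟩ := Ph_decay hg2 hc (σ' - σ)
    have e2 := contour_shift (H := fun s => G s * Ph g (s - σ)) (B := B * B1) hσσ'
      ((hG.mono (fun s hs => lt_of_lt_of_le hσ hs)).mul
        (((Ph_differentiable hg2.continuous hc).comp (differentiable_id.sub_const _)).differentiableOn))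
      (fun s hs1 hs2 => by
        have a1 := hPh (s - σ) (by
          rw [sub_re, ofReal_re, abs_of_nonneg (by linarith)]; linarith)
        have a2 := hB s hs1
        have a3 : s.im ^ 2 ≤ ‖s - σ‖ ^ 2 := by
          rw [Complex.sq_norm, Complex.normSq_apply]
          simp
          nlinarith [sq_nonneg (s.re - σ)]
        have hB0 : 0 ≤ B := (norm_nonneg _).trans a2
        rw [norm_mul]
        calc _ = ‖G s‖ * (s.im ^ 2 * ‖Ph g (s - σ)‖) := by ring
          _ ≤ B * (‖s - σ‖ ^ 2 * ‖Ph g (s - σ)‖) := by gcongr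
          _ ≤ _ := by gcongr)
      (GPh_integrable hG hσ (fun s hs => hB s hs.ge) hg2 hc σ)
      (GPh_integrable hG (hσ.trans_le hσσ') (fun s hs => hB s (hs.ge.trans' hσσ')) hg2 hc σ)
    have e3 : ∫ y : ℝ, g y • k y = ∫ ξ : ℝ, Gs ξ * Ph g ((2 * Real.pi * ξ : ℝ) * I) := by
      have sc := Measure.integral_comp_mul_left
        (fun t : ℝ => G (σ + t * I) * Ph g (σ + t * I - σ)) (2 * Real.pi)
      rw [abs_of_pos (by positivity), e2, ← e1] at sc
      simp only [hGs]
      simp only [add_sub_cancel_left] at sc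
      rw [sc]
      simp [hk]
    rw [e3]
    -- L2 side
    set v : ℝ → ℂ := fun y => (g y : ℂ) with hv
    have hvc : HasCompactSupport v := hc.comp_left (g := fun x : ℝ => (x : ℂ)) (by simp)
    have hvd : ContDiff ℝ ((⊤ : ℕ∞) : WithTop ℕ∞) v := Complex.ofRealCLM.contDiff.comp hg
    let S := hvc.toSchwartzMap hvd
    have hS : (S : ℝ → ℂ) = v := rfl
    have p1 := Lp.inner_fourier_eq (S.toLp 2) kl
    rw [SchwartzMap.toLp_fourier_eq, hkl, L2.inner_def, L2.inner_def] at p1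
    have p2 : ∫ y : ℝ, g y • kl y = ∫ a, inner ℂ ((S.toLp 2) a) (kl a) := by
      apply integral_congr_ae
      filter_upwards [S.coeFn_toLp 2] with y hy
      rw [hy, hS]
      simp [hv, mul_comm]
    rw [p2, ← p1]
    apply integral_congr_ae
    filter_upwards [(𝓕 S).coeFn_toLp 2, hGs2.coeFn_toLp] with ξ hξ hξ2
    rw [hξ, hξ2, SchwartzMap.fourier_coe, hS]
    simp only [RCLike.inner_apply]
    congr 1
    rw [Real.fourier_real_eq_integral_exp_smul, ← integral_conj, Ph]
    congr 1; ext y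
    simp only [hv, smul_eq_mul, map_mul, conj_ofReal, ← Complex.exp_conj, conj_I]
    rw [mul_comm]
    congr 2
    push_cast; ring
  have nk : ∀ y, ‖h y‖ ^ 2 * Real.exp (-2 * σ * y) = ‖k y‖ ^ 2 := by
    intro y
    rw [hk, norm_mul, Complex.norm_exp, mul_pow, ← Real.exp_nat_mul]
    congr 2
    simp; ring
  simp only [nk]
  have hae : (fun y => ‖k y‖ ^ 2) =ᵐ[volume] fun y => ‖kl y‖ ^ 2 := by
    filter_upwards [hke] with y hy
    rw [hy]
  have hi : Integrable (fun y => ‖kl y‖ ^ 2) :=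
    (memLp_two_iff_integrable_sq_norm (Lp.memLp kl).1).mp (Lp.memLp kl)
  refine ⟨hi.congr hae.symm, ?_⟩
  rw [integral_congr_ae hae]
  have sc := Measure.integral_comp_mul_left (fun t : ℝ => ‖G (σ + t * I)‖ ^ 2) (2 * Real.pi)
  rw [abs_of_pos (by positivity), smul_eq_mul] at sc
  rw [← sc]
  have q1 := Lp.inner_fourier_eq kl kl
  rw [hkl, L2.inner_def, L2.inner_def] at q1
  have q2 : ∀ u : Lp ℂ 2 (volume : Measure ℝ), ∫ a, inner ℂ (u a) (u a) = ((∫ a, ‖u a‖ ^ 2 : ℝ) : ℂ) := by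
    intro u
    refine Eq.trans ?_ (integral_ofReal (𝕜 := ℂ))
    congr 1; ext a
    rw [inner_self_eq_norm_sq_to_K]; simp
  rw [q2, q2] at q1
  have q3 : ∫ a, ‖Gl a‖ ^ 2 = ∫ a, ‖kl a‖ ^ 2 := by exact_mod_cast q1
  rw [← q3]
  apply integral_congr_ae
  filter_upwards [hGs2.coeFn_toLp] with ξ hξ
  change ‖(hGs2.toLp Gs) ξ‖ ^ 2 = ‖Gs ξ‖ ^ 2
  rw [hξ]

end S12

namespace S12

lemma mean_bound {h : ℝ → ℂ} (hm : Measurable h) (h0 : ∀ y < 0, h y = 0) {A C : ℝ}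
    (hb : ∀ y, 0 ≤ y → ‖h y‖ ≤ C * Real.exp (A * y)) {G : ℂ → ℂ}
    (hG : DifferentiableOn ℂ G {s | 0 < s.re})
    (hGb : ∀ δ : ℝ, 0 < δ → ∃ B, ∀ s : ℂ, δ ≤ s.re → ‖G s‖ ≤ B)
    (hL : ∀ s : ℂ, A < s.re → G s = ∫ y : ℝ, h y * Complex.exp (-s * y))
    {ε : ℝ} (hε : 0 < ε) (h2 : ∀ᶠ σ : ℝ in 𝓝[>] 0, Integrable (fun t : ℝ => ‖G (σ + t * I)‖ ^ 2) ∧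
      σ * ∫ t : ℝ, ‖G (σ + t * I)‖ ^ 2 ≤ ε ^ 2) :
    ∀ᶠ Y : ℝ in atTop, ∫ y in (0:ℝ)..Y, ‖h y‖ ≤ ε * Y := by
  have ht : Tendsto (fun Y : ℝ => (2 * Y)⁻¹) atTop (𝓝[>] 0) :=
    tendsto_inv_atTop_nhdsGT_zero.comp (tendsto_id.const_mul_atTop two_pos)
  filter_upwards [ht.eventually h2, eventually_gt_atTop 0] with Y hY hY0
  obtain ⟨hi, hle⟩ := hY
  have hσ : 0 < (2 * Y)⁻¹ := by positivity
  obtain ⟨hi2, he⟩ := pw hm h0 hb hG hGb hL hσ hi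
  set J := ∫ t : ℝ, ‖G (((2 * Y)⁻¹ : ℝ) + t * I)‖ ^ 2 with hJ
  have hJ2 : J ≤ 2 * Y * ε ^ 2 := by
    rw [inv_mul_le_iff₀ (by positivity)] at hle
    exact hle
  have hI : ∫ y : ℝ, ‖h y‖ ^ 2 * Real.exp (-2 * (2 * Y)⁻¹ * y) ≤ Y * ε ^ 2 / Real.pi := by
    rw [he]
    calc _ ≤ (2 * Real.pi)⁻¹ * (2 * Y * ε ^ 2) := by gcongr
      _ = _ := by field_simp
  have hs : ∫ y in (0:ℝ)..Y, ‖h y‖ ^ 2 * Real.exp (-2 * (2 * Y)⁻¹ * y) ≤ Y * ε ^ 2 / Real.pi := by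
    rw [intervalIntegral.integral_of_le hY0.le]
    refine (setIntegral_le_integral hi2 (Eventually.of_forall fun y => ?_)).trans hI
    positivity
  have hpt : ∀ y ∈ Set.Icc 0 Y, ‖h y‖ ≤ (Real.exp 1 / (2 * ε)) * (‖h y‖ ^ 2 * Real.exp (-2 * (2 * Y)⁻¹ * y)) + ε / 2 := by
    intro y hy
    have e1 : 1 ≤ Real.exp 1 * Real.exp (-2 * (2 * Y)⁻¹ * y) := by
      rw [← Real.exp_add]
      apply Real.one_le_exp
      have : (2 * (2 * Y)⁻¹) * y ≤ 1 := by
        have : (2 * (2 * Y)⁻¹) * y = y / Y := by field_simp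
        rw [this, div_le_one hY0]; exact hy.2
      linarith
    have e2 : ‖h y‖ ≤ ‖h y‖ ^ 2 / (2 * ε) + ε / 2 := by
      have : ‖h y‖ ^ 2 / (2 * ε) + ε / 2 - ‖h y‖ = (‖h y‖ - ε) ^ 2 / (2 * ε) := by
        field_simp; ring
      have : 0 ≤ (‖h y‖ - ε) ^ 2 / (2 * ε) := by positivity
      linarith
    have e3 : ‖h y‖ ^ 2 / (2 * ε) ≤ ‖h y‖ ^ 2 / (2 * ε) * (Real.exp 1 * Real.exp (-2 * (2 * Y)⁻¹ * y)) :=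
      le_mul_of_one_le_right (by positivity) e1
    calc _ ≤ _ := e2
      _ ≤ ‖h y‖ ^ 2 / (2 * ε) * (Real.exp 1 * Real.exp (-2 * (2 * Y)⁻¹ * y)) + ε / 2 := by linarith
      _ = _ := by ring
  have hbd : IntervalIntegrable (fun y => ‖h y‖) volume 0 Y := by
    rw [intervalIntegrable_iff_integrableOn_Ioc_of_le hY0.le]
    apply Measure.integrableOn_of_bounded (M := |C| * Real.exp (|A| * Y)) (by simp)
      hm.norm.aestronglyMeasurable
    filter_upwards [ae_restrict_mem measurableSet_Ioc] with y hy
    rw [norm_norm]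
    refine (hb y hy.1.le).trans (mul_le_mul (le_abs_self _) (Real.exp_le_exp.mpr ?_) (Real.exp_pos _).le
                (abs_nonneg _))
    calc A * y ≤ |A| * y := by gcongr; exacts [hy.1.le, le_abs_self _]
      _ ≤ _ := by gcongr; exact hy.2
  calc ∫ y in (0:ℝ)..Y, ‖h y‖ ≤ ∫ y in (0:ℝ)..Y, ((Real.exp 1 / (2 * ε)) * (‖h y‖ ^ 2 * Real.exp (-2 * (2 * Y)⁻¹ * y)) + ε / 2) := by
        apply intervalIntegral.integral_mono_on hY0.le hbd _ hpt
        exact (hi2.intervalIntegrable.const_mul _).add (by simp)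
    _ = (Real.exp 1 / (2 * ε)) * (∫ y in (0:ℝ)..Y, (‖h y‖ ^ 2 * Real.exp (-2 * (2 * Y)⁻¹ * y))) + Y * (ε / 2) := by
        rw [intervalIntegral.integral_add (hi2.intervalIntegrable.const_mul _) (by simp)]
        simp; ring
    _ ≤ (Real.exp 1 / (2 * ε)) * (Y * ε ^ 2 / Real.pi) + Y * (ε / 2) := by gcongr
    _ = ε * Y / 2 * (Real.exp 1 / Real.pi) + ε * Y / 2 := by field_simp
    _ ≤ ε * Y / 2 * 1 + ε * Y / 2 := by
        gcongr
        rw [div_le_one Real.pi_pos]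
        linarith [Real.exp_one_lt_d9, Real.pi_gt_three]
    _ = ε * Y := by ring

end S12

namespace S12

lemma sum_range_zmod (q : ℕ) [NeZero q] (f : ZMod q → ℂ) :
    ∑ k ∈ Finset.range q, f (k : ZMod q) = ∑ a : ZMod q, f a := by
  refine Finset.sum_nbij' (fun k => (k : ZMod q)) (fun a => a.val) ?_ ?_ ?_ ?_ ?_
  · intro k _; simp
  · intro a _; simpa using a.val_lt
  · intro k hk; exact ZMod.val_cast_of_lt (by simpa using hk)
  · intro a _; simp
  · intro k _; rfl

lemma char_sum (q : ℕ) [NeZero q] (χ : DirichletCharacter ℂ q) :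
    ∃ κ : ℂ, ∃ C : ℝ, 0 < C ∧ (χ ≠ 1 → κ = 0) ∧
      ∀ n : ℕ, ‖∑ k ∈ Finset.Icc 1 n, χ (k : ZMod q) - κ * n‖ ≤ C := by
  have hq : (q : ℂ) ≠ 0 := by exact_mod_cast NeZero.ne q
  set κ : ℂ := (∑ k ∈ Finset.range q, χ ((k + 1 : ℕ) : ZMod q)) / q with hκ
  set D : ℕ → ℂ := fun n => ∑ k ∈ Finset.range n, (χ ((k + 1 : ℕ) : ZMod q) - κ) with hD
  have hper : Function.Periodic D q := by
    intro n
    induction n with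
    | zero => simp [hD, hκ, mul_div_cancel₀ _ hq]
    | succ n ih =>
      have : n + 1 + q = (n + q) + 1 := by ring
      rw [this]
      simp only [hD, Finset.sum_range_succ] at ih ⊢
      rw [ih]; simp
  refine ⟨κ, 1 + ∑ k ∈ Finset.range q, ‖D k‖, by positivity, ?_, fun n => ?_⟩
  · intro h
    rw [hκ]
    have := sum_range_zmod q (fun a => χ (a + 1))
    push_cast
    have e2 := Equiv.sum_comp (Equiv.addRight (1 : ZMod q)) (fun a => χ a)
    simp only [Equiv.coe_addRight] at e2
    rw [this, e2, MulChar.sum_eq_zero_of_ne_one h]; simp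
  · have e : ∑ k ∈ Finset.Icc 1 n, χ (k : ZMod q) - κ * n = D n := by
      induction n with
      | zero => simp [hD]
      | succ n ih =>
        rw [Finset.sum_Icc_succ_top (by omega)]
        simp only [hD, Finset.sum_range_succ] at ih ⊢
        rw [← ih]; push_cast; ring
    rw [e, ← hper.map_mod_nat]
    have := Finset.single_le_sum (f := fun k => ‖D k‖) (s := Finset.range q) (fun _ _ => norm_nonneg _)
      (Finset.mem_range.mpr (Nat.mod_lt n (NeZero.pos q)))
    linarith

open Classical in
/-- entire version of the L function -/
def FF {q : ℕ} [NeZero q] (χ : DirichletCharacter ℂ q) : ℂ → ℂ :=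
  if χ = 1 then DirichletCharacter.LFunctionTrivChar₁ q else χ.LFunction

open Classical in
/-- order of the pole -/
def ee {q : ℕ} (χ : DirichletCharacter ℂ q) : ℕ := if χ = 1 then 1 else 0

lemma FF_eq {q : ℕ} [NeZero q] (χ : DirichletCharacter ℂ q) {s : ℂ} (hs : s ≠ 1) :
    FF χ s = (s - 1) ^ (ee χ) * χ.LFunction s := by
  unfold FF ee
  split_ifs with h
  · rw [DirichletCharacter.LFunctionTrivChar₁, Function.update_of_ne hs, h]; simp
  · simp

lemma FF_diff {q : ℕ} [NeZero q] (χ : DirichletCharacter ℂ q) : Differentiable ℂ (FF χ) := by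
  unfold FF
  split_ifs with h
  · exact DirichletCharacter.differentiable_LFunctionTrivChar₁ q
  · exact DirichletCharacter.differentiable_LFunction h

lemma FF_ne_zero {q : ℕ} [NeZero q] (χ : DirichletCharacter ℂ q) {s : ℂ} (hs : 1 ≤ s.re) :
    FF χ s ≠ 0 := by
  by_cases h1 : s = 1
  · unfold FF
    split_ifs with h
    · rw [h1]; exact DirichletCharacter.LFunctionTrivChar₁_apply_one_ne_zero q
    · exact DirichletCharacter.LFunction_ne_zero_of_one_le_re χ (.inl h) hs
  · rw [FF_eq χ h1]
    exact mul_ne_zero (pow_ne_zero _ (sub_ne_zero.mpr h1))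
      (DirichletCharacter.LFunction_ne_zero_of_one_le_re χ (.inr h1) hs)

lemma integral_rpow_tail {x : ℝ} (hx : 0 < x) :
    IntegrableOn (fun t : ℝ => t ^ (-(x + 1))) (Set.Ioi 1) ∧
    ∫ t in Set.Ioi (1:ℝ), t ^ (-(x + 1)) = 1 / x := by
  refine ⟨integrableOn_Ioi_rpow_of_lt (by linarith) one_pos, ?_⟩
  rw [integral_Ioi_rpow_of_lt (by linarith) one_pos]
  have : -(x + 1) + 1 = -x := by ring
  rw [this]; simp

lemma FF_bound {q : ℕ} [NeZero q] (χ : DirichletCharacter ℂ q) :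
    ∃ C : ℝ, 0 < C ∧ ∀ s : ℂ, 3 / 10 ≤ s.re → ‖FF χ s‖ ≤ C * (1 + ‖s‖) ^ 2 := by
  obtain ⟨κ, C, hC, hκ, hS⟩ := char_sum q χ
  set S : ℝ → ℂ := fun t => ∑ k ∈ Finset.Icc 1 ⌊t⌋₊, χ (k : ZMod q) with hSd
  set w : ℝ → ℂ := (Set.Ioi (1:ℝ)).indicator (fun t => S t - κ * t) with hw
  have hSm : Measurable S := by
    have : Measurable (fun n : ℕ => ∑ k ∈ Finset.Icc 1 n, χ (k : ZMod q)) := measurable_from_top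
    exact this.comp Nat.measurable_floor
  have hwm : Measurable w := by
    apply Measurable.indicator _ measurableSet_Ioi
    fun_prop
  have hwb : ∀ t, ‖w t‖ ≤ C + ‖κ‖ := by
    intro t
    by_cases ht : t ∈ Set.Ioi (1:ℝ)
    · rw [hw, Set.indicator_of_mem ht]
      have h1 := hS ⌊t⌋₊
      have ht0 : (0:ℝ) ≤ t := by linarith [Set.mem_Ioi.mp ht]
      have h2 : ‖κ * (⌊t⌋₊ : ℂ) - κ * t‖ ≤ ‖κ‖ := by
        rw [← mul_sub, norm_mul]
        have : ‖((⌊t⌋₊ : ℂ) - t)‖ ≤ 1 := by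
          have e : ((⌊t⌋₊ : ℂ) - t) = (((⌊t⌋₊ : ℝ) - t : ℝ) : ℂ) := by push_cast; rfl
          rw [e, Complex.norm_real, Real.norm_eq_abs, abs_le]
          have := Nat.floor_le ht0
          have := Nat.lt_floor_add_one t
          constructor <;> linarith
        exact mul_le_of_le_one_right (norm_nonneg _) this
      calc ‖S t - κ * t‖ = ‖(S t - κ * ⌊t⌋₊) + (κ * (⌊t⌋₊ : ℂ) - κ * t)‖ := by congr 1; ring
        _ ≤ _ := (norm_add_le _ _).trans (add_le_add h1 h2)
    · rw [hw, Set.indicator_of_notMem ht]; simp; positivity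
  have hmel : ∀ s : ℂ, mellin w (-s) = ∫ t in Set.Ioi (1:ℝ), (S t - κ * t) * (t:ℂ) ^ (-(s + 1)) := by
    intro s
    rw [mellin, ← integral_indicator measurableSet_Ioi, ← integral_indicator measurableSet_Ioi]
    congr 1; ext t
    by_cases ht : t ∈ Set.Ioi (1:ℝ)
    · have : t ∈ Set.Ioi (0:ℝ) := Set.mem_Ioi.mpr (lt_trans one_pos (Set.mem_Ioi.mp ht))
      rw [Set.indicator_of_mem ht, Set.indicator_of_mem this, hw, Set.indicator_of_mem ht, smul_eq_mul, mul_comm]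
      congr 2; ring
    · rw [Set.indicator_of_notMem ht]
      by_cases h0 : t ∈ Set.Ioi (0:ℝ)
      · rw [Set.indicator_of_mem h0, hw, Set.indicator_of_notMem ht]; simp
      · rw [Set.indicator_of_notMem h0]
  have hmd : ∀ s : ℂ, 0 < s.re → DifferentiableAt ℂ (mellin w) (-s) := by
    intro s hs
    apply mellin_differentiableAt_of_isBigO_rpow (a := 0) (b := -s.re - 1)
    · apply LocallyIntegrable.locallyIntegrableOn
      rw [MeasureTheory.locallyIntegrable_iff]
      intro K hK
      exact Measure.integrableOn_of_bounded (M := C + ‖κ‖) hK.measure_lt_top.ne hwm.aestronglyMeasurable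
        (Eventually.of_forall hwb)
    · simp only [neg_zero, Real.rpow_zero]
      exact Asymptotics.IsBigO.of_bound (C + ‖κ‖) (Eventually.of_forall fun t => by simpa using hwb t)
    · simpa using hs
    · apply Asymptotics.IsBigO.of_bound 1
      filter_upwards [nhdsWithin_le_nhds (Iio_mem_nhds (one_pos (α := ℝ)))] with t ht
      rw [hw, Set.indicator_of_notMem (by simpa using (le_of_lt ht))]
      simp; 
    · simp
  have hmb : ∀ s : ℂ, 0 < s.re → ‖mellin w (-s)‖ ≤ (C + ‖κ‖) * (1 / s.re) := by
    intro s hs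
    rw [hmel]
    obtain ⟨i1, i2⟩ := integral_rpow_tail hs
    rw [← i2, ← integral_const_mul]
    refine norm_integral_le_of_norm_le (i1.const_mul _) ?_
    filter_upwards [ae_restrict_mem measurableSet_Ioi] with t ht
    have h := hwb t
    rw [hw, Set.indicator_of_mem ht] at h
    rw [norm_mul, Complex.norm_cpow_eq_rpow_re_of_pos (lt_trans one_pos ht)]
    simp only [neg_re, add_re, one_re]
    have : 0 ≤ t ^ (-(s.re + 1)) := Real.rpow_nonneg (lt_trans one_pos ht).le _
    gcongr
  -- the formula for Re > 1
  have hbig : (fun n : ℕ => ∑ k ∈ Finset.Icc 1 n, χ (k : ZMod q)) =O[atTop] fun n : ℕ => (n : ℝ) ^ (1:ℝ) := by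
    apply Asymptotics.IsBigO.of_bound 1
    filter_upwards with n
    rw [Real.rpow_one, one_mul, Real.norm_of_nonneg (by positivity)]
    refine (norm_sum_le _ _).trans ?_
    calc _ ≤ ∑ k ∈ Finset.Icc 1 n, (1:ℝ) := Finset.sum_le_sum fun k _ => DirichletCharacter.norm_le_one χ _
      _ = n := by simp
  have hform : ∀ s : ℂ, 1 < s.re → (s - 1) * χ.LFunction s = (s - 1) * s * mellin w (-s) + κ * s := by
    intro s hs
    have hs1 : s - 1 ≠ 0 := by
      intro h
      have : s = 1 := by linear_combination h
      rw [this] at hs; simp at hs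
    rw [DirichletCharacter.LFunction_eq_LSeries χ hs, LSeries_eq_mul_integral _ zero_le_one hs
      (DirichletCharacter.LSeriesSummable_of_one_lt_re χ hs) hbig, hmel]
    have i2 : ∫ t in Set.Ioi (1:ℝ), κ * ((t:ℂ) ^ (-s)) = κ * (1 / (s - 1)) := by
      rw [integral_const_mul, integral_Ioi_cpow_of_lt (by simpa using hs) one_pos]
      congr 1
      have : -s + 1 = -(s - 1) := by ring
      rw [this, ofReal_one, one_cpow, neg_div_neg_eq]
    have i1 : IntegrableOn (fun t : ℝ => κ * ((t:ℂ) ^ (-s))) (Set.Ioi 1) :=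
      (integrableOn_Ioi_cpow_of_lt (by simpa using hs) one_pos).const_mul κ
    have i3 : IntegrableOn (fun t : ℝ => (S t - κ * t) * (t:ℂ) ^ (-(s + 1))) (Set.Ioi 1) := by
      refine Integrable.mono' ((integral_rpow_tail (by linarith : 0 < s.re)).1.const_mul (C + ‖κ‖)) ?_ ?_
      · apply AEStronglyMeasurable.mul
        · apply Measurable.aestronglyMeasurable; fun_prop
        · apply ContinuousOn.aestronglyMeasurable _ measurableSet_Ioi
          intro t ht
          apply ContinuousAt.continuousWithinAt
          exact continuousAt_ofReal_cpow_const _ _ (Or.inr (lt_trans one_pos ht).ne')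
      · filter_upwards [ae_restrict_mem measurableSet_Ioi] with t ht
        have h := hwb t
        rw [hw, Set.indicator_of_mem ht] at h
        rw [norm_mul, Complex.norm_cpow_eq_rpow_re_of_pos (lt_trans one_pos ht)]
        simp only [neg_re, add_re, one_re]
        have : 0 ≤ t ^ (-(s.re + 1)) := Real.rpow_nonneg (lt_trans one_pos ht).le _
        gcongr
    have e : ∫ t in Set.Ioi (1:ℝ), S t * (t:ℂ) ^ (-(s + 1)) =
        (∫ t in Set.Ioi (1:ℝ), (S t - κ * t) * (t:ℂ) ^ (-(s + 1))) + κ * (1 / (s - 1)) := by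
      rw [← i2, ← integral_add i3 i1]
      apply setIntegral_congr_fun measurableSet_Ioi
      intro t ht
      have ht0 : (t:ℂ) ≠ 0 := by exact_mod_cast (lt_trans one_pos ht).ne'
      have : (t:ℂ) * (t:ℂ) ^ (-(s + 1)) = (t:ℂ) ^ (-s) := by
        rw [neg_add, Complex.cpow_add _ _ ht0, Complex.cpow_neg_one]
        field_simp
      simp only
      rw [← this]; ring
    simp only [hSd] at e
    rw [e]
    field_simp
    rfl
  -- identity theorem
  have hext : ∀ s : ℂ, 0 < s.re → (s - 1) ^ (1 - ee χ) * FF χ s = (s - 1) * s * mellin w (-s) + κ * s := by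
    have hopen : IsOpen {s : ℂ | 0 < s.re} := isOpen_lt continuous_const continuous_re
    have a1 : AnalyticOnNhd ℂ (fun s => (s - 1) ^ (1 - ee χ) * FF χ s) {s : ℂ | 0 < s.re} := by
      apply DifferentiableOn.analyticOnNhd _ hopen
      apply Differentiable.differentiableOn
      exact ((differentiable_id.sub_const 1).pow _).mul (FF_diff χ)
    have a2 : AnalyticOnNhd ℂ (fun s => (s - 1) * s * mellin w (-s) + κ * s) {s : ℂ | 0 < s.re} := by
      apply DifferentiableOn.analyticOnNhd _ hopen
      intro s hs
      have := (hmd s hs).comp s (differentiableAt_id.neg)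
      apply DifferentiableAt.differentiableWithinAt
      exact (((differentiableAt_id.sub_const 1).mul differentiableAt_id).mul this).add
        (differentiableAt_id.const_mul κ)
    have hpre : IsPreconnected {s : ℂ | 0 < s.re} := (convex_halfSpace_re_gt 0).isPreconnected
    have := a1.eqOn_of_preconnected_of_eventuallyEq a2 hpre (z₀ := 2) (by simp) (by
      have : {s : ℂ | 1 < s.re} ∈ 𝓝 (2:ℂ) :=
        (isOpen_lt continuous_const continuous_re).mem_nhds (by simp)
      filter_upwards [this] with s hs
      have hs1 : s ≠ 1 := by
        rintro rfl; simp at hs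
      rw [← hform s hs, FF_eq χ hs1, ← mul_assoc, ← pow_add]
      congr 1
      have : 1 - ee χ + ee χ = 1 := by unfold ee; split_ifs <;> rfl
      rw [this, pow_one])
    exact fun s hs => this hs
  set M := (C + ‖κ‖) * (10 / 3) with hM
  have hmb' : ∀ s : ℂ, 3 / 10 ≤ s.re → ‖mellin w (-s)‖ ≤ M := by
    intro s hs
    refine (hmb s (by linarith)).trans ?_
    rw [hM]
    refine mul_le_mul_of_nonneg_left ?_ (by positivity)
    rw [div_le_iff₀ (by linarith)]; linarith
  have hM0 : 0 < M := by positivity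
  refine ⟨M + ‖κ‖, by positivity, fun s hs => ?_⟩
  have h1 := hmb' s hs
  have h2 := hext s (by linarith)
  have hn : ‖s - 1‖ ≤ 1 + ‖s‖ := by
    have := norm_sub_le s 1
    simp at this; linarith
  have hn0 := norm_nonneg s
  by_cases hχ : χ = 1
  · have : ee χ = 1 := by simp [ee, hχ]
    rw [this] at h2
    simp only [le_refl, tsub_eq_zero_of_le, pow_zero, one_mul] at h2
    rw [h2]
    calc _ ≤ ‖s - 1‖ * ‖s‖ * ‖mellin w (-s)‖ + ‖κ‖ * ‖s‖ := by
          refine (norm_add_le _ _).trans ?_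
          simp only [norm_mul]; rfl
      _ ≤ (1 + ‖s‖) * (1 + ‖s‖) * M + ‖κ‖ * (1 + ‖s‖) ^ 2 := by
          gcongr
          · linarith
          · nlinarith
      _ = _ := by ring
  · have he : ee χ = 0 := by simp [ee, hχ]
    have hL : ∀ s : ℂ, 0 < s.re → FF χ s = s * mellin w (-s) := by
      have hopen : IsOpen {s : ℂ | 0 < s.re} := isOpen_lt continuous_const continuous_re
      have hd : DifferentiableOn ℂ (fun s => s * mellin w (-s)) {s : ℂ | 0 < s.re} := by
        intro s hs
        have := (hmd s hs).comp s (differentiableAt_id.neg)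
        exact (differentiableAt_id.mul this).differentiableWithinAt
      have := (FF_diff χ).differentiableOn.analyticOnNhd hopen |>.eqOn_of_preconnected_of_eventuallyEq
        (hd.analyticOnNhd hopen) (convex_halfSpace_re_gt 0).isPreconnected (z₀ := 2) (by simp) (by
        have : {s : ℂ | 1 < s.re} ∈ 𝓝 (2:ℂ) :=
          (isOpen_lt continuous_const continuous_re).mem_nhds (by simp)
        filter_upwards [this] with s hs
        have hs1 : s - 1 ≠ 0 := by
          intro h
          have : s = 1 := by linear_combination h
          rw [this] at hs; simp at hs
        have := hext s (lt_trans one_pos hs)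
        rw [he, hκ hχ] at this
        apply mul_left_cancel₀ hs1
        simp at this
        linear_combination this)
      exact fun s hs => this hs
    rw [hL s (by linarith), norm_mul]
    calc _ ≤ (1 + ‖s‖) * M := by gcongr; linarith
      _ ≤ _ := by nlinarith [norm_nonneg κ, mul_nonneg hM0.le hn0, mul_nonneg (norm_nonneg κ) (sq_nonneg (1 + ‖s‖)), mul_nonneg hM0.le (mul_nonneg hn0 hn0)]

end S12

namespace S12

structure Good (F : ℂ → ℂ) (β : ℝ) : Prop where
  diff : Differentiable ℂ F
  bound : ∃ C : ℝ, 0 < C ∧ ∀ s : ℂ, 3 / 10 ≤ s.re → ‖F s‖ ≤ C * (1 + ‖s‖) ^ 2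
  low : ∃ c : ℝ, 0 < c ∧ ∀ τ : ℝ, c ≤ ‖F (2 + τ * I)‖
  nz : ∀ s : ℂ, β < s.re → F s ≠ 0
  right : ∃ B : ℝ, ∀ s : ℂ, 2 ≤ s.re → ‖logDeriv F s‖ ≤ B
  half_le : 1 / 2 ≤ β
  le_one : β ≤ 1

lemma LSeries_bdd {f : ℕ → ℂ} (hf : LSeriesSummable f 2) :
    ∃ B : ℝ, 0 < B ∧ ∀ s : ℂ, 2 ≤ s.re → ‖LSeries f s‖ ≤ B := by
  refine ⟨1 + ∑' n, ‖LSeries.term f 2 n‖, by positivity, fun s hs => ?_⟩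
  have h1 : ∀ n, ‖LSeries.term f s n‖ ≤ ‖LSeries.term f 2 n‖ := fun n =>
    LSeries.norm_term_le_of_re_le_re f (by simpa using hs) n
  have h2 := tsum_of_norm_bounded hf.norm.hasSum h1
  have : LSeries f s = ∑' n, LSeries.term f s n := rfl
  rw [this]; linarith

lemma FF_logDeriv {q : ℕ} [NeZero q] (χ : DirichletCharacter ℂ q) {s : ℂ} (hs : 1 < s.re) :
    logDeriv (FF χ) s = ee χ / (s - 1) -
      LSeries (fun n : ℕ => χ (n : ZMod q) * (ArithmeticFunction.vonMangoldt n : ℂ)) s := by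
  have hs1 : s ≠ 1 := by rintro rfl; simp at hs
  have e : LSeries (fun n : ℕ => χ (n : ZMod q) * (ArithmeticFunction.vonMangoldt n : ℂ)) s =
      -deriv (LSeries (fun n : ℕ => χ (n : ZMod q))) s / LSeries (fun n : ℕ => χ (n : ZMod q)) s :=
    DirichletCharacter.LSeries_twist_vonMangoldt_eq χ hs
  have hev : FF χ =ᶠ[𝓝 s] fun s => (s - 1) ^ (ee χ) * χ.LFunction s := by
    filter_upwards [isOpen_ne.mem_nhds hs1] with z hz
    exact FF_eq χ hz
  have hL0 : χ.LFunction s ≠ 0 :=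
    DirichletCharacter.LFunction_ne_zero_of_one_le_re χ (.inr hs1) hs.le
  have hld : logDeriv (FF χ) s = logDeriv (fun s => (s - 1) ^ (ee χ) * χ.LFunction s) s := by
    rw [logDeriv_apply, logDeriv_apply, hev.deriv_eq, hev.eq_of_nhds]
  have hmul := logDeriv_mul (f := fun s : ℂ => (s - 1) ^ (ee χ)) (g := χ.LFunction) s
    (pow_ne_zero _ (sub_ne_zero.mpr hs1)) hL0 (by fun_prop)
    (DirichletCharacter.differentiableAt_LFunction χ s (.inl hs1))
  rw [hld, hmul, e]
  have h1 : logDeriv (fun s : ℂ => (s - 1) ^ (ee χ)) s = ee χ / (s - 1) := by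
    have := logDeriv_fun_pow (f := fun s : ℂ => s - 1) (x := s) (by fun_prop) (ee χ)
    rw [this, logDeriv_apply]
    simp [div_eq_mul_inv]
  rw [h1, logDeriv_apply, ← DirichletCharacter.deriv_LFunction_eq_deriv_LSeries χ hs,
    ← DirichletCharacter.LFunction_eq_LSeries χ hs]
  ring

lemma FF_good {q : ℕ} [NeZero q] (χ : DirichletCharacter ℂ q) {β : ℝ} (h1 : 1 / 2 ≤ β) (h2 : β ≤ 1)
    (hnz : ∀ s : ℂ, β < s.re → FF χ s ≠ 0) : Good (FF χ) β := by
  refine ⟨FF_diff χ, FF_bound χ, ?_, hnz, ?_, h1, h2⟩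
  · have hsum : LSeriesSummable ((fun n : ℕ => χ (n : ZMod q)) * (fun n : ℕ => (ArithmeticFunction.moebius n : ℂ))) 2 :=
      DirichletCharacter.LSeriesSummable_mul χ
        (ArithmeticFunction.LSeriesSummable_moebius_iff.mpr (by simp))
    obtain ⟨B, hB, hb⟩ := LSeries_bdd hsum
    refine ⟨B⁻¹, by positivity, fun τ => ?_⟩
    have hre : (2 + τ * I : ℂ).re = 2 := by simp
    have hs1 : (2 + τ * I : ℂ) ≠ 1 := by
      intro h; rw [h] at hre; simp at hre
    have hm := DirichletCharacter.LSeries.mul_mu_eq_one χ (s := 2 + τ * I) (by rw [hre]; norm_num)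
    rw [← DirichletCharacter.LFunction_eq_LSeries χ (by rw [hre]; norm_num)] at hm
    have hm2 := congrArg norm hm
    rw [norm_mul, norm_one] at hm2
    have hb2 := hb (2 + τ * I) (by rw [hre])
    have hL : B⁻¹ ≤ ‖χ.LFunction (2 + τ * I)‖ := by
      rw [inv_le_iff_one_le_mul₀ hB, ← hm2]
      exact mul_le_mul_of_nonneg_left hb2 (norm_nonneg _)
    rw [FF_eq χ hs1, norm_mul, norm_pow]
    refine hL.trans (le_mul_of_one_le_left (norm_nonneg _) ?_)
    apply one_le_pow₀
    have := Complex.abs_re_le_norm (2 + τ * I - 1)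
    simp at this
    norm_num at this
    exact this
  · have hsum : LSeriesSummable (fun n : ℕ => χ (n : ZMod q) * (ArithmeticFunction.vonMangoldt n : ℂ)) 2 :=
      DirichletCharacter.LSeriesSummable_twist_vonMangoldt χ (by simp)
    obtain ⟨B, hB, hb⟩ := LSeries_bdd hsum
    refine ⟨1 + B, fun s hs => ?_⟩
    rw [FF_logDeriv χ (by linarith)]
    refine (norm_sub_le _ _).trans (add_le_add ?_ (hb s hs))
    rw [norm_div]
    have h3 : 1 ≤ ‖s - 1‖ := by
      have := Complex.abs_re_le_norm (s - 1)
      have h4 : 1 ≤ |(s - 1).re| := by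
        rw [sub_re, one_re, abs_of_nonneg (by linarith)]; linarith
      linarith
    rw [div_le_one (by linarith)]
    refine le_trans ?_ h3
    unfold ee; split_ifs <;> simp

lemma log_le_aux {a : ℝ} (ha : 0 < a) : ∃ K : ℝ, 0 < K ∧ ∀ x : ℝ, 0 ≤ x →
    Real.log (a * (x + 5) ^ 2) + 1 ≤ K * Real.log (x + 4) := by
  refine ⟨|Real.log a| + 1 + 4, by positivity, fun x hx => ?_⟩
  have h1 : 1 ≤ Real.log (x + 4) := by
    rw [Real.le_log_iff_exp_le (by linarith)]
    linarith [Real.exp_one_lt_d9]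
  have h2 : Real.log (x + 5) ≤ 2 * Real.log (x + 4) := by
    rw [show (2:ℝ) * Real.log (x + 4) = Real.log ((x + 4) ^ 2) by rw [Real.log_pow]; norm_num]
    apply Real.log_le_log (by linarith); nlinarith
  rw [Real.log_mul ha.ne' (by positivity), Real.log_pow]
  push_cast
  have := le_abs_self (Real.log a)
  nlinarith [abs_nonneg (Real.log a)]

lemma Good.local {F : ℂ → ℂ} {β : ℝ} (hF : Good F β) :
    ∃ K : ℝ, 0 < K ∧ ∀ τ : ℝ, ∃ Z : Multiset ℂ, (∀ ρ ∈ Z, ρ.re ≤ β) ∧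
      (Multiset.card Z : ℝ) ≤ K * Real.log (|τ| + 4) ∧
      ∀ s : ℂ, ‖s - (2 + τ * I)‖ ≤ 8 / 5 → F s ≠ 0 →
        ‖logDeriv F s - (Z.map (fun ρ => 1 / (s - ρ))).sum‖ ≤ K * Real.log (|τ| + 4) := by
  obtain ⟨C, hC, hb⟩ := hF.bound
  obtain ⟨c, hc, hl⟩ := hF.low
  obtain ⟨K, hK, hloc⟩ := local_logDeriv (r := 8/5) (r₁ := 33/20) (R := 17/10) (R' := 7/4)
    (by norm_num) (by norm_num) (by norm_num) (by norm_num)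
  obtain ⟨K2, hK2, hlog⟩ := log_le_aux (a := C / c) (by positivity)
  refine ⟨K * K2, by positivity, fun τ => ?_⟩
  set M := C * (|τ| + 5) ^ 2
  have hbig : K * (Real.log (M / ‖F (2 + τ * I)‖) + 1) ≤ K * K2 * Real.log (|τ| + 4) := by
    rw [mul_assoc]
    gcongr
    refine le_trans ?_ (hlog |τ| (abs_nonneg _))
    gcongr Real.log ?_ + 1
    · have := hl τ
      have : 0 < ‖F (2 + τ * I)‖ := by linarith
      positivity
    · rw [show C / c * (|τ| + 5) ^ 2 = M / c by simp only [M]; ring]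
      have := hl τ
      gcongr
  obtain ⟨Z, hZ1, hZ2, hZ3⟩ := hloc (fun z => F (z + (2 + τ * I))) M
    ((hF.diff.comp (differentiable_id.add_const _)).differentiableOn) (by
      intro z hz
      have hz' : ‖z‖ ≤ 17/10 := by simpa using hz
      have hzre : |z.re| ≤ 17/10 := (Complex.abs_re_le_norm z).trans hz'
      refine (hb _ ?_).trans ?_
      · simp; linarith [(abs_le.mp hzre).1]
      · have hn : ‖z + (2 + τ * I)‖ ≤ 17/10 + (2 + |τ|) := by
          refine (norm_add_le _ _).trans (add_le_add hz' ((norm_add_le _ _).trans ?_))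
          simp
        simp only [M]
        have h7 : 1 + ‖z + (2 + τ * I)‖ ≤ |τ| + 5 := by linarith
        gcongr) (by
      simp only [zero_add]
      intro h
      have := hl τ
      rw [h, norm_zero] at this; linarith)
  simp only [zero_add] at hZ2 hZ3
  refine ⟨Z.map (fun ρ => ρ + (2 + τ * I)), ?_, ?_, ?_⟩
  · intro ρ hρ
    obtain ⟨ρ', h', rfl⟩ := Multiset.mem_map.mp hρ
    by_contra hcon
    exact hF.nz _ (not_le.mp hcon) (hZ1 ρ' h').2
  · rw [Multiset.card_map]; exact hZ2.trans hbig
  · intro s hs hs0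
    have := hZ3 (s - (2 + τ * I)) hs (by simpa using hs0)
    rw [Multiset.map_map]
    have e : logDeriv (fun z => F (z + (2 + τ * I))) (s - (2 + τ * I)) = logDeriv F s := by
      rw [logDeriv_apply, logDeriv_apply, deriv_comp_add_const]; simp
    rw [e] at this
    refine le_trans (le_of_eq ?_) (this.trans hbig)
    congr 3
    apply Multiset.map_congr rfl
    intro ρ _
    simp only [Function.comp]
    congr 1; ring

end S12

namespace S12

lemma multiset_cs (Z : Multiset ℂ) (f : ℂ → ℂ) :
    ‖(Z.map f).sum‖ ^ 2 ≤ Multiset.card Z * (Z.map (fun ρ => ‖f ρ‖ ^ 2)).sum := by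
  induction Z using Multiset.induction_on with
  | empty => simp
  | cons a Z ih =>
    simp only [Multiset.map_cons, Multiset.sum_cons, Multiset.card_cons]
    push_cast
    have hQ : 0 ≤ (Z.map (fun ρ => ‖f ρ‖ ^ 2)).sum :=
      Multiset.sum_nonneg (by simp only [Multiset.mem_map]; rintro _ ⟨ρ, _, rfl⟩; positivity)
    generalize (Z.map (fun ρ => ‖f ρ‖ ^ 2)).sum = Q at *
    have h1 := norm_add_le (f a) (Z.map f).sum
    generalize hS : ‖(Z.map f).sum‖ = S at *
    have hS0 : 0 ≤ S := hS ▸ norm_nonneg _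
    generalize hA : ‖f a‖ = A at *
    have hA0 : 0 ≤ A := hA ▸ norm_nonneg _
    have hn : (0:ℝ) ≤ Multiset.card Z := Nat.cast_nonneg _
    generalize (Multiset.card Z : ℝ) = n at *
    have h2 : 2 * A * S ≤ n * A ^ 2 + Q := by
      refine abs_le_of_sq_le_sq' ?_ (by positivity) |>.2
      nlinarith [mul_le_mul_of_nonneg_left ih (sq_nonneg A), sq_nonneg (n * A ^ 2 - Q)]
    calc ‖f a + (Z.map f).sum‖ ^ 2 ≤ (A + S) ^ 2 := by gcongr
      _ ≤ _ := by nlinarith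

lemma lint_cauchy {σ : ℝ} (hσ : 0 < σ) (γ : ℝ) :
    ∫⁻ t : ℝ, ENNReal.ofReal (1 / (σ ^ 2 + (t - γ) ^ 2)) = ENNReal.ofReal (Real.pi / σ) := by
  have e : ∀ t : ℝ, 1 / (σ ^ 2 + (t - γ) ^ 2) = (1 / σ ^ 2) * (1 + (σ⁻¹ * (t - γ)) ^ 2)⁻¹ := by
    intro t
    have : 0 < σ ^ 2 + (t - γ) ^ 2 := by positivity
    field_simp
  have hi : Integrable (fun t : ℝ => (1 / σ ^ 2) * (1 + (σ⁻¹ * (t - γ)) ^ 2)⁻¹) := by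
    apply Integrable.const_mul
    exact ((integrable_inv_one_add_sq.comp_mul_left' (inv_ne_zero hσ.ne')).comp_sub_right γ)
  simp_rw [e]
  rw [← ofReal_integral_eq_lintegral_ofReal hi (ae_of_all _ fun t => by positivity)]
  congr 1
  rw [integral_const_mul, integral_sub_right_eq_self (fun t : ℝ => (1 + (σ⁻¹ * t) ^ 2)⁻¹) γ,
    Measure.integral_comp_mul_left (fun t : ℝ => (1 + t ^ 2)⁻¹) σ⁻¹, integral_univ_inv_one_add_sq,
    inv_inv, abs_of_pos hσ]
  simp only [smul_eq_mul]
  field_simp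

lemma lint_msum {σ : ℝ} (hσ : 0 < σ) (Z : Multiset ℂ) :
    ∫⁻ t : ℝ, ENNReal.ofReal ((Z.map (fun ρ => 1 / (σ ^ 2 + (t - ρ.im) ^ 2))).sum) =
      ENNReal.ofReal (Multiset.card Z * (Real.pi / σ)) := by
  induction Z using Multiset.induction_on with
  | empty => simp
  | cons a Z ih =>
    simp only [Multiset.map_cons, Multiset.sum_cons, Multiset.card_cons]
    push_cast
    have hQ : ∀ t : ℝ, 0 ≤ (Z.map (fun ρ => 1 / (σ ^ 2 + (t - ρ.im) ^ 2))).sum := fun t =>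
      Multiset.sum_nonneg (by simp only [Multiset.mem_map]; rintro _ ⟨ρ, _, rfl⟩; positivity)
    have hpi := Real.pi_pos
    simp_rw [fun t : ℝ => ENNReal.ofReal_add
      (show 0 ≤ 1 / (σ ^ 2 + (t - a.im) ^ 2) by positivity) (hQ t)]
    rw [lintegral_add_left (by fun_prop), ih, lint_cauchy hσ, add_mul, one_mul,
      ENNReal.ofReal_add (by positivity) (by positivity), add_comm]

lemma Good.L2 {F : ℂ → ℂ} {β : ℝ} (hF : Good F β) :
    ∃ K : ℝ, 0 < K ∧ ∀ τ σ : ℝ, 0 < σ → σ ≤ 1 →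
      ∫⁻ t in Set.Icc (τ - 1 / 2) (τ + 1 / 2), ENNReal.ofReal (‖logDeriv F (β + σ + t * I)‖ ^ 2) ≤
        ENNReal.ofReal (K * Real.log (|τ| + 4) ^ 2 / σ) := by
  obtain ⟨K, hK, hloc⟩ := hF.local
  have hpi := Real.pi_pos
  refine ⟨2 * K ^ 2 + 2 * K ^ 2 * Real.pi, by positivity, fun τ σ hσ hσ1 => ?_⟩
  obtain ⟨Z, hZ1, hZ2, hZ3⟩ := hloc τ
  set ℓ := Real.log (|τ| + 4)
  have hb1 := hF.half_le
  have hb2 := hF.le_one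
  have hℓ : 0 ≤ ℓ := Real.log_nonneg (by linarith [abs_nonneg τ])
  have hpt : ∀ t ∈ Set.Icc (τ - 1 / 2) (τ + 1 / 2), ‖logDeriv F (β + σ + t * I)‖ ^ 2 ≤
      2 * (K * ℓ) ^ 2 + 2 * (K * ℓ) * (Z.map (fun ρ => 1 / (σ ^ 2 + (t - ρ.im) ^ 2))).sum := by
    intro t ht
    have hsr : (β + σ + t * I : ℂ).re = β + σ := by simp
    have hsi : (β + σ + t * I : ℂ).im = t := by simp
    generalize (β + σ + t * I : ℂ) = s at *
    have hd : ‖s - (2 + τ * I)‖ ≤ 8 / 5 := by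
      rw [Complex.norm_eq_sqrt_sq_add_sq]
      apply Real.sqrt_le_iff.mpr ⟨by norm_num, ?_⟩
      simp [hsr, hsi]
      nlinarith [ht.1, ht.2]
    have hs0 : F s ≠ 0 := hF.nz s (by rw [hsr]; linarith)
    have h1 := hZ3 s hd hs0
    have h2 := multiset_cs Z (fun ρ => 1 / (s - ρ))
    have h3 : (Z.map (fun ρ => ‖1 / (s - ρ)‖ ^ 2)).sum ≤
        (Z.map (fun ρ => 1 / (σ ^ 2 + (t - ρ.im) ^ 2))).sum := by
      apply Multiset.sum_map_le_sum_map
      intro ρ hρ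
      rw [norm_div, norm_one, div_pow, one_pow, Complex.sq_norm, Complex.normSq_apply]
      have h4 := hZ1 ρ hρ
      simp only [sub_re, sub_im, hsr, hsi]
      apply one_div_le_one_div_of_le (by positivity)
      nlinarith
    have hQ : 0 ≤ (Z.map (fun ρ => ‖1 / (s - ρ)‖ ^ 2)).sum :=
      Multiset.sum_nonneg (by simp only [Multiset.mem_map]; rintro _ ⟨ρ, _, rfl⟩; positivity)
    have h5 : ‖logDeriv F s‖ ≤ K * ℓ + ‖(Z.map (fun ρ => 1 / (s - ρ))).sum‖ := by
      have := norm_sub_norm_le (logDeriv F s) (Z.map (fun ρ => 1 / (s - ρ))).sum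
      linarith
    have h6 : ‖(Z.map (fun ρ => 1 / (s - ρ))).sum‖ ^ 2 ≤
        (K * ℓ) * (Z.map (fun ρ => 1 / (σ ^ 2 + (t - ρ.im) ^ 2))).sum := by
      refine h2.trans (mul_le_mul hZ2 h3 hQ (by positivity))
    calc ‖logDeriv F s‖ ^ 2 ≤ (K * ℓ + ‖(Z.map (fun ρ => 1 / (s - ρ))).sum‖) ^ 2 := by gcongr
      _ ≤ _ := by nlinarith [sq_nonneg (K * ℓ - ‖(Z.map (fun ρ => 1 / (s - ρ))).sum‖)]
  have hQ : ∀ t : ℝ, 0 ≤ (Z.map (fun ρ => 1 / (σ ^ 2 + (t - ρ.im) ^ 2))).sum := fun t =>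
    Multiset.sum_nonneg (by simp only [Multiset.mem_map]; rintro _ ⟨ρ, _, rfl⟩; positivity)
  calc _ ≤ ∫⁻ t in Set.Icc (τ - 1 / 2) (τ + 1 / 2), (ENNReal.ofReal (2 * (K * ℓ) ^ 2) +
        ENNReal.ofReal (2 * (K * ℓ)) * ENNReal.ofReal ((Z.map (fun ρ => 1 / (σ ^ 2 + (t - ρ.im) ^ 2))).sum)) := by
        apply setLIntegral_mono' measurableSet_Icc
        intro t ht
        rw [← ENNReal.ofReal_mul (by positivity), ← ENNReal.ofReal_add (by positivity)
          (mul_nonneg (by positivity) (hQ t))]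
        exact ENNReal.ofReal_le_ofReal (hpt t ht)
    _ ≤ ENNReal.ofReal (2 * (K * ℓ) ^ 2) + ENNReal.ofReal (2 * (K * ℓ)) *
        ENNReal.ofReal (Multiset.card Z * (Real.pi / σ)) := by
        rw [lintegral_add_left (by fun_prop)]
        apply add_le_add
        · simp only [lintegral_const, MeasurableSet.univ, Measure.restrict_apply, Set.univ_inter,
            Real.volume_Icc]
          apply le_of_eq
          rw [show τ + 1 / 2 - (τ - 1 / 2) = 1 by ring]; simp
        · rw [lintegral_const_mul' _ _ ENNReal.ofReal_ne_top]
          gcongr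
          rw [← lint_msum hσ]
          exact setLIntegral_le_lintegral _ _
    _ ≤ _ := by
        rw [← ENNReal.ofReal_mul (by positivity), ← ENNReal.ofReal_add (by positivity) (by positivity)]
        apply ENNReal.ofReal_le_ofReal
        have h7 : (Multiset.card Z : ℝ) * (Real.pi / σ) ≤ K * ℓ * (Real.pi / σ) := by gcongr
        have h8 : 2 * (K * ℓ) ^ 2 ≤ 2 * (K * ℓ) ^ 2 / σ := by
          rw [le_div_iff₀ hσ]; nlinarith [sq_nonneg (K * ℓ)]
        calc _ ≤ 2 * (K * ℓ) ^ 2 / σ + 2 * (K * ℓ) * (K * ℓ * (Real.pi / σ)) := by gcongr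
          _ = _ := by ring

lemma Good.L3 {F : ℂ → ℂ} {β : ℝ} (hF : Good F β) {δ : ℝ} (hδ : 0 < δ) :
    ∃ K : ℝ, 0 < K ∧ ∀ s : ℂ, β + δ ≤ s.re → ‖logDeriv F s‖ ≤ K * Real.log (|s.im| + 4) := by
  obtain ⟨K, hK, hloc⟩ := hF.local
  obtain ⟨B, hB⟩ := hF.right
  have hb1 := hF.half_le
  have hb2 := hF.le_one
  refine ⟨K * (1 + 1 / δ) + |B|, by positivity, fun s hs => ?_⟩
  have hℓ1 : 1 ≤ Real.log (|s.im| + 4) := by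
    rw [Real.le_log_iff_exp_le (by positivity)]
    linarith [Real.exp_one_lt_d9, abs_nonneg s.im]
  set ℓ := Real.log (|s.im| + 4)
  rcases le_total 2 s.re with h2 | h2
  · have : |B| ≤ |B| * ℓ := le_mul_of_one_le_right (abs_nonneg _) hℓ1
    have h3 := hB s h2
    have h4 : 0 ≤ K * (1 + 1 / δ) * ℓ := by positivity
    have := le_abs_self B
    linarith
  · obtain ⟨Z, hZ1, hZ2, hZ3⟩ := hloc s.im
    have hd : ‖s - (2 + s.im * I)‖ ≤ 8 / 5 := by
      rw [Complex.norm_eq_sqrt_sq_add_sq]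
      apply Real.sqrt_le_iff.mpr ⟨by norm_num, ?_⟩
      simp
      nlinarith
    have h1 := hZ3 s hd (hF.nz s (by linarith))
    have h4 : ‖(Z.map (fun ρ => 1 / (s - ρ))).sum‖ ≤ Multiset.card Z * (1 / δ) := by
      clear hZ2 hZ3 h1
      induction Z using Multiset.induction_on with
      | empty => simp
      | cons a Z ih =>
        simp only [Multiset.map_cons, Multiset.sum_cons, Multiset.card_cons]
        push_cast
        rw [add_mul, one_mul, add_comm (_ * _)]
        refine (norm_add_le _ _).trans (add_le_add ?_ (ih fun ρ hρ => hZ1 ρ (Multiset.mem_cons_of_mem hρ)))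
        rw [norm_div, norm_one]
        apply one_div_le_one_div_of_le hδ
        have := Complex.abs_re_le_norm (s - a)
        have h5 := hZ1 a (Multiset.mem_cons_self a Z)
        rw [sub_re] at this
        have := le_abs_self (s.re - a.re)
        linarith
    have h5 : (Multiset.card Z : ℝ) * (1 / δ) ≤ K * ℓ * (1 / δ) := by gcongr
    have := norm_sub_norm_le (logDeriv F s) (Z.map (fun ρ => 1 / (s - ρ))).sum
    have h6 : 0 ≤ |B| * ℓ := by positivity
    nlinarith

lemma summable_log_sq : Summable (fun k : ℕ => Real.log (k + 4) ^ 2 / (k:ℝ) ^ 2) := by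
  have h := (Real.summable_nat_rpow_inv (p := 3/2)).mpr (by norm_num)
  refine Summable.of_nonneg_of_le (fun k => by positivity) (fun k => ?_) (h.mul_left 80)
  rcases Nat.eq_zero_or_pos k with rfl | hk
  · simp
  have hk1 : (1:ℝ) ≤ k := by exact_mod_cast hk
  have hk0 : (0:ℝ) < k := by linarith
  have h1 : Real.log (k + 4) ≤ (k + 4 : ℝ) ^ (1/4 : ℝ) / (1/4) :=
    Real.log_le_rpow_div (by linarith) (by norm_num)
  have h0 : 0 ≤ Real.log (k + 4) := Real.log_nonneg (by linarith)
  have h2 : ((k + 4 : ℝ) ^ (1/4 : ℝ)) ^ 2 = (k + 4 : ℝ) ^ (1/2 : ℝ) := by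
    rw [← Real.rpow_natCast, ← Real.rpow_mul (by linarith)]; norm_num
  have h3 : (k + 4 : ℝ) ^ (1/2 : ℝ) ≤ 5 * (k:ℝ) ^ (1/2 : ℝ) := by
    calc (k + 4 : ℝ) ^ (1/2 : ℝ) ≤ (25 * k : ℝ) ^ (1/2 : ℝ) := by
          apply Real.rpow_le_rpow <;> linarith
      _ = 5 * (k:ℝ) ^ (1/2 : ℝ) := by
          rw [Real.mul_rpow (by norm_num) (by linarith)]
          congr 1
          rw [show (25:ℝ) = 5 ^ (2:ℝ) by norm_num, ← Real.rpow_mul (by norm_num)]; norm_num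
  have h4 : Real.log (k + 4) ^ 2 ≤ 80 * (k:ℝ) ^ (1/2 : ℝ) := by
    calc Real.log (k + 4) ^ 2 ≤ ((k + 4 : ℝ) ^ (1/4 : ℝ) / (1/4)) ^ 2 := by gcongr
      _ = 16 * (k + 4 : ℝ) ^ (1/2 : ℝ) := by rw [← h2]; ring
      _ ≤ _ := by linarith
  rw [div_le_iff₀ (by positivity)]
  refine h4.trans (le_of_eq ?_)
  rw [mul_assoc]
  congr 1
  rw [← Real.rpow_neg hk0.le, ← Real.rpow_natCast, ← Real.rpow_add hk0]
  norm_num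

lemma Good.tail {F : ℂ → ℂ} {β : ℝ} (hF : Good F β) {η : ℝ} (hη : 0 < η) :
    ∃ T₀ : ℝ, 0 < T₀ ∧ ∀ σ : ℝ, 0 < σ → σ ≤ 1 →
      ∫⁻ t in {t : ℝ | T₀ ≤ |t|},
        ENNReal.ofReal (‖logDeriv F (β + σ + t * I) / (β + σ + t * I)‖ ^ 2) ≤ ENNReal.ofReal (η / σ) := by
  obtain ⟨K, hK, hL⟩ := hF.L2
  set u : ℕ → ℝ := fun k => 8 * K * (Real.log (k + 4) ^ 2 / (k:ℝ) ^ 2) with hu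
  have hus : Summable u := summable_log_sq.mul_left _
  have hu0 : ∀ k, 0 ≤ u k := fun k => by simp only [hu]; positivity
  have htail := tendsto_sum_nat_add u
  obtain ⟨n, hn1, hn⟩ := ((eventually_ge_atTop 1).and (htail.eventually_lt_const hη)).exists
  refine ⟨n, by exact_mod_cast hn1, fun σ hσ hσ1 => ?_⟩
  set B : ℕ → Set ℝ := fun j => Set.Icc (((n + j : ℕ) : ℝ) - 1 / 2) (((n + j : ℕ) : ℝ) + 1 / 2) ∪
    Set.Icc (-((n + j : ℕ) : ℝ) - 1 / 2) (-((n + j : ℕ) : ℝ) + 1 / 2) with hB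
  have hsub : {t : ℝ | (n:ℝ) ≤ |t|} ⊆ ⋃ j, B j := by
    intro t ht
    have ht' : (n:ℝ) ≤ |t| := ht
    have h1 : n ≤ ⌊|t| + 1/2⌋₊ := Nat.le_floor (by linarith)
    obtain ⟨j, hj⟩ := Nat.exists_eq_add_of_le h1
    have h2 : ((n + j : ℕ) : ℝ) ≤ |t| + 1/2 := by rw [← hj]; exact Nat.floor_le (by positivity)
    have h3 : |t| + 1/2 < ((n + j : ℕ) : ℝ) + 1 := by rw [← hj]; exact Nat.lt_floor_add_one _
    refine Set.mem_iUnion.mpr ⟨j, ?_⟩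
    rcases abs_cases t with ⟨h, _⟩ | ⟨h, _⟩
    · left; constructor <;> linarith
    · right; constructor <;> linarith
  set f : ℝ → ENNReal := fun t =>
    ENNReal.ofReal (‖logDeriv F (β + σ + t * I) / (β + σ + t * I)‖ ^ 2) with hf
  have hpiece : ∀ k : ℕ, 1 ≤ k → ∀ τ : ℝ, |τ| = k → ∫⁻ t in Set.Icc (τ - 1/2) (τ + 1/2), f t ≤
      ENNReal.ofReal (u k / 2 / σ) := by
    intro k hk τ hτ
    have hk1 : (1:ℝ) ≤ k := by exact_mod_cast hk
    calc _ ≤ ∫⁻ t in Set.Icc (τ - 1/2) (τ + 1/2), ENNReal.ofReal (4 / (k:ℝ)^2) *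
          ENNReal.ofReal (‖logDeriv F (β + σ + t * I)‖ ^ 2) := by
          apply setLIntegral_mono' measurableSet_Icc
          intro t ht
          simp only [hf]
          rw [← ENNReal.ofReal_mul (by positivity)]
          apply ENNReal.ofReal_le_ofReal
          have h1 : (k:ℝ) / 2 ≤ ‖(β + σ + t * I : ℂ)‖ := by
            have h2 := Complex.abs_im_le_norm (β + σ + t * I : ℂ)
            simp only [add_im, ofReal_im, mul_im, ofReal_re, I_im, mul_one, I_re, mul_zero, add_zero,
              zero_add] at h2
            have h3 := abs_sub_abs_le_abs_sub τ t
            have h4 : |τ - t| ≤ 1/2 := abs_le.mpr ⟨by linarith [ht.2], by linarith [ht.1]⟩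
            linarith
          rw [norm_div, div_pow, div_eq_mul_inv, mul_comm]
          gcongr
          rw [show (4:ℝ) / (k:ℝ)^2 = (((k:ℝ)/2)^2)⁻¹ by field_simp; norm_num]
          gcongr
      _ = ENNReal.ofReal (4 / (k:ℝ)^2) * ∫⁻ t in Set.Icc (τ - 1/2) (τ + 1/2),
          ENNReal.ofReal (‖logDeriv F (β + σ + t * I)‖ ^ 2) := lintegral_const_mul' _ _ (by simp)
      _ ≤ ENNReal.ofReal (4 / (k:ℝ)^2) * ENNReal.ofReal (K * Real.log (|τ| + 4) ^ 2 / σ) := by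
          gcongr; exact hL τ σ hσ hσ1
      _ = _ := by
          rw [← ENNReal.ofReal_mul (by positivity), hτ]
          congr 1
          simp only [hu]; ring
  calc ∫⁻ t in {t : ℝ | (n:ℝ) ≤ |t|}, f t ≤ ∫⁻ t in ⋃ j, B j, f t := lintegral_mono_set hsub
    _ ≤ ∑' j, ∫⁻ t in B j, f t := lintegral_iUnion_le _ _
    _ ≤ ∑' j, ENNReal.ofReal (u (j + n) / σ) := by
        apply ENNReal.tsum_le_tsum
        intro j
        refine (lintegral_union_le _ _ _).trans ?_
        have a1 := hpiece (n + j) (by omega) ((n + j : ℕ) : ℝ) (abs_of_nonneg (by positivity))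
        have a2 := hpiece (n + j) (by omega) (-((n + j : ℕ) : ℝ)) (by rw [abs_neg]; exact abs_of_nonneg (by positivity))
        refine (add_le_add a1 a2).trans (le_of_eq ?_)
        have := hu0 (n + j)
        rw [← ENNReal.ofReal_add (by positivity) (by positivity), add_comm j n]
        congr 1; ring
    _ = ENNReal.ofReal (∑' j, u (j + n) / σ) := by
        rw [ENNReal.ofReal_tsum_of_nonneg (fun j => div_nonneg (hu0 _) hσ.le)]
        exact ((summable_nat_add_iff n).mpr hus).div_const σ
    _ ≤ _ := by
        apply ENNReal.ofReal_le_ofReal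
        rw [tsum_div_const]
        gcongr

end S12

namespace S12

def cc (F : ℂ → ℂ) (β : ℝ) (τ : ℝ) : ℂ :=
  -(analyticOrderNatAt F (β + τ * I) : ℂ) / (β + τ * I)

lemma cc_zero {F : ℂ → ℂ} {β τ : ℝ} (h : cc F β τ ≠ 0) : F (β + τ * I) = 0 := by
  apply apply_eq_zero_of_analyticOrderNatAt_ne_zero (𝕜 := ℂ)
  intro h0
  apply h
  simp [cc, h0]

lemma Good.order_ne_top {F : ℂ → ℂ} {β : ℝ} (hF : Good F β) (τ : ℝ) :
    analyticOrderAt F (β + τ * I) ≠ ⊤ := by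
  rw [Ne, analyticOrderAt_eq_top]
  intro h
  have hc : Tendsto (fun x : ℝ => (β + τ * I + x : ℂ)) (𝓝[>] 0) (𝓝 (β + τ * I)) := by
    have : Tendsto (fun x : ℝ => (β + τ * I + x : ℂ)) (𝓝 0) (𝓝 (β + τ * I + (0:ℝ))) := by
      apply Continuous.tendsto; fun_prop
    simp only [ofReal_zero, add_zero] at this
    exact this.mono_left nhdsWithin_le_nhds
  obtain ⟨x, hx, hx0⟩ := ((hc.eventually h).and self_mem_nhdsWithin).exists
  exact hF.nz _ (by simpa using hx0) hx

lemma Good.ev_ne {F : ℂ → ℂ} {β : ℝ} (hF : Good F β) (τ : ℝ) :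
    ∀ᶠ z in 𝓝[≠] ((β : ℂ) + τ * I), F z ≠ 0 := by
  have ha : AnalyticAt ℂ F (β + τ * I) := hF.diff.analyticAt _
  rcases ha.eventually_eq_zero_or_eventually_ne_zero with h | h
  · exact absurd (analyticOrderAt_eq_top.mpr h) (hF.order_ne_top τ)
  · exact h

lemma Good.finite_zeros {F : ℂ → ℂ} {β : ℝ} (hF : Good F β) (T : ℝ) :
    {γ : ℝ | γ ∈ Set.Icc (-T) T ∧ F (β + γ * I) = 0}.Finite := by
  have : (Set.Icc (-T) T ∩ {γ : ℝ | F (β + γ * I) = 0}).Finite := by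
    refine IsCompact.induction_on (isCompact_Icc (a := -T) (b := T))
      (p := fun S => (S ∩ {γ : ℝ | F (β + γ * I) = 0}).Finite) (by simp)
      (fun s t hst ht => ht.subset (Set.inter_subset_inter_left _ hst))
      (fun s t hs ht => by rw [Set.union_inter_distrib_right]; exact hs.union ht) ?_
    intro τ _
    have hc : Tendsto (fun t : ℝ => (β + t * I : ℂ)) (𝓝[≠] τ) (𝓝[≠] (β + τ * I)) := by
      apply tendsto_nhdsWithin_of_tendsto_nhds_of_eventually_within
      · have : ContinuousAt (fun t : ℝ => (β + t * I : ℂ)) τ := by fun_prop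
        exact this.tendsto.mono_left nhdsWithin_le_nhds
      · filter_upwards [self_mem_nhdsWithin] with t ht
        simpa using ht
    have h := hc.eventually (hF.ev_ne τ)
    rw [eventually_nhdsWithin_iff] at h
    refine ⟨_, mem_nhdsWithin_of_mem_nhds h, ?_⟩
    apply (Set.finite_singleton τ).subset
    rintro t ⟨ht1, ht2⟩
    by_contra hne
    exact ht1 hne ht2
  exact this

lemma Good.local_bdd {F : ℂ → ℂ} {β : ℝ} (hF : Good F β) (τ : ℝ) :
    ∃ B : ℝ, ∀ᶠ z in 𝓝[≠] ((β : ℂ) + τ * I),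
      ‖-(logDeriv F z / z) - cc F β τ / (z - (β + τ * I))‖ ≤ B := by
  set w : ℂ := β + τ * I with hw
  have hw0 : w ≠ 0 := by
    intro h
    have := congrArg Complex.re h
    simp [hw] at this
    have := hF.half_le
    linarith
  have ha : AnalyticAt ℂ F w := hF.diff.analyticAt _
  obtain ⟨g, hg, hg0, hgF⟩ := (ha.analyticOrderNatAt_eq_iff (hF.order_ne_top τ)).mp rfl
  set n := analyticOrderNatAt F w with hn
  have hcc : cc F β τ = -(n:ℂ) / w := rfl
  have hcont : ContinuousAt (fun z => (n:ℂ) / (z * w) - logDeriv g z / z) w := by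
    have h1 : ContinuousAt (logDeriv g) w := by
      have : logDeriv g = fun z => deriv g z / g z := by ext z; rw [logDeriv_apply]
      rw [this]
      exact hg.deriv.continuousAt.div hg.continuousAt hg0
    have h2 : w * w ≠ 0 := mul_ne_zero hw0 hw0
    have h3 : ContinuousAt (fun z : ℂ => (n:ℂ) / (z * w)) w := by
      fun_prop (disch := exact h2)
    have h4 : ContinuousAt (fun z : ℂ => logDeriv g z / z) w := by
      fun_prop (disch := exact hw0)
    exact h3.sub h4
  obtain ⟨B, hB⟩ := (hcont.norm.tendsto.isBoundedUnder_le)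
  refine ⟨B, ?_⟩
  have hB' := eventually_map.mp hB
  have hne : ∀ᶠ z in 𝓝 w, z ≠ 0 := continuousAt_id.eventually_ne hw0
  have hgn : ∀ᶠ z in 𝓝 w, g z ≠ 0 := hg.continuousAt.eventually_ne hg0
  have hgd : ∀ᶠ z in 𝓝 w, AnalyticAt ℂ g z := hg.eventually_analyticAt
  filter_upwards [nhdsWithin_le_nhds hB', nhdsWithin_le_nhds hne, nhdsWithin_le_nhds hgn,
    nhdsWithin_le_nhds hgd, nhdsWithin_le_nhds hgF.eventually_nhds, self_mem_nhdsWithin]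
    with z h1 h2 h3 h4 h5 h6
  refine le_trans (le_of_eq ?_) h1
  congr 1
  have h7 : z - w ≠ 0 := sub_ne_zero.mpr h6
  have hev : F =ᶠ[𝓝 z] fun z => (z - w) ^ n * g z := by
    filter_upwards [h5] with x hx; simpa using hx
  have hld : logDeriv F z = logDeriv (fun z => (z - w) ^ n * g z) z := by
    rw [logDeriv_apply, logDeriv_apply, hev.deriv_eq, hev.eq_of_nhds]
  have hmul := logDeriv_mul (f := fun z : ℂ => (z - w) ^ n) (g := g) z
    (pow_ne_zero _ h7) h3 (by fun_prop) h4.differentiableAt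
  have hpow : logDeriv (fun z : ℂ => (z - w) ^ n) z = n / (z - w) := by
    have := logDeriv_fun_pow (f := fun s : ℂ => s - w) (x := z) (by fun_prop) n
    rw [this, logDeriv_apply]
    simp [div_eq_mul_inv]
  rw [hld, hmul, hpow, hcc]
  field_simp
  ring

/-- The transform after removing finitely many poles. -/
def GG (F : ℂ → ℂ) (β : ℝ) (Γ : Finset ℝ) (s : ℂ) : ℂ :=
  -(logDeriv F (s + β) / (s + β)) - ∑ γ ∈ Γ, cc F β γ / (s - γ * I)

lemma Good.GG_bdd_near {F : ℂ → ℂ} {β : ℝ} (hF : Good F β) (Γ : Finset ℝ) {T : ℝ}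
    (hΓ : ∀ τ : ℝ, |τ| ≤ T → τ ∉ Γ → cc F β τ = 0) :
    ∃ B : ℝ, ∀ᶠ σ : ℝ in 𝓝[>] 0, ∀ t ∈ Set.Icc (-T) T, ‖GG F β Γ (σ + t * I)‖ ≤ B := by
  refine IsCompact.induction_on (isCompact_Icc (a := -T) (b := T))
    (p := fun S => ∃ B : ℝ, ∀ᶠ σ : ℝ in 𝓝[>] 0, ∀ t ∈ S, ‖GG F β Γ (σ + t * I)‖ ≤ B)
    ⟨0, by simp⟩ ?_ ?_ ?_
  · rintro s t hst ⟨B, hB⟩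
    exact ⟨B, hB.mono fun σ h t' ht' => h t' (hst ht')⟩
  · rintro s t ⟨B, hB⟩ ⟨B', hB'⟩
    refine ⟨max B B', ?_⟩
    filter_upwards [hB, hB'] with σ h1 h2 t' ht'
    rcases ht' with h | h
    · exact (h1 _ h).trans (le_max_left _ _)
    · exact (h2 _ h).trans (le_max_right _ _)
  · intro τ hτ
    obtain ⟨B, hB⟩ := hF.local_bdd τ
    have hc2 : ContinuousAt (fun s : ℂ => ∑ γ ∈ Γ.erase τ, cc F β γ / (s - γ * I)) (τ * I) := by
      apply tendsto_finsetSum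
      intro γ hγ
      refine (continuousAt_const.div (by fun_prop) ?_)
      rw [Finset.mem_erase] at hγ
      rw [← sub_mul]
      refine mul_ne_zero ?_ I_ne_zero
      rw [← ofReal_sub]
      exact_mod_cast sub_ne_zero.mpr hγ.1.symm
    obtain ⟨B2, hB2⟩ := (hc2.norm.tendsto.isBoundedUnder_le)
    have hB2' := eventually_map.mp hB2
    have ht1 : Tendsto (fun p : ℝ × ℝ => (p.1 + p.2 * I : ℂ)) (𝓝[>] 0 ×ˢ 𝓝 τ) (𝓝 (τ * I)) := by
      have : ContinuousAt (fun p : ℝ × ℝ => (p.1 + p.2 * I : ℂ)) (0, τ) := by fun_prop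
      have h := this.tendsto
      rw [nhds_prod_eq] at h
      simp only [ofReal_zero, zero_add] at h
      exact h.mono_left (Filter.prod_mono nhdsWithin_le_nhds le_rfl)
    have ht2 : Tendsto (fun p : ℝ × ℝ => (p.1 + p.2 * I + β : ℂ)) (𝓝[>] 0 ×ˢ 𝓝 τ)
        (𝓝[≠] (β + τ * I)) := by
      apply tendsto_nhdsWithin_of_tendsto_nhds_of_eventually_within
      · have := ht1.add_const (β:ℂ)
        rwa [add_comm (τ * I : ℂ)] at this
      · have : ∀ᶠ p : ℝ × ℝ in 𝓝[>] 0 ×ˢ 𝓝 τ, 0 < p.1 :=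
          (eventually_mem_of_tendsto_nhdsWithin tendsto_id : ∀ᶠ x : ℝ in 𝓝[>] (0:ℝ), x ∈ Set.Ioi 0).prod_inl _
        filter_upwards [this] with p hp h
        have := congrArg Complex.re h
        simp at this
        linarith
    have hev := (ht2.eventually hB).and (ht1.eventually hB2')
    have hev2 : ∀ᶠ p : ℝ × ℝ in 𝓝[>] 0 ×ˢ 𝓝 τ, ‖GG F β Γ (p.1 + p.2 * I)‖ ≤ B + B2 := by
      filter_upwards [hev] with p hp
      have e : GG F β Γ (p.1 + p.2 * I) =
          (-(logDeriv F (p.1 + p.2 * I + β) / (p.1 + p.2 * I + β)) -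
            cc F β τ / (p.1 + p.2 * I + β - (β + τ * I))) -
          ∑ γ ∈ Γ.erase τ, cc F β γ / ((p.1 + p.2 * I) - γ * I) := by
        unfold GG
        by_cases hmem : τ ∈ Γ
        · rw [← Finset.add_sum_erase _ _ hmem]; ring
        · rw [Finset.erase_eq_of_notMem hmem, hΓ τ (abs_le.mpr hτ) hmem]; ring
      rw [e]
      exact (norm_sub_le _ _).trans (add_le_add hp.1 hp.2)
    obtain ⟨pa, ha, pb, hb, hab⟩ := eventually_prod_iff.mp hev2
    refine ⟨{t | pb t}, mem_nhdsWithin_of_mem_nhds hb, B + B2, ?_⟩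
    filter_upwards [ha] with σ hσ t ht
    exact hab hσ ht

end S12

namespace S12

lemma Good.GG_diff {F : ℂ → ℂ} {β : ℝ} (hF : Good F β) (Γ : Finset ℝ) :
    DifferentiableOn ℂ (GG F β Γ) {s | 0 < s.re} := by
  have hb := hF.half_le
  intro s hs
  have hs' : 0 < s.re := hs
  apply DifferentiableAt.differentiableWithinAt
  unfold GG
  have h0 : s + β ≠ 0 := by
    intro h
    have := congrArg Complex.re h
    simp at this; linarith
  have hF0 : F (s + β) ≠ 0 := hF.nz _ (by simp; linarith)
  have hd : DifferentiableAt ℂ (logDeriv F) (s + β) := by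
    have : logDeriv F = fun z => deriv F z / F z := by ext z; rw [logDeriv_apply]
    rw [this]
    exact ((hF.diff.analyticAt _).deriv.differentiableAt).div (hF.diff _) hF0
  apply DifferentiableAt.sub
  · apply DifferentiableAt.neg
    apply DifferentiableAt.div
    · exact hd.comp s (differentiableAt_id.add_const _)
    · fun_prop
    · exact h0
  · apply DifferentiableAt.fun_sum
    intro γ _
    apply DifferentiableAt.fun_div (by fun_prop) (by fun_prop)
    intro h
    have := congrArg Complex.re h
    simp at this; linarith

lemma Good.LD_bdd {F : ℂ → ℂ} {β : ℝ} (hF : Good F β) {δ : ℝ} (hδ : 0 < δ) :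
    ∃ B : ℝ, ∀ s : ℂ, δ ≤ s.re → ‖logDeriv F (s + β) / (s + β)‖ ≤ B := by
  obtain ⟨K, hK, h⟩ := hF.L3 hδ
  have hb := hF.half_le
  refine ⟨K * 9, fun s hs => ?_⟩
  have h1 := h (s + β) (by simp; linarith)
  generalize hw : s + β = w at *
  have hre : 1 / 2 ≤ w.re := by rw [← hw]; simp; linarith
  have h2 : 1 / 2 ≤ ‖w‖ := hre.trans ((le_abs_self _).trans (Complex.abs_re_le_norm w))
  have h3 := Complex.abs_im_le_norm w
  rw [norm_div, div_le_iff₀ (by linarith)]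
  refine h1.trans ?_
  rw [mul_assoc]
  gcongr
  have := Real.log_le_sub_one_of_pos (show 0 < |w.im| + 4 by positivity)
  linarith

lemma Good.GG_bdd {F : ℂ → ℂ} {β : ℝ} (hF : Good F β) (Γ : Finset ℝ) {δ : ℝ} (hδ : 0 < δ) :
    ∃ B : ℝ, ∀ s : ℂ, δ ≤ s.re → ‖GG F β Γ s‖ ≤ B := by
  obtain ⟨B, hB⟩ := hF.LD_bdd hδ
  refine ⟨B + ∑ γ ∈ Γ, ‖cc F β γ‖ / δ, fun s hs => ?_⟩
  refine (norm_sub_le _ _).trans (add_le_add (by rw [norm_neg]; exact hB s hs) ?_)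
  refine (norm_sum_le _ _).trans (Finset.sum_le_sum fun γ _ => ?_)
  rw [norm_div]
  gcongr
  have := Complex.abs_re_le_norm (s - γ * I)
  simp at this
  exact hs.trans ((le_abs_self _).trans this)

lemma exp_laplace {z s : ℂ} (h : z.re < s.re) :
    Integrable (fun y : ℝ => (if 0 ≤ y then Complex.exp (z * y) else 0) * Complex.exp (-s * y)) ∧
    ∫ y : ℝ, (if 0 ≤ y then Complex.exp (z * y) else 0) * Complex.exp (-s * y) = 1 / (s - z) := by
  have e : (fun y : ℝ => (if 0 ≤ y then Complex.exp (z * y) else 0) * Complex.exp (-s * y)) =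
      (Set.Ici 0).indicator (fun y : ℝ => Complex.exp ((z - s) * y)) := by
    ext y
    by_cases hy : 0 ≤ y
    · rw [if_pos hy, Set.indicator_of_mem (by exact hy), ← Complex.exp_add]; congr 1; ring
    · rw [if_neg hy, Set.indicator_of_notMem (by exact hy), zero_mul]
  have hre : (z - s).re < 0 := by simp; linarith
  have h1 := integrableOn_exp_mul_complex_Ioi hre 0
  rw [e]
  constructor
  · rw [integrable_indicator_iff measurableSet_Ici]
    exact (integrableOn_Ici_iff_integrableOn_Ioi).mpr h1
  · rw [integral_indicator measurableSet_Ici, integral_Ici_eq_integral_Ioi,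
      integral_exp_mul_complex_Ioi hre]
    have : s - z ≠ 0 := by intro h; have := congrArg Complex.re h; simp at this; linarith
    have : z - s ≠ 0 := by intro h; have := congrArg Complex.re h; simp at this; linarith
    simp
    field_simp
    ring

/-- trigonometric polynomial supported on `y ≥ 0`. -/
def PP (F : ℂ → ℂ) (β : ℝ) (Γ : Finset ℝ) (y : ℝ) : ℂ :=
  ∑ γ ∈ Γ, cc F β γ * Complex.exp (γ * I * y)

lemma laplace_int {N : ℝ → ℂ} (hm : Measurable N) (h0 : ∀ y < 0, N y = 0) {A C : ℝ}
    (hb : ∀ y, 0 ≤ y → ‖N y‖ ≤ C * Real.exp (A * y)) {s : ℂ} (hs : A < s.re) :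
    Integrable (fun y : ℝ => N y * Complex.exp (-s * y)) := by
  have h1 := (exp_laplace (z := (A:ℂ)) (s := (s.re:ℂ)) (by simpa using hs)).1.norm.const_mul C
  refine h1.mono' (by fun_prop) (ae_of_all _ fun y => ?_)
  by_cases hy : 0 ≤ y
  · rw [if_pos hy, norm_mul, norm_mul, Complex.norm_exp, Complex.norm_exp, Complex.norm_exp,
      ← mul_assoc]
    have := hb y hy
    simp at *
    gcongr
  · rw [h0 y (not_le.mp hy), if_neg hy]; simp

lemma lemM {F : ℂ → ℂ} {β : ℝ} (hF : Good F β) {N : ℝ → ℂ} (hm : Measurable N)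
    (h0 : ∀ y < 0, N y = 0) {A C : ℝ} (hA : 0 ≤ A)
    (hb : ∀ y, 0 ≤ y → ‖N y‖ ≤ C * Real.exp (A * y))
    (hL : ∀ s : ℂ, A < s.re → ∫ y : ℝ, N y * Complex.exp (-s * y) = -(logDeriv F s / s))
    {ε : ℝ} (hε : 0 < ε) :
    ∃ Γ : Finset ℝ, 0 ∈ Γ ∧ ∀ᶠ Y in atTop,
      ∫ y in (0:ℝ)..Y, ‖Complex.exp (-β * y) * N y - PP F β Γ y‖ ≤ ε * Y := by
  have hb1 := hF.half_le
  obtain ⟨T₀, hT₀, htail⟩ := hF.tail (η := ε ^ 2 / 4) (by positivity)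
  have hfin := hF.finite_zeros (T₀ + 1)
  set S := hfin.toFinset with hS
  obtain ⟨T, hT, hTS⟩ := (Set.Ioo_infinite (show T₀ < T₀ + 1 by linarith)).exists_notMem_finset
    (S.image fun γ => |γ|)
  have hTpos : 0 < T := hT₀.trans hT.1
  set Γ : Finset ℝ := insert 0 (S.filter (fun γ => |γ| < T)) with hΓ
  have hΓT : ∀ γ ∈ Γ, |γ| < T := by
    intro γ hγ
    rw [hΓ, Finset.mem_insert, Finset.mem_filter] at hγ
    rcases hγ with rfl | h
    · simpa using hTpos
    · exact h.2
  have hΓc : ∀ τ : ℝ, |τ| ≤ T → τ ∉ Γ → cc F β τ = 0 := by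
    intro τ hτ hn
    by_contra hne
    have hz := cc_zero hne
    have hτS : τ ∈ S := by
      rw [hS, Set.Finite.mem_toFinset]
      exact ⟨abs_le.mp (hτ.trans hT.2.le), hz⟩
    apply hn
    rw [hΓ, Finset.mem_insert, Finset.mem_filter]
    refine Or.inr ⟨hτS, lt_of_le_of_ne hτ fun h => hTS ?_⟩
    rw [Finset.mem_image]
    exact ⟨τ, hτS, h⟩
  refine ⟨Γ, by simp [hΓ], ?_⟩
  set h : ℝ → ℂ := fun y => Complex.exp (-β * y) * N y - ∑ γ ∈ Γ, cc F β γ *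
    (if 0 ≤ y then Complex.exp (γ * I * y) else 0) with hh
  have hmean : ∀ᶠ Y in atTop, ∫ y in (0:ℝ)..Y, ‖h y‖ ≤ ε * Y := by
    refine mean_bound (A := A) (C := |C| + ∑ γ ∈ Γ, ‖cc F β γ‖) (G := GG F β Γ) ?_ ?_ ?_
      (hF.GG_diff Γ) (fun δ hδ => hF.GG_bdd Γ hδ) ?_ hε ?_
    · apply Measurable.sub (by fun_prop)
      apply Finset.measurable_sum
      intro γ _
      exact (Measurable.ite measurableSet_Ici (by fun_prop) (by fun_prop)).const_mul _
    · intro y hy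
      simp [hh, h0 y hy, not_le.mpr hy]
    · intro y hy
      simp only [hh, if_pos hy]
      rw [add_mul]
      have hexp : 1 ≤ Real.exp (A * y) := Real.one_le_exp (by positivity)
      refine (norm_sub_le _ _).trans (add_le_add ?_ ?_)
      · rw [norm_mul, Complex.norm_exp]
        have h1 : Real.exp ((-β * y : ℂ).re) ≤ 1 := by
          rw [Real.exp_le_one_iff]; simp; nlinarith
        have h2 := hb y hy
        have h3 : C * Real.exp (A * y) ≤ |C| * Real.exp (A * y) := by gcongr; exact le_abs_self C
        calc _ ≤ 1 * ‖N y‖ := by gcongr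
          _ ≤ _ := by linarith
      · refine (norm_sum_le _ _).trans ?_
        refine le_trans ?_ (le_mul_of_one_le_right (Finset.sum_nonneg fun _ _ => norm_nonneg _) hexp)
        apply Finset.sum_le_sum
        intro γ _
        rw [norm_mul, Complex.norm_exp]
        simp
    · intro s hs
      have hi : ∀ γ ∈ Γ, Integrable (fun y : ℝ => cc F β γ *
          ((if 0 ≤ y then Complex.exp (γ * I * y) else 0) * Complex.exp (-s * y))) := fun γ _ =>
        (exp_laplace (by simp; linarith)).1.const_mul _
      have hN : Integrable (fun y : ℝ => N y * Complex.exp (-(s + β) * y)) :=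
        laplace_int hm h0 hb (by simp; linarith)
      have e : (fun y : ℝ => h y * Complex.exp (-s * y)) = fun y : ℝ =>
          N y * Complex.exp (-(s + β) * y) - ∑ γ ∈ Γ, cc F β γ *
          ((if 0 ≤ y then Complex.exp (γ * I * y) else 0) * Complex.exp (-s * y)) := by
        ext y
        simp only [hh, sub_mul, Finset.sum_mul]
        congr 1
        · rw [show -(s + β) * y = -β * y + -s * (y:ℂ) by ring, Complex.exp_add]; ring
        · apply Finset.sum_congr rfl; intros; ring
      rw [e, integral_sub hN (integrable_finset_sum _ hi), integral_finset_sum _ hi,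
        hL _ (by simp; linarith)]
      unfold GG
      congr 1
      apply Finset.sum_congr rfl
      intro γ _
      rw [integral_const_mul, (exp_laplace (by simp; linarith)).2]
      ring
    · -- the L2 estimate
      obtain ⟨B, hB⟩ := hF.GG_bdd_near Γ hΓc
      set D : ℝ := ∑ γ ∈ Γ, ‖cc F β γ‖ / (1 - |γ| / T) with hD
      have hD0 : 0 ≤ D := Finset.sum_nonneg fun γ hγ => by
        have : |γ| / T < 1 := (div_lt_one hTpos).mpr (hΓT γ hγ)
        exact div_nonneg (norm_nonneg _) (by linarith)
      set D3 : ℝ := 2 * T * B ^ 2 + 2 * D ^ 2 * (1 + 1 / T ^ 2) * Real.pi with hD3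
      have hpi := Real.pi_pos
      have hD30 : 0 ≤ D3 := by positivity
      have key : ∀ᶠ σ : ℝ in 𝓝[>] 0, ∫⁻ t : ℝ, ENNReal.ofReal (‖GG F β Γ (σ + t * I)‖ ^ 2) ≤
          ENNReal.ofReal (ε ^ 2 / 2 / σ + D3) := by
        filter_upwards [hB, Ioc_mem_nhdsGT (show (0:ℝ) < 1 by norm_num)] with σ hσB hσ
        rw [← lintegral_add_compl _ (measurableSet_Icc (a := -T) (b := T))]
        have hσ0 : 0 < σ := hσ.1
        have i1 : ∫⁻ t in Set.Icc (-T) T, ENNReal.ofReal (‖GG F β Γ (σ + t * I)‖ ^ 2) ≤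
            ENNReal.ofReal (2 * T * B ^ 2) := by
          calc _ ≤ ∫⁻ t in Set.Icc (-T) T, ENNReal.ofReal (B ^ 2) := by
                apply setLIntegral_mono' measurableSet_Icc
                intro t ht
                apply ENNReal.ofReal_le_ofReal
                have := hσB t ht
                gcongr
            _ = _ := by
                simp only [lintegral_const, MeasurableSet.univ, Measure.restrict_apply,
                  Set.univ_inter, Real.volume_Icc]
                rw [← ENNReal.ofReal_mul (by positivity)]
                congr 1; ring
        have i2 : ∫⁻ t in (Set.Icc (-T) T)ᶜ, ENNReal.ofReal (‖GG F β Γ (σ + t * I)‖ ^ 2) ≤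
            ENNReal.ofReal (ε ^ 2 / 2 / σ) +
            ENNReal.ofReal (2 * D ^ 2 * (1 + 1 / T ^ 2) * Real.pi) := by
          have hpt : ∀ t ∈ (Set.Icc (-T) T)ᶜ, ‖GG F β Γ (σ + t * I)‖ ^ 2 ≤
              2 * ‖logDeriv F (β + σ + t * I) / (β + σ + t * I)‖ ^ 2 +
              2 * D ^ 2 * (1 + 1 / T ^ 2) * (1 + t ^ 2)⁻¹ := by
            intro t ht
            have htT : T < |t| := by
              by_contra hcon
              exact ht (abs_le.mp (not_lt.mp hcon))
            have ht0 : 0 < |t| := hTpos.trans htT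
            have hsum : ‖∑ γ ∈ Γ, cc F β γ / ((σ + t * I) - γ * I)‖ ≤ D / |t| := by
              rw [hD, Finset.sum_div]
              refine (norm_sum_le _ _).trans (Finset.sum_le_sum fun γ hγ => ?_)
              rw [norm_div, div_div]
              have hlt : |γ| / T < 1 := (div_lt_one hTpos).mpr (hΓT γ hγ)
              have hpos : 0 < (1 - |γ| / T) * |t| := mul_pos (by linarith) ht0
              gcongr
              have h1 := Complex.abs_im_le_norm ((σ + t * I) - γ * I)
              simp only [sub_im, add_im, ofReal_im, mul_im, ofReal_re, I_im, mul_one, I_re,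
                mul_zero, add_zero, zero_add] at h1
              have h2 := abs_sub_abs_le_abs_sub t γ
              have h3 : |γ| ≤ |γ| / T * |t| := by
                rw [div_mul_eq_mul_div, le_div_iff₀ hTpos]
                gcongr
              linarith
            have hgg : ‖GG F β Γ (σ + t * I)‖ ≤
                ‖logDeriv F (β + σ + t * I) / (β + σ + t * I)‖ + D / |t| := by
              unfold GG
              refine (norm_sub_le _ _).trans (add_le_add (le_of_eq ?_) hsum)
              rw [norm_neg, show (σ + t * I + β : ℂ) = β + σ + t * I by ring]
            have hD2 : (D / |t|) ^ 2 ≤ D ^ 2 * (1 + 1 / T ^ 2) * (1 + t ^ 2)⁻¹ := by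
              rw [div_pow, sq_abs, div_eq_mul_inv, mul_assoc]
              gcongr
              have ht2 : T ^ 2 < t ^ 2 := by
                rw [← sq_abs t]; gcongr
              have : 0 < t ^ 2 := lt_of_le_of_lt (sq_nonneg T) ht2
              rw [← div_eq_mul_inv, le_div_iff₀ (by positivity), inv_mul_eq_div,
                add_div, div_self this.ne', add_comm]
              gcongr
            generalize ‖logDeriv F (β + σ + t * I) / (β + σ + t * I)‖ = X at *
            calc _ ≤ (X + D / |t|) ^ 2 := by gcongr
              _ ≤ 2 * X ^ 2 + 2 * (D / |t|) ^ 2 := by nlinarith [sq_nonneg (X - D / |t|)]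
              _ ≤ _ := by linarith
          calc _ ≤ ∫⁻ t in (Set.Icc (-T) T)ᶜ, (2 * ENNReal.ofReal
                (‖logDeriv F (β + σ + t * I) / (β + σ + t * I)‖ ^ 2) +
                ENNReal.ofReal (2 * D ^ 2 * (1 + 1 / T ^ 2)) * ENNReal.ofReal ((1 + t ^ 2)⁻¹)) := by
                apply setLIntegral_mono' measurableSet_Icc.compl
                intro t ht
                rw [← ENNReal.ofReal_mul (by positivity),
                  show (2:ENNReal) = ENNReal.ofReal 2 by simp, ← ENNReal.ofReal_mul (by norm_num),
                  ← ENNReal.ofReal_add (by positivity) (by positivity)]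
                exact ENNReal.ofReal_le_ofReal (hpt t ht)
            _ ≤ _ := by
                rw [lintegral_add_right _ (by fun_prop)]
                apply add_le_add
                · rw [lintegral_const_mul' _ _ (by simp)]
                  calc _ ≤ 2 * ENNReal.ofReal (ε ^ 2 / 4 / σ) := by
                        gcongr
                        refine le_trans (lintegral_mono_set ?_) (htail σ hσ.1 hσ.2)
                        intro t ht
                        by_contra hcon
                        have hcon' : |t| < T₀ := not_le.mp hcon
                        exact ht (abs_le.mp (hcon'.le.trans hT.1.le))
                    _ = _ := by
                        rw [show (2:ENNReal) = ENNReal.ofReal 2 by simp,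
                          ← ENNReal.ofReal_mul (by norm_num)]
                        congr 1; ring
                · rw [lintegral_const_mul' _ _ ENNReal.ofReal_ne_top,
                    ENNReal.ofReal_mul (p := 2 * D ^ 2 * (1 + 1 / T ^ 2)) (by positivity)]
                  gcongr
                  rw [← integral_univ_inv_one_add_sq,
                    ofReal_integral_eq_lintegral_ofReal integrable_inv_one_add_sq
                      (ae_of_all _ fun t => by positivity)]
                  exact setLIntegral_le_lintegral _ _
        refine (add_le_add i1 i2).trans (le_of_eq ?_)
        rw [← ENNReal.ofReal_add (by positivity) (by positivity),
          ← ENNReal.ofReal_add (by positivity) (by positivity)]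
        congr 1; rw [hD3]; ring
      have hsmall : ∀ᶠ σ : ℝ in 𝓝[>] 0, σ * D3 ≤ ε ^ 2 / 2 := by
        have : Tendsto (fun σ : ℝ => σ * D3) (𝓝[>] 0) (𝓝 (0 * D3)) :=
          (continuousAt_id.mul continuousAt_const).tendsto.mono_left nhdsWithin_le_nhds
        rw [zero_mul] at this
        exact (this.eventually_lt_const (show (0:ℝ) < ε ^ 2 / 2 by positivity)).mono fun _ h => h.le
      filter_upwards [key, hsmall, self_mem_nhdsWithin] with σ hk hsm hσ
      have hσ0 : 0 < σ := hσ
      have hcont : Continuous (fun t : ℝ => ‖GG F β Γ (σ + t * I)‖ ^ 2) := by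
        apply Continuous.pow
        apply Continuous.norm
        refine (hF.GG_diff Γ).continuousOn.comp_continuous (by fun_prop) fun t => ?_
        simpa using hσ0
      have hintg : Integrable (fun t : ℝ => ‖GG F β Γ (σ + t * I)‖ ^ 2) := by
        refine ⟨hcont.aestronglyMeasurable, ?_⟩
        rw [hasFiniteIntegral_iff_ofReal (ae_of_all _ fun t => by positivity)]
        exact hk.trans_lt ENNReal.ofReal_lt_top
      refine ⟨hintg, ?_⟩
      have : ∫ t : ℝ, ‖GG F β Γ (σ + t * I)‖ ^ 2 ≤ ε ^ 2 / 2 / σ + D3 := by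
        rw [integral_eq_lintegral_of_nonneg_ae (ae_of_all _ fun t => by positivity)
          hcont.aestronglyMeasurable]
        exact ENNReal.toReal_le_of_le_ofReal (by positivity) hk
      calc _ ≤ σ * (ε ^ 2 / 2 / σ + D3) := by gcongr
        _ = ε ^ 2 / 2 + σ * D3 := by field_simp
        _ ≤ _ := by linarith
  filter_upwards [hmean, eventually_ge_atTop 0] with Y hY hY0
  refine le_trans (le_of_eq ?_) hY
  apply intervalIntegral.integral_congr
  intro y hy
  rw [Set.uIcc_of_le hY0] at hy
  simp only [hh, PP, if_pos hy.1]

end S12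

namespace S12

def ex (l : ℝ) : ℝ → ℂ := fun y => Complex.exp (l * I * y)

lemma ex_cont (l : ℝ) : Continuous (ex l) := by unfold ex; fun_prop

/-- Mean-approximable by trigonometric polynomials with frequencies in `Λ`. -/
def AP (Λ : Set ℝ) (h : ℝ → ℂ) : Prop :=
  (∀ Y : ℝ, 0 ≤ Y → IntervalIntegrable h volume 0 Y) ∧
  ∀ ε : ℝ, 0 < ε → ∃ P ∈ Submodule.span ℂ (ex '' Λ),
    ∀ᶠ Y in atTop, ∫ y in (0:ℝ)..Y, ‖h y - P y‖ ≤ ε * Y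

lemma span_cont {Λ : Set ℝ} {P : ℝ → ℂ} (hP : P ∈ Submodule.span ℂ (ex '' Λ)) : Continuous P := by
  induction hP using Submodule.span_induction with
  | mem x hx => obtain ⟨l, _, rfl⟩ := hx; exact ex_cont l
  | zero => exact continuous_const
  | add x y _ _ h1 h2 => exact h1.add h2
  | smul a x _ h => exact h.const_smul a

lemma AP.mono {Λ Λ' : Set ℝ} (hΛ : Λ ⊆ Λ') {h : ℝ → ℂ} (hh : AP Λ h) : AP Λ' h := by
  refine ⟨hh.1, fun ε hε => ?_⟩
  obtain ⟨P, hP, h1⟩ := hh.2 ε hε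
  exact ⟨P, Submodule.span_mono (Set.image_mono hΛ) hP, h1⟩

lemma AP.add {Λ : Set ℝ} {h k : ℝ → ℂ} (hh : AP Λ h) (hk : AP Λ k) : AP Λ (fun y => h y + k y) := by
  refine ⟨fun Y hY => (hh.1 Y hY).add (hk.1 Y hY), fun ε hε => ?_⟩
  obtain ⟨P, hP, h1⟩ := hh.2 (ε / 2) (by positivity)
  obtain ⟨Q, hQ, h2⟩ := hk.2 (ε / 2) (by positivity)
  refine ⟨P + Q, Submodule.add_mem _ hP hQ, ?_⟩
  filter_upwards [h1, h2, eventually_ge_atTop 0] with Y a1 a2 hY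
  have i1 := ((hh.1 Y hY).sub ((span_cont hP).intervalIntegrable 0 Y)).norm
  have i2 := ((hk.1 Y hY).sub ((span_cont hQ).intervalIntegrable 0 Y)).norm
  have i3 := (((hh.1 Y hY).add (hk.1 Y hY)).sub
    (((span_cont hP).add (span_cont hQ)).intervalIntegrable 0 Y)).norm
  calc _ ≤ ∫ y in (0:ℝ)..Y, (‖h y - P y‖ + ‖k y - Q y‖) := by
        apply intervalIntegral.integral_mono_on hY i3 (i1.add i2)
        intro y _
        rw [show h y + k y - (P + Q) y = (h y - P y) + (k y - Q y) by simp; ring]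
        exact norm_add_le _ _
    _ = _ := intervalIntegral.integral_add i1 i2
    _ ≤ _ := by linarith

lemma AP.zero (Λ : Set ℝ) : AP Λ (fun _ => 0) := by
  refine ⟨fun Y _ => by simp, fun ε hε => ⟨0, Submodule.zero_mem _, ?_⟩⟩
  filter_upwards [eventually_ge_atTop 0] with Y hY
  simp; positivity

lemma AP.const_mul {Λ : Set ℝ} {h : ℝ → ℂ} (hh : AP Λ h) (c : ℂ) : AP Λ (fun y => c * h y) := by
  rcases eq_or_ne c 0 with rfl | hc
  · simpa using AP.zero Λ
  refine ⟨fun Y hY => (hh.1 Y hY).const_mul c, fun ε hε => ?_⟩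
  have hc' : 0 < ‖c‖ := norm_pos_iff.mpr hc
  obtain ⟨P, hP, h1⟩ := hh.2 (ε / ‖c‖) (by positivity)
  refine ⟨c • P, Submodule.smul_mem _ _ hP, ?_⟩
  filter_upwards [h1] with Y a1
  have : ∀ y, ‖c * h y - (c • P) y‖ = ‖c‖ * ‖h y - P y‖ := fun y => by
    rw [← norm_mul]; congr 1; simp; ring
  simp_rw [this, intervalIntegral.integral_const_mul]
  calc _ ≤ ‖c‖ * (ε / ‖c‖ * Y) := by gcongr
    _ = _ := by field_simp

lemma AP.sum {Λ : Set ℝ} {ι : Type*} (s : Finset ι) {h : ι → ℝ → ℂ} (hh : ∀ i ∈ s, AP Λ (h i)) :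
    AP Λ (fun y => ∑ i ∈ s, h i y) := by
  classical
  induction s using Finset.induction_on with
  | empty => simpa using AP.zero Λ
  | insert a s ha ih =>
    simp_rw [Finset.sum_insert ha]
    exact (hh a (Finset.mem_insert_self _ _)).add (ih fun i hi => hh i (Finset.mem_insert_of_mem hi))

lemma AP.congr {Λ : Set ℝ} {h k : ℝ → ℂ} (hh : AP Λ h) (he : ∀ y, 0 ≤ y → h y = k y) : AP Λ k := by
  refine ⟨fun Y hY => (hh.1 Y hY).congr ?_, fun ε hε => ?_⟩
  · intro y hy
    rw [Set.uIoc_of_le hY] at hy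
    exact he y hy.1.le
  · obtain ⟨P, hP, h1⟩ := hh.2 ε hε
    refine ⟨P, hP, ?_⟩
    filter_upwards [h1, eventually_ge_atTop 0] with Y a1 hY
    refine le_trans (le_of_eq ?_) a1
    apply intervalIntegral.integral_congr
    intro y hy
    rw [Set.uIcc_of_le hY] at hy
    simp only [he y hy.1]

variable {q : ℕ} [NeZero q]

def psiC (χ : DirichletCharacter ℂ q) (x : ℝ) : ℂ :=
  ∑ n ∈ Finset.Icc 1 ⌊x⌋₊, χ (n : ZMod q) * (ArithmeticFunction.vonMangoldt n : ℂ)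

def NN (χ : DirichletCharacter ℂ q) (y : ℝ) : ℂ :=
  if 0 ≤ y then psiC χ (Real.exp y) - ee χ * (Complex.exp y - 1) else 0

lemma psiC_bound (χ : DirichletCharacter ℂ q) {x : ℝ} (hx : 0 ≤ x) :
    ‖psiC χ x‖ ≤ (Real.log 4 + 4) * x := by
  refine le_trans ?_ (Chebyshev.psi_le_const_mul_self hx)
  rw [Chebyshev.psi]
  refine (norm_sum_le _ _).trans ?_
  have hI : Finset.Icc 1 ⌊x⌋₊ = Finset.Ioc 0 ⌊x⌋₊ := by
    ext n; rw [Finset.mem_Icc, Finset.mem_Ioc]; omega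
  rw [hI]
  · apply Finset.sum_le_sum
    intro n _
    rw [norm_mul]
    have := χ.norm_le_one (n : ZMod q)
    calc _ ≤ 1 * ‖(ArithmeticFunction.vonMangoldt n : ℂ)‖ := by gcongr
      _ = _ := by rw [one_mul, Complex.norm_real, Real.norm_of_nonneg ArithmeticFunction.vonMangoldt_nonneg]

lemma psiC_meas (χ : DirichletCharacter ℂ q) : Measurable (psiC χ) := by
  unfold psiC
  exact (measurable_from_nat (f := fun n => ∑ n ∈ Finset.Icc 1 n, χ (n : ZMod q) *
    (ArithmeticFunction.vonMangoldt n : ℂ))).comp Nat.measurable_floor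

lemma NN_meas (χ : DirichletCharacter ℂ q) : Measurable (NN χ) := by
  unfold NN
  refine Measurable.ite measurableSet_Ici ?_ measurable_const
  have := (psiC_meas χ).comp Real.measurable_exp
  exact this.sub (by fun_prop)

lemma ee_le (χ : DirichletCharacter ℂ q) : (ee χ : ℝ) ≤ 1 := by
  unfold ee; split_ifs <;> simp

lemma NN_bound (χ : DirichletCharacter ℂ q) {y : ℝ} (hy : 0 ≤ y) :
    ‖NN χ y‖ ≤ (Real.log 4 + 6) * Real.exp (1 * y) := by
  rw [NN, if_pos hy, one_mul]
  have h1 := psiC_bound χ (Real.exp_pos y).le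
  have h2 : ‖(ee χ : ℂ) * (Complex.exp y - 1)‖ ≤ 2 * Real.exp y := by
    rw [norm_mul]
    have h3 : ‖(ee χ : ℂ)‖ ≤ 1 := by simpa using ee_le χ
    have h4 : ‖Complex.exp y - 1‖ ≤ 2 * Real.exp y := by
      refine (norm_sub_le _ _).trans ?_
      rw [Complex.norm_exp]
      have := Real.one_le_exp hy
      simp; linarith
    calc _ ≤ 1 * (2 * Real.exp y) := by gcongr
      _ = _ := one_mul _
  refine (norm_sub_le _ _).trans ?_
  linarith

lemma psiC_laplace (χ : DirichletCharacter ℂ q) {s : ℂ} (hs : 1 < s.re) :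
    s * ∫ y in Set.Ioi (0:ℝ), psiC χ (Real.exp y) * Complex.exp (-s * y) =
      LSeries (fun n : ℕ => χ (n : ZMod q) * (ArithmeticFunction.vonMangoldt n : ℂ)) s := by
  have hO : (fun n : ℕ ↦ ∑ k ∈ Finset.Icc 1 n, χ (k : ZMod q) *
      (ArithmeticFunction.vonMangoldt k : ℂ)) =O[atTop] fun n : ℕ ↦ (n : ℝ) ^ (1:ℝ) := by
    apply Asymptotics.IsBigO.of_bound (Real.log 4 + 4)
    filter_upwards with n
    have := psiC_bound χ (Nat.cast_nonneg n : (0:ℝ) ≤ n)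
    unfold psiC at this
    rw [Nat.floor_natCast] at this
    rw [Real.rpow_one, Real.norm_of_nonneg (Nat.cast_nonneg n)]
    exact this
  have hsum : LSeriesSummable (fun n : ℕ => χ (n : ZMod q) *
    (ArithmeticFunction.vonMangoldt n : ℂ)) s :=
    DirichletCharacter.LSeriesSummable_twist_vonMangoldt χ hs
  rw [LSeries_eq_mul_integral _ (r := 1) zero_le_one hs hsum hO]
  congr 1
  have := integral_comp_exp_Ioi (fun t : ℝ => psiC χ t * (t:ℂ) ^ (-(s + 1))) 0
  rw [Real.exp_zero] at this
  rw [show (∫ (t : ℝ) in Set.Ioi 1, (∑ k ∈ Finset.Icc 1 ⌊t⌋₊, χ (k : ZMod q) *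
    (ArithmeticFunction.vonMangoldt k : ℂ)) * (t:ℂ) ^ (-(s + 1))) =
    ∫ (t : ℝ) in Set.Ioi 1, psiC χ t * (t:ℂ) ^ (-(s + 1)) from rfl, ← this]
  apply setIntegral_congr_fun measurableSet_Ioi
  intro y _
  simp only
  have e1 : ((Real.exp y : ℝ) : ℂ) ^ (-(s + 1)) = Complex.exp (y * (-(s + 1))) := by
    rw [Complex.cpow_def_of_ne_zero (by exact_mod_cast (Real.exp_pos y).ne'),
      ← Complex.ofReal_log (Real.exp_pos y).le, Real.log_exp]
  rw [Complex.real_smul, e1, Complex.ofReal_exp, mul_left_comm, ← Complex.exp_add]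
  congr 2
  ring

lemma NN_laplace (χ : DirichletCharacter ℂ q) {s : ℂ} (hs : 1 < s.re) :
    ∫ y : ℝ, NN χ y * Complex.exp (-s * y) = -(logDeriv (FF χ) s / s) := by
  have hs0 : s ≠ 0 := by rintro rfl; simp at hs; linarith
  have hs1 : s - 1 ≠ 0 := by
    intro h; have := congrArg Complex.re h; simp at this; linarith
  obtain ⟨i1, v1⟩ := exp_laplace (z := 1) (s := s) (by simpa using hs)
  obtain ⟨i0, v0⟩ := exp_laplace (z := 0) (s := s) (by simp; linarith)
  set p : ℝ → ℂ := fun y => if 0 ≤ y then psiC χ (Real.exp y) else 0 with hp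
  have hpi : Integrable (fun y : ℝ => p y * Complex.exp (-s * y)) := by
    refine laplace_int (A := 1) (C := Real.log 4 + 4) ?_ ?_ ?_ hs
    · exact Measurable.ite measurableSet_Ici ((psiC_meas χ).comp Real.measurable_exp) measurable_const
    · intro y hy; simp [hp, not_le.mpr hy]
    · intro y hy
      simp only [hp, if_pos hy, one_mul]
      exact psiC_bound χ (Real.exp_pos y).le
  have hpv : ∫ y : ℝ, p y * Complex.exp (-s * y) =
      ∫ y in Set.Ioi (0:ℝ), psiC χ (Real.exp y) * Complex.exp (-s * y) := by
    rw [← integral_Ici_eq_integral_Ioi, ← integral_indicator measurableSet_Ici]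
    congr 1
    ext y
    by_cases hy : 0 ≤ y
    · rw [Set.indicator_of_mem (by exact hy)]; simp [hp, hy]
    · rw [Set.indicator_of_notMem (by exact hy)]; simp [hp, hy]
  have e : (fun y : ℝ => NN χ y * Complex.exp (-s * y)) = fun y : ℝ =>
      p y * Complex.exp (-s * y) - (ee χ : ℂ) *
      ((if 0 ≤ y then Complex.exp (1 * y) else 0) * Complex.exp (-s * y) -
       (if 0 ≤ y then Complex.exp (0 * y) else 0) * Complex.exp (-s * y)) := by
    ext y
    simp only [NN, hp]
    split_ifs
    · simp; ring
    · simp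
  have i10 : Integrable (fun y : ℝ => (ee χ : ℂ) *
      ((if 0 ≤ y then Complex.exp (1 * y) else 0) * Complex.exp (-s * y) -
       (if 0 ≤ y then Complex.exp (0 * y) else 0) * Complex.exp (-s * y))) := (i1.sub i0).const_mul _
  rw [e, integral_sub hpi i10, integral_const_mul, integral_sub i1 i0, v1, v0,
    hpv, FF_logDeriv χ hs, ← psiC_laplace χ hs]
  field_simp
  ring

lemma AP_NN (χ : DirichletCharacter ℂ q) {β : ℝ} (hF : Good (FF χ) β) :
    AP {γ : ℝ | γ ≠ 0 ∧ FF χ (β + γ * I) = 0}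
      (fun y => Complex.exp (-β * y) * NN χ y - cc (FF χ) β 0) := by
  have hb := hF.half_le
  constructor
  · intro Y hY
    apply IntervalIntegrable.sub _ (by simp)
    rw [intervalIntegrable_iff, Set.uIoc_of_le hY]
    have hm : Measurable fun y : ℝ => Complex.exp (-β * y) * NN χ y := by
      have := NN_meas χ; fun_prop
    refine Integrable.mono' (g := fun y => (Real.log 4 + 6) * Real.exp (1 * y)) ?_
      hm.aestronglyMeasurable ?_
    · exact (Continuous.integrableOn_Ioc (by fun_prop))
    · filter_upwards [ae_restrict_mem measurableSet_Ioc] with y hy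
      rw [norm_mul, Complex.norm_exp]
      have h1 : Real.exp ((-β * y : ℂ).re) ≤ 1 := by
        rw [Real.exp_le_one_iff]; simp; nlinarith [hy.1]
      have h2 := NN_bound χ hy.1.le
      calc _ ≤ 1 * ‖NN χ y‖ := by gcongr
        _ ≤ _ := by linarith
  · intro ε hε
    obtain ⟨Γ, h0, hΓ⟩ := lemM hF (NN_meas χ) (fun y hy => by simp [NN, not_le.mpr hy])
      (A := 1) zero_le_one (fun y hy => NN_bound χ hy) (fun s hs => NN_laplace χ hs) hε
    refine ⟨∑ γ ∈ Γ.erase 0, cc (FF χ) β γ • ex γ, ?_, ?_⟩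
    · apply Submodule.sum_mem
      intro γ hγ
      rw [Finset.mem_erase] at hγ
      by_cases hc : cc (FF χ) β γ = 0
      · rw [hc, zero_smul]; exact Submodule.zero_mem _
      · exact Submodule.smul_mem _ _ (Submodule.subset_span ⟨γ, ⟨hγ.1, cc_zero hc⟩, rfl⟩)
    · filter_upwards [hΓ] with Y hY
      refine le_trans (le_of_eq ?_) hY
      congr 1
      ext y
      congr 1
      rw [PP, ← Finset.add_sum_erase _ _ h0]
      simp only [Finset.sum_apply, Pi.smul_apply, smul_eq_mul, ex]
      simp
      ring

end S12

namespace S12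

lemma norm_Gamma_le {z : ℂ} (hz : 0 < z.re) : ‖Complex.Gamma z‖ ≤ Real.Gamma z.re := by
  rw [Complex.Gamma_eq_integral hz, Real.Gamma_eq_integral hz, Complex.GammaIntegral]
  refine (norm_integral_le_integral_norm _).trans (le_of_eq ?_)
  refine setIntegral_congr_fun measurableSet_Ioi fun t ht => ?_
  simp only [norm_mul]
  rw [Complex.norm_cpow_eq_rpow_re_of_pos ht]
  simp [Complex.norm_exp]

lemma realGamma_le {x : ℝ} (hx : 1 / 4 ≤ x) :
    Real.Gamma x ≤ 4 * Real.exp (2 * (x + 2) ^ (3 / 2 : ℝ)) := by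
  have h0 : 0 < x := by linarith
  have h1 : Real.Gamma (x + 2) = (x + 1) * (x * Real.Gamma x) := by
    rw [show x + 2 = (x + 1) + 1 by ring, Real.Gamma_add_one (by linarith),
      Real.Gamma_add_one h0.ne']
  have hG := Real.Gamma_pos_of_pos h0
  have h2 : Real.Gamma x ≤ 4 * Real.Gamma (x + 2) := by
    rw [h1]; nlinarith [mul_pos h0 hG]
  have h3 : Real.Gamma (x + 2) ≤ (x + 2) ^ (x + 2) := by
    have hf : (⌊x⌋₊ : ℝ) ≤ x := Nat.floor_le h0.le
    have hf2 : x < ⌊x⌋₊ + 1 := Nat.lt_floor_add_one x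
    have h4 : Real.Gamma (x + 2) ≤ Real.Gamma ((⌊x⌋₊ + 2 : ℕ) + 1) := by
      apply Real.Gamma_strictMonoOn_Ici.monotoneOn
      · simp; linarith
      · simp; linarith
      · push_cast; linarith
    rw [Real.Gamma_nat_eq_factorial] at h4
    refine h4.trans ?_
    have h5 : ((⌊x⌋₊ + 2).factorial : ℝ) ≤ ((⌊x⌋₊ + 2 : ℕ) : ℝ) ^ (⌊x⌋₊ + 2) := by
      exact_mod_cast Nat.factorial_le_pow (⌊x⌋₊ + 2)
    refine h5.trans ?_
    rw [← Real.rpow_natCast]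
    push_cast
    refine (Real.rpow_le_rpow (by positivity) (by linarith : (⌊x⌋₊ : ℝ) + 2 ≤ x + 2) (by positivity)).trans ?_
    exact Real.rpow_le_rpow_of_exponent_le (by linarith) (by linarith)
  have h6 : (x + 2) ^ (x + 2) ≤ Real.exp (2 * (x + 2) ^ (3 / 2 : ℝ)) := by
    have h7 : 0 < x + 2 := by linarith
    rw [Real.rpow_def_of_pos h7]
    apply Real.exp_le_exp.mpr
    have h8 := Real.log_le_rpow_div h7.le (ε := 1 / 2) (by norm_num)
    have h9 : (x + 2) ^ (3 / 2 : ℝ) = (x + 2) ^ (1 / 2 : ℝ) * (x + 2) := by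
      rw [show (3 / 2 : ℝ) = 1 / 2 + 1 by norm_num, Real.rpow_add_one h7.ne']
    rw [h9]
    calc _ ≤ ((x + 2) ^ (1 / 2 : ℝ) / (1 / 2)) * (x + 2) := by gcongr
      _ = _ := by ring
  linarith

def Gr (f : ℂ → ℂ) : Prop :=
  ∃ C : ℝ, 0 ≤ C ∧ ∀ z : ℂ, 1 / 2 ≤ z.re → ‖f z‖ ≤ Real.exp (C * (1 + ‖z‖) ^ (3 / 2 : ℝ))

lemma Gr.mul {f g : ℂ → ℂ} (hf : Gr f) (hg : Gr g) : Gr (fun z => f z * g z) := by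
  obtain ⟨C, hC, h⟩ := hf
  obtain ⟨D, hD, k⟩ := hg
  refine ⟨C + D, by positivity, fun z hz => ?_⟩
  rw [norm_mul, add_mul, Real.exp_add]
  exact mul_le_mul (h z hz) (k z hz) (norm_nonneg _) (Real.exp_pos _).le

lemma le_rpow_aux (z : ℂ) : 1 + ‖z‖ ≤ (1 + ‖z‖) ^ (3 / 2 : ℝ) := by
  have : 1 ≤ 1 + ‖z‖ := by linarith [norm_nonneg z]
  calc 1 + ‖z‖ = (1 + ‖z‖) ^ (1 : ℝ) := by simp
    _ ≤ _ := Real.rpow_le_rpow_of_exponent_le this (by norm_num)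

lemma Gr_poly {f : ℂ → ℂ} {C : ℝ} (hC : 0 < C) (h : ∀ s : ℂ, 1 / 2 ≤ s.re → ‖f s‖ ≤ C * (1 + ‖s‖) ^ 2) :
    Gr f := by
  refine ⟨C + 2, by positivity, fun z hz => (h z hz).trans ?_⟩
  have h1 : C ≤ Real.exp (C * (1 + ‖z‖) ^ (3 / 2 : ℝ)) := by
    have := Real.add_one_le_exp C
    refine (by linarith : C ≤ Real.exp C).trans (Real.exp_le_exp.mpr ?_)
    apply le_mul_of_one_le_right hC.le
    linarith [le_rpow_aux z, norm_nonneg z]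
  have h2 : (1 + ‖z‖) ^ 2 ≤ Real.exp (2 * (1 + ‖z‖) ^ (3 / 2 : ℝ)) := by
    rw [two_mul, Real.exp_add, ← sq]
    gcongr
    refine le_trans ?_ (Real.add_one_le_exp _)
    linarith [le_rpow_aux z]
  rw [add_mul, Real.exp_add]
  gcongr

lemma Gr_Gamma : Gr Gammaℝ ∧ Gr (fun z => Gammaℝ (z + 1)) := by
  have key : ∀ z : ℂ, 1 / 2 ≤ z.re → ‖Gammaℝ z‖ ≤ 4 * Real.exp (2 * (z.re / 2 + 2) ^ (3 / 2 : ℝ)) := by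
    intro z hz
    rw [Gammaℝ_def, norm_mul]
    have h1 : ‖(Real.pi : ℂ) ^ (-z / 2)‖ ≤ 1 := by
      rw [Complex.norm_cpow_eq_rpow_re_of_pos Real.pi_pos]
      apply Real.rpow_le_one_of_one_le_of_nonpos (by linarith [Real.pi_gt_three])
      simp; linarith
    have h2 : (z / 2).re = z.re / 2 := by simp
    have h3 := norm_Gamma_le (z := z / 2) (by rw [h2]; linarith)
    have h4 := realGamma_le (x := z.re / 2) (by linarith)
    rw [h2] at h3
    nlinarith [norm_nonneg ((Real.pi : ℂ) ^ (-z / 2)), norm_nonneg (Complex.Gamma (z / 2))]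
  have key2 : ∀ w z : ℂ, 1 / 2 ≤ w.re → w.re ≤ 1 + ‖z‖ → ‖Gammaℝ w‖ ≤ Real.exp ((2 * 3 ^ (3 / 2 : ℝ) + 3) * (1 + ‖z‖) ^ (3 / 2 : ℝ)) := by
    intro w z hw hwz
    refine (key w hw).trans ?_
    have h4 : (4 : ℝ) ≤ Real.exp (3 * (1 + ‖z‖) ^ (3 / 2 : ℝ)) := by
      refine le_trans ?_ (Real.add_one_le_exp _)
      linarith [le_rpow_aux z, norm_nonneg z]
    rw [add_mul, Real.exp_add, mul_comm]
    have h5 : (w.re / 2 + 2) ^ (3 / 2 : ℝ) ≤ 3 ^ (3 / 2 : ℝ) * (1 + ‖z‖) ^ (3 / 2 : ℝ) := by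
      rw [← Real.mul_rpow (by norm_num) (by positivity)]
      apply Real.rpow_le_rpow (by linarith) _ (by norm_num)
      linarith [norm_nonneg z]
    exact mul_le_mul (Real.exp_le_exp.mpr (by rw [mul_assoc]; linarith)) h4 (by norm_num) (Real.exp_pos _).le
  constructor
  · refine ⟨_, by positivity, fun z hz => key2 z z hz ?_⟩
    linarith [Complex.re_le_norm z]
  · refine ⟨_, by positivity, fun z hz => key2 (z + 1) z ?_ ?_⟩
    · simp; linarith
    · simp; linarith [Complex.re_le_norm z]

end S12

namespace S12
open DirichletCharacter

lemma completed_eq {N : ℕ} [NeZero N] (χ : DirichletCharacter ℂ N) {s : ℂ} (hs : 0 < s.re) :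
    completedLFunction χ s = gammaFactor χ s * χ.LFunction s ∧ gammaFactor χ s ≠ 0 := by
  have h0 : s ≠ 0 := by rintro rfl; simp at hs
  have hg : gammaFactor χ s ≠ 0 := by
    unfold gammaFactor
    split_ifs
    · exact Gammaℝ_ne_zero_of_re_pos hs
    · exact Gammaℝ_ne_zero_of_re_pos (by simp; linarith)
  refine ⟨?_, hg⟩
  rw [LFunction_eq_completed_div_gammaFactor χ s (.inl h0)]
  field_simp

lemma Gr_completed {N : ℕ} [NeZero N] (χ : DirichletCharacter ℂ N) (hχ : χ ≠ 1) :
    Gr (completedLFunction χ) := by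
  have h1 : Gr (gammaFactor χ) := by
    by_cases h : χ.Even
    · obtain ⟨C, hC, hb⟩ := Gr_Gamma.1
      exact ⟨C, hC, fun z hz => by simpa [gammaFactor, h] using hb z hz⟩
    · obtain ⟨C, hC, hb⟩ := Gr_Gamma.2
      exact ⟨C, hC, fun z hz => by simpa [gammaFactor, h] using hb z hz⟩
  obtain ⟨C, hC, hb⟩ := FF_bound χ
  obtain ⟨D, hD, hd⟩ := h1.mul (Gr_poly (f := FF χ) hC (fun s hs => hb s (by linarith)))
  have hL : FF χ = χ.LFunction := by
    ext s
    by_cases hs : s = 1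
    · have hc : Continuous (FF χ) := (FF_diff χ).continuous
      have hc2 : Continuous χ.LFunction := (differentiable_LFunction hχ).continuous
      have : Set.EqOn (FF χ) χ.LFunction {1}ᶜ := fun z hz => by
        rw [FF_eq χ hz]; simp [ee, hχ]
      exact congrFun (Continuous.ext_on (dense_compl_singleton 1) hc hc2 this) s
    · rw [FF_eq χ hs]; simp [ee, hχ]
  refine ⟨D, hD, fun z hz => ?_⟩
  rw [(completed_eq χ (by linarith)).1, ← hL]
  exact hd z hz

lemma completed_growth {N : ℕ} [NeZero N] (χ : DirichletCharacter ℂ N) (hχ : χ ≠ 1) (hp : χ.IsPrimitive) :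
    ∃ C : ℝ, 0 ≤ C ∧ ∀ z : ℂ, ‖completedLFunction χ z‖ ≤ Real.exp (C * (2 + ‖z‖) ^ (3 / 2 : ℝ)) := by
  obtain ⟨C, hC, hb⟩ := Gr_completed χ hχ
  have h2 : Gr (fun s => ((N : ℂ) ^ (s - 1 / 2) * rootNumber χ) * completedLFunction χ⁻¹ s) := by
    refine Gr.mul (Gr.mul ?_ ?_) (Gr_completed χ⁻¹ (by simpa using hχ))
    · refine ⟨Real.log N, Real.log_natCast_nonneg _, fun z hz => ?_⟩
      have hN : (0 : ℝ) < N := by exact_mod_cast Nat.pos_of_ne_zero (NeZero.ne N)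
      have := Complex.norm_cpow_eq_rpow_re_of_pos hN (z - 1 / 2)
      push_cast at this
      rw [this, Real.rpow_def_of_pos hN]
      apply Real.exp_le_exp.mpr
      have h0 := Real.log_natCast_nonneg N
      gcongr
      have h1 := le_rpow_aux z
      have h2 := Complex.re_le_norm z
      simp
      linarith
    · refine Gr_poly (C := 1 + ‖rootNumber χ‖) (by positivity) fun s _ => ?_
      have : 1 ≤ 1 + ‖s‖ := by linarith [norm_nonneg s]
      exact le_trans (by linarith) (le_mul_of_one_le_right (by positivity) (one_le_pow₀ this))
  obtain ⟨D, hD, hd⟩ := h2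
  refine ⟨max C D, by positivity, fun z => ?_⟩
  by_cases hz : 1 / 2 ≤ z.re
  · refine (hb z hz).trans (Real.exp_le_exp.mpr ?_)
    gcongr
    · exact le_max_left _ _
    · norm_num
  · have := hp.completedLFunction_one_sub (1 - z)
    rw [sub_sub_cancel] at this
    rw [this]
    refine (hd (1 - z) (by simp; linarith)).trans (Real.exp_le_exp.mpr ?_)
    refine mul_le_mul (le_max_right _ _) (Real.rpow_le_rpow (by positivity) ?_ (by norm_num))
      (by positivity) (by positivity)
    have := norm_sub_le 1 z
    rw [norm_one] at this
    linarith

lemma LF_low {q : ℕ} [NeZero q] (χ : DirichletCharacter ℂ q) :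
    ∃ c : ℝ, 0 < c ∧ ∀ s : ℂ, 2 ≤ s.re → c ≤ ‖χ.LFunction s‖ := by
  have hsum : LSeriesSummable ((fun n : ℕ => χ (n : ZMod q)) * (fun n : ℕ => (ArithmeticFunction.moebius n : ℂ))) 2 :=
    DirichletCharacter.LSeriesSummable_mul χ
      (ArithmeticFunction.LSeriesSummable_moebius_iff.mpr (by simp))
  obtain ⟨B, hB, hb⟩ := LSeries_bdd hsum
  refine ⟨B⁻¹, by positivity, fun s hs => ?_⟩
  have hm := DirichletCharacter.LSeries.mul_mu_eq_one χ (s := s) (by linarith)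
  rw [← DirichletCharacter.LFunction_eq_LSeries χ (by linarith)] at hm
  have hm2 := congrArg norm hm
  rw [norm_mul, norm_one] at hm2
  have hb2 := hb s hs
  rw [inv_le_iff_one_le_mul₀ hB, ← hm2]
  exact mul_le_mul_of_nonneg_left hb2 (norm_nonneg _)

lemma LF_up {q : ℕ} [NeZero q] (χ : DirichletCharacter ℂ q) :
    ∃ c : ℝ, 0 < c ∧ ∀ s : ℂ, 2 ≤ s.re → ‖χ.LFunction s‖ ≤ c := by
  have hsum : LSeriesSummable (fun n : ℕ => χ (n : ZMod q)) 2 := χ.LSeriesSummable_of_one_lt_re (by simp)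
  obtain ⟨B, hB, hb⟩ := LSeries_bdd hsum
  refine ⟨B, hB, fun s hs => ?_⟩
  rw [DirichletCharacter.LFunction_eq_LSeries χ (by linarith)]
  exact hb s hs

lemma completed_zero {N : ℕ} [NeZero N] (χ : DirichletCharacter ℂ N) (hχ : χ ≠ 1) (hp : χ.IsPrimitive) :
    ∃ ρ : ℂ, completedLFunction χ ρ = 0 := by
  by_contra! hne
  obtain ⟨C, hC, hg⟩ := completed_growth χ hχ hp
  set ξ := completedLFunction χ
  have hd : Differentiable ℂ ξ := differentiable_completedLFunction hχ
  have hld : Differentiable ℂ (logDeriv ξ) := by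
    intro z
    have : DifferentiableAt ℂ (deriv ξ) z := (hd.contDiff (n := 2)).differentiable_deriv_two z
    exact this.div (hd z) (hne z)
  -- o(R) bound
  have hb : ∀ R : ℝ, 1 ≤ R → ∀ z : ℂ, ‖z‖ ≤ R → ‖logDeriv ξ z‖ ≤
      16 * (C * 8 + 1 + |Real.log ‖ξ 0‖|) * R ^ (1 / 2 : ℝ) := by
    intro R hR z hz
    have hR3 : 1 ≤ R ^ (3 / 2 : ℝ) := Real.one_le_rpow hR (by norm_num)
    set M := Real.exp (C * (2 + 2 * R) ^ (3 / 2 : ℝ)) with hM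
    have hM2 : ∀ w ∈ Metric.ball (0:ℂ) (2 * R), ‖ξ w‖ ≤ M := by
      intro w hw
      refine (hg w).trans (Real.exp_le_exp.mpr ?_)
      have : ‖w‖ < 2 * R := by simpa using hw
      gcongr
    have hm : Real.log (M / ‖ξ 0‖) ≤ (C * 8 + 1 + |Real.log ‖ξ 0‖|) * R ^ (3 / 2 : ℝ) := by
      rw [Real.log_div (Real.exp_pos _).ne' (norm_ne_zero_iff.mpr (hne 0)), Real.log_exp]
      have h1 : (2 + 2 * R) ^ (3 / 2 : ℝ) ≤ 8 * R ^ (3 / 2 : ℝ) := by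
        have : (8 : ℝ) = 4 ^ (3 / 2 : ℝ) := by
          rw [show (4 : ℝ) = 2 ^ (2 : ℝ) by norm_num, ← Real.rpow_mul (by norm_num)]; norm_num
        rw [this, ← Real.mul_rpow (by norm_num) (by linarith)]
        apply Real.rpow_le_rpow (by linarith) (by linarith) (by norm_num)
      have h2 := neg_abs_le (Real.log ‖ξ 0‖)
      have h3 := abs_nonneg (Real.log ‖ξ 0‖)
      nlinarith [mul_le_mul_of_nonneg_left h1 hC]
    have := logDeriv_bound (r := R) (r₁ := 2 * R) (by linarith) (by linarith) (g := ξ)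
      hd.differentiableOn (fun w _ => hne w) hM2 hm (by positivity) hz
    refine this.trans (le_of_eq ?_)
    have hR0 : (0 : ℝ) < R := by linarith
    have e : R ^ (3 / 2 : ℝ) = R ^ (1 / 2 : ℝ) * R := by
      rw [show (3 / 2 : ℝ) = 1 / 2 + 1 by norm_num, Real.rpow_add_one hR0.ne']
    rw [e]
    have : 2 * R - R = R := by ring
    rw [this]
    field_simp
    ring
  set K := 16 * (C * 8 + 1 + |Real.log ‖ξ 0‖|) with hK
  have hK0 : 0 ≤ K := by positivity
  have hder : ∀ z, deriv (logDeriv ξ) z = 0 := by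
    intro z
    rw [← norm_le_zero_iff]
    have hlim : Tendsto (fun R : ℝ => K * 2 * R ^ (-(1 / 2) : ℝ)) atTop (𝓝 (K * 2 * 0)) :=
      (tendsto_rpow_neg_atTop (by norm_num)).const_mul _
    rw [mul_zero] at hlim
    refine ge_of_tendsto hlim ?_
    filter_upwards [eventually_ge_atTop (max 1 ‖z‖)] with R hR
    have hR1 : 1 ≤ R := (le_max_left _ _).trans hR
    have hRz : ‖z‖ ≤ R := (le_max_right _ _).trans hR
    have hR0 : (0 : ℝ) < R := by linarith
    have := Complex.norm_deriv_le_of_forall_mem_sphere_norm_le (f := logDeriv ξ) (c := z) hR0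
      (hld.diffContOnCl) (C := K * (2 * R) ^ (1 / 2 : ℝ)) (fun w hw => by
        apply hb (2 * R) (by linarith)
        have h1 : ‖w - z‖ = R := by simpa [dist_eq_norm] using hw
        have := norm_add_le (w - z) z
        rw [sub_add_cancel] at this
        linarith)
    refine this.trans ?_
    have h2 : (2 * R) ^ (1 / 2 : ℝ) ≤ 2 * R ^ (1 / 2 : ℝ) := by
      rw [Real.mul_rpow (by norm_num) hR0.le]
      gcongr
      calc (2 : ℝ) ^ (1 / 2 : ℝ) ≤ 2 ^ (1 : ℝ) := Real.rpow_le_rpow_of_exponent_le (by norm_num) (by norm_num)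
        _ = 2 := by simp
    have e : R ^ (-(1 / 2) : ℝ) = R ^ (1 / 2 : ℝ) / R := by
      rw [show (-(1 / 2) : ℝ) = 1 / 2 - 1 by norm_num, Real.rpow_sub_one hR0.ne']
    rw [e, ← mul_div_assoc]
    refine div_le_div_of_nonneg_right ?_ hR0.le
    nlinarith
  set B := logDeriv ξ 0
  have hB : ∀ z, logDeriv ξ z = B := fun z => is_const_of_deriv_eq_zero hld hder z 0
  have hB2 : ∀ z, deriv ξ z = B * ξ z := by
    intro z
    rw [← hB z, logDeriv_apply, div_mul_cancel₀ _ (hne z)]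
  have hexp : ∀ z, ξ z * cexp (-(B * z)) = ξ 0 := by
    intro z
    have hdd : ∀ z, HasDerivAt (fun z => ξ z * cexp (-(B * z))) 0 z := by
      intro z
      have h1 := (hd z).hasDerivAt
      have h2 : HasDerivAt (fun z : ℂ => cexp (-(B * z))) (cexp (-(B * z)) * (-(B * 1))) z :=
        (((hasDerivAt_id z).const_mul B).neg).cexp
      have := h1.mul h2
      exact this.congr_deriv (by rw [hB2]; ring)
    have := is_const_of_deriv_eq_zero (f := fun z => ξ z * cexp (-(B * z))) (fun z => (hdd z).differentiableAt)
      (fun z => (hdd z).deriv) z 0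
    simpa using this
  have hratio : ∀ z, ξ (z + 2) = cexp (2 * B) * ξ z := by
    intro z
    have h1 := hexp z
    have h2 := hexp (z + 2)
    have h3 : ξ (z + 2) * cexp (-(B * (z + 2))) = ξ z * cexp (-(B * z)) := by rw [h1, h2]
    have h4 : cexp (-(B * (z + 2))) = cexp (-(B * z)) * (cexp (2 * B))⁻¹ := by
      rw [← Complex.exp_neg, ← Complex.exp_add]; congr 1; ring
    rw [h4] at h3
    have h5 := Complex.exp_ne_zero (-(B * z))
    have h6 := Complex.exp_ne_zero (2 * B)
    have h7 : ξ (z + 2) = ξ z * cexp (2 * B) := by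
      field_simp at h3
      linear_combination h3
    rw [h7]; ring
  obtain ⟨c, hc, hlow⟩ := LF_low χ
  obtain ⟨D, hD, hup⟩ := LF_up χ
  have hfin : ∀ τ : ℝ, 0 ≤ τ → τ * c ≤ 2 * Real.pi * ‖cexp (2 * B)‖ * D := by
    intro τ hτ
    set z : ℂ := 2 + τ * I with hz
    have hzre : z.re = 2 := by simp [hz]
    have hzim : z.im = τ := by simp [hz]
    have h1 := hratio z
    have hz2 : (z + 2).re = 4 := by simp [hzre]; norm_num
    obtain ⟨e1, -⟩ := completed_eq χ (s := z + 2) (by rw [hz2]; norm_num)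
    obtain ⟨e2, g2⟩ := completed_eq χ (s := z) (by rw [hzre]; norm_num)
    have hw : ∃ w : ℂ, τ ≤ ‖w‖ ∧ gammaFactor χ (z + 2) = gammaFactor χ z * w / 2 / Real.pi := by
      by_cases h : χ.Even
      · refine ⟨z, ?_, ?_⟩
        · have := Complex.abs_im_le_norm z
          rw [hzim] at this
          exact (le_abs_self _).trans this
        · simp only [gammaFactor, h, if_true]
          exact Gammaℝ_add_two (fun h => by rw [h] at hzre; simp at hzre)
      · refine ⟨z + 1, ?_, ?_⟩
        · have := Complex.abs_im_le_norm (z + 1)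
          rw [add_im, hzim, one_im, add_zero] at this
          exact (le_abs_self _).trans this
        · simp only [gammaFactor, h, if_false]
          rw [show z + 2 + 1 = z + 1 + 2 by ring]
          refine Gammaℝ_add_two (fun h => ?_)
          have := congrArg re h
          rw [add_re, hzre] at this
          norm_num at this
    obtain ⟨w, hw1, hw2⟩ := hw
    have hpi : (Real.pi : ℂ) ≠ 0 := by exact_mod_cast Real.pi_ne_zero
    have h2 : w * χ.LFunction (z + 2) = 2 * Real.pi * cexp (2 * B) * χ.LFunction z := by
      have h3 : completedLFunction χ (z + 2) = cexp (2 * B) * completedLFunction χ z := h1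
      rw [e1, e2, hw2] at h3
      field_simp at h3
      linear_combination h3
    have h4 := congrArg norm h2
    simp only [norm_mul] at h4
    have h5 := hlow (z + 2) (by rw [hz2]; norm_num)
    have h6 := hup z (by rw [hzre])
    have hp : ‖(Real.pi : ℂ)‖ = Real.pi := by simp [abs_of_pos Real.pi_pos]
    rw [hp, Complex.norm_ofNat] at h4
    calc τ * c ≤ ‖w‖ * ‖χ.LFunction (z + 2)‖ := mul_le_mul hw1 h5 hc.le (norm_nonneg _)
      _ = _ := h4
      _ ≤ _ := by gcongr
  have := hfin ((2 * Real.pi * ‖cexp (2 * B)‖ * D + 1) / c) (by positivity)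
  rw [div_mul_cancel₀ _ hc.ne'] at this
  linarith

end S12

namespace S12
open DirichletCharacter

lemma FF_zero_iff {q : ℕ} [NeZero q] (χ : DirichletCharacter ℂ q) (hχ : χ ≠ 1) : FF χ = χ.LFunction := by
  ext s
  by_cases hs : s = 1
  · have hc : Continuous (FF χ) := (FF_diff χ).continuous
    have hc2 : Continuous χ.LFunction := (differentiable_LFunction hχ).continuous
    have : Set.EqOn (FF χ) χ.LFunction {1}ᶜ := fun z hz => by
      rw [FF_eq χ hz]; simp [ee, hχ]
    exact congrFun (Continuous.ext_on (dense_compl_singleton 1) hc hc2 this) s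
  · rw [FF_eq χ hs]; simp [ee, hχ]

lemma exists_strip_zero {q : ℕ} [NeZero q] (χ : DirichletCharacter ℂ q) (hχ : χ ≠ 1) :
    ∃ ρ : ℂ, 0 < ρ.re ∧ ρ.re < 1 ∧ χ.LFunction ρ = 0 ∧ χ⁻¹.LFunction (1 - ρ) = 0 := by
  set ψ := χ.primitiveCharacter with hψ
  have hcl : changeLevel χ.conductor_dvd_level ψ = χ := χ.changeLevel_primitiveCharacter
  haveI : NeZero χ.conductor := ⟨fun h => by
    have := χ.conductor_dvd_level
    rw [h, zero_dvd_iff] at this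
    exact NeZero.ne q this⟩
  have hψ1 : ψ ≠ 1 := by
    intro h; rw [h, map_one] at hcl; exact hχ hcl.symm
  have hψi : ψ⁻¹ ≠ 1 := by simpa using hψ1
  have hcl2 : changeLevel χ.conductor_dvd_level ψ⁻¹ = χ⁻¹ := by rw [map_inv, hcl]
  have hp : ψ.IsPrimitive := χ.primitiveCharacter_isPrimitive
  obtain ⟨ρ, hρ⟩ := completed_zero ψ hψ1 hp
  have hfe := hp.completedLFunction_one_sub (1 - ρ)
  rw [sub_sub_cancel, hρ] at hfe
  have hnz : ∀ φ : DirichletCharacter ℂ χ.conductor, φ ≠ 1 → ∀ s : ℂ, 1 ≤ s.re → completedLFunction φ s ≠ 0 := by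
    intro φ hφ s hs
    obtain ⟨e, hg⟩ := completed_eq φ (s := s) (by linarith)
    rw [e]
    exact mul_ne_zero hg (LFunction_ne_zero_of_one_le_re φ (.inl hφ) hs)
  have hz2 : completedLFunction ψ⁻¹ (1 - ρ) = 0 := by
    have hN : (χ.conductor : ℂ) ^ (1 - ρ - 1 / 2) ≠ 0 := by
      rw [Complex.cpow_ne_zero_iff]; left; exact_mod_cast NeZero.ne _
    have hr : rootNumber ψ ≠ 0 := by
      intro hr
      have h1 := hp.completedLFunction_one_sub (-1)
      rw [hr] at h1
      refine hnz ψ hψ1 (1 - -1) (by simp) ?_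
      rw [h1]; simp
    rcases mul_eq_zero.mp hfe.symm with h | h
    · exact absurd h (mul_ne_zero hN hr)
    · exact h
  have hre1 : ρ.re < 1 := by
    by_contra! h
    exact hnz ψ hψ1 ρ h hρ
  have hre0 : 0 < ρ.re := by
    by_contra! h
    exact hnz ψ⁻¹ hψi (1 - ρ) (by simp; linarith) hz2
  have hL1 : ψ.LFunction ρ = 0 := by
    obtain ⟨e, hg⟩ := completed_eq ψ (s := ρ) hre0
    rw [hρ] at e
    exact (mul_eq_zero.mp e.symm).resolve_left hg
  have hL2 : ψ⁻¹.LFunction (1 - ρ) = 0 := by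
    obtain ⟨e, hg⟩ := completed_eq ψ⁻¹ (s := 1 - ρ) (by simp; linarith)
    rw [hz2] at e
    exact (mul_eq_zero.mp e.symm).resolve_left hg
  refine ⟨ρ, hre0, hre1, ?_, ?_⟩
  · rw [← hcl, LFunction_changeLevel _ _ (.inl hψ1), hL1, zero_mul]
  · rw [← hcl2, LFunction_changeLevel _ _ (.inl hψi), hL2, zero_mul]

lemma beta_bdd (q : ℕ) [NeZero q] : BddAbove {b : ℝ | ∃ χ : DirichletCharacter ℂ q, χ ≠ 1 ∧
    ∃ ρ : ℂ, χ.LFunction ρ = 0 ∧ 0 < ρ.re ∧ ρ.re < 1 ∧ ρ.re = b} := by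
  refine ⟨1, ?_⟩
  rintro b ⟨χ, -, ρ, -, -, h, rfl⟩
  exact h.le

lemma exists_nontriv (q : ℕ) [NeZero q] {a b : ZMod q} (ha : IsUnit a) (hb : IsUnit b) (hab : a ≠ b) :
    ∃ χ : DirichletCharacter ℂ q, χ ≠ 1 := by
  obtain ⟨u, rfl⟩ := ha
  obtain ⟨v, rfl⟩ := hb
  have h1 : ((u * v⁻¹ : (ZMod q)ˣ) : ZMod q) ≠ 1 := by
    intro h
    have : u * v⁻¹ = 1 := Units.ext h
    exact hab (by rw [mul_inv_eq_one.mp this])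
  obtain ⟨χ, hχ⟩ := DirichletCharacter.exists_apply_ne_one_of_hasEnoughRootsOfUnity ℂ h1
  refine ⟨χ, ?_⟩
  rintro rfl
  exact hχ (MulChar.one_apply (Units.isUnit _))

lemma beta_half (q : ℕ) [NeZero q] (h : ∃ χ : DirichletCharacter ℂ q, χ ≠ 1) : 1 / 2 ≤ betaQ q := by
  obtain ⟨χ, hχ⟩ := h
  obtain ⟨ρ, h0, h1, hz, hz'⟩ := exists_strip_zero χ hχ
  have ha : ρ.re ≤ betaQ q := le_csSup (beta_bdd q) ⟨χ, hχ, ρ, hz, h0, h1, rfl⟩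
  have hb : (1 - ρ).re ≤ betaQ q :=
    le_csSup (beta_bdd q) ⟨χ⁻¹, by simpa using hχ, 1 - ρ, hz', by simp; linarith, by simp; linarith, rfl⟩
  simp at hb
  linarith

lemma beta_le (q : ℕ) [NeZero q] (h : ∃ χ : DirichletCharacter ℂ q, χ ≠ 1) : betaQ q ≤ 1 := by
  obtain ⟨χ, hχ⟩ := h
  obtain ⟨ρ, h0, h1, hz, hz'⟩ := exists_strip_zero χ hχ
  unfold betaQ
  refine csSup_le ⟨ρ.re, χ, hχ, ρ, hz, h0, h1, rfl⟩ ?_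
  rintro b ⟨χ, -, ρ, -, -, h, rfl⟩
  exact h.le

lemma beta_good (q : ℕ) [NeZero q] (χ : DirichletCharacter ℂ q) (hχ : χ ≠ 1) : Good (FF χ) (betaQ q) := by
  refine FF_good χ (beta_half q ⟨χ, hχ⟩) (beta_le q ⟨χ, hχ⟩) fun s hs hz => ?_
  rcases le_or_gt 1 s.re with h | h
  · exact FF_ne_zero χ h hz
  · have := beta_half q ⟨χ, hχ⟩
    have : s.re ≤ betaQ q := le_csSup (beta_bdd q)
      ⟨χ, hχ, s, by rw [← FF_zero_iff χ hχ]; exact hz, by linarith, h, rfl⟩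
    linarith

lemma one_good {q : ℕ} [NeZero q] (χ : DirichletCharacter ℂ q) : Good (FF χ) 1 :=
  FF_good χ (by norm_num) le_rfl fun _ hs => FF_ne_zero χ hs.le

lemma AP_one {q : ℕ} [NeZero q] (χ : DirichletCharacter ℂ q) :
    AP ∅ (fun y : ℝ => cexp (-y) * NN χ y) := by
  have h := AP_NN χ (one_good χ)
  have hc : cc (FF χ) 1 0 = 0 := by
    by_contra h
    exact FF_ne_zero χ (by simp) (cc_zero h)
  have hs : {γ : ℝ | γ ≠ 0 ∧ FF χ ((1 : ℝ) + γ * I) = 0} = ∅ := by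
    ext γ
    simp only [Set.mem_setOf_eq, Set.mem_empty_iff_false, iff_false, not_and]
    intro _
    exact FF_ne_zero χ (by simp)
  rw [hs, hc] at h
  refine h.congr fun y _ => ?_
  simp
end S12

namespace S12
open ArithmeticFunction (vonMangoldt)

def SS (w : ℕ → ℝ) (x : ℝ) : ℝ := ∑ n ∈ Finset.Icc 1 ⌊x⌋₊, w n

lemma SS_meas (w : ℕ → ℝ) : Measurable (SS w) := by
  have : SS w = (fun k : ℕ => ∑ n ∈ Finset.Icc 1 k, w n) ∘ Nat.floor := rfl
  rw [this]
  exact (measurable_of_countable _).comp Nat.measurable_floor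

lemma SS_mono {v w : ℕ → ℝ} (h : ∀ n, v n ≤ w n) (x : ℝ) : SS v x ≤ SS w x :=
  Finset.sum_le_sum fun n _ => h n

lemma SS_nonneg {w : ℕ → ℝ} (h : ∀ n, 0 ≤ w n) (x : ℝ) : 0 ≤ SS w x :=
  Finset.sum_nonneg fun n _ => h n

lemma SS_sub (v w : ℕ → ℝ) (x : ℝ) : SS (fun n => v n - w n) x = SS v x - SS w x :=
  Finset.sum_sub_distrib _ _

open Classical in
def wpsi {q : ℕ} (a : ZMod q) (n : ℕ) : ℝ := if (n : ZMod q) = a then vonMangoldt n else 0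
open Classical in
def wth {q : ℕ} (a : ZMod q) (n : ℕ) : ℝ := if n.Prime ∧ (n : ZMod q) = a then Real.log n else 0
open Classical in
def wsq {q : ℕ} (a : ZMod q) (n : ℕ) : ℝ :=
  if (∃ p : ℕ, p.Prime ∧ p ^ 2 = n) then (if (n : ZMod q) = a then vonMangoldt n else 0) else 0

open Classical in
lemma sum_sq (g : ℕ → ℝ) {x : ℝ} (hx : 0 ≤ x) :
    SS (fun n => if (∃ p : ℕ, p.Prime ∧ p ^ 2 = n) then g n else 0) x =
    SS (fun p => if p.Prime then g (p ^ 2) else 0) (Real.sqrt x) := by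
  unfold SS
  rw [← Finset.sum_filter, ← Finset.sum_filter]
  symm
  have key : ∀ p : ℕ, p ≤ ⌊Real.sqrt x⌋₊ ↔ p ^ 2 ≤ ⌊x⌋₊ := by
    intro p
    rw [Nat.le_floor_iff (Real.sqrt_nonneg x), Nat.le_floor_iff hx, Real.le_sqrt (by positivity) hx]
    push_cast; rfl
  refine Finset.sum_bij (fun p _ => p ^ 2) ?_ ?_ ?_ ?_
  · intro p hp
    simp only [Finset.mem_filter, Finset.mem_Icc] at hp ⊢
    exact ⟨⟨Nat.one_le_pow _ _ hp.1.1, (key p).1 hp.1.2⟩, p, hp.2, rfl⟩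
  · intro p _ r _ h
    exact Nat.pow_left_injective (by norm_num) h
  · intro n hn
    simp only [Finset.mem_filter, Finset.mem_Icc] at hn
    obtain ⟨⟨h1, h2⟩, p, hp, rfl⟩ := hn
    refine ⟨p, ?_, rfl⟩
    simp only [Finset.mem_filter, Finset.mem_Icc]
    exact ⟨⟨hp.one_le, (key p).2 h2⟩, hp⟩
  · intros; rfl

lemma vm_sq {p : ℕ} (hp : p.Prime) : vonMangoldt (p ^ 2) = Real.log p := by
  rw [ArithmeticFunction.vonMangoldt_apply_pow (by norm_num), ArithmeticFunction.vonMangoldt_apply_prime hp]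

lemma SS_wsq {q : ℕ} [NeZero q] (a : ZMod q) {x : ℝ} (hx : 0 ≤ x) :
    SS (wsq a) x = ∑ c ∈ (Finset.univ : Finset (ZMod q)).filter (fun c => c ^ 2 = a), SS (wth c) (Real.sqrt x) := by
  classical
  have h := sum_sq (fun n => if (n : ZMod q) = a then vonMangoldt n else 0) hx
  have e1 : SS (wsq a) x = SS (fun n => if (∃ p : ℕ, p.Prime ∧ p ^ 2 = n) then
      (if (n : ZMod q) = a then vonMangoldt n else 0) else 0) x := by
    unfold SS; refine Finset.sum_congr rfl fun n _ => ?_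
    unfold wsq; congr
  rw [e1, h]
  unfold SS
  rw [Finset.sum_comm]
  refine Finset.sum_congr rfl fun p _ => ?_
  by_cases hp : p.Prime
  · simp only [hp, if_true, wth, true_and, vm_sq hp]
    rw [Finset.sum_ite_eq]
    simp
  · simp [hp, wth]

lemma psi_eq (x : ℝ) : Chebyshev.psi x = SS vonMangoldt x := by
  unfold Chebyshev.psi SS; rfl

lemma theta_eq (x : ℝ) : Chebyshev.theta x = SS (fun p => if p.Prime then Real.log p else 0) x := by
  unfold Chebyshev.theta SS; rw [Finset.sum_filter]; rfl

lemma theta_sqrt {x : ℝ} (hx : 0 ≤ x) : Chebyshev.theta (Real.sqrt x) =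
    SS (fun n => open Classical in if (∃ p : ℕ, p.Prime ∧ p ^ 2 = n) then vonMangoldt n else 0) x := by
  rw [sum_sq _ hx, theta_eq]
  unfold SS
  refine Finset.sum_congr rfl fun p _ => ?_
  by_cases hp : p.Prime
  · simp [hp, vm_sq hp]
  · simp [hp]

lemma resid {q : ℕ} (a : ZMod q) {x : ℝ} (hx : 0 ≤ x) :
    0 ≤ SS (wpsi a) x - SS (wth a) x - SS (wsq a) x ∧
    SS (wpsi a) x - SS (wth a) x - SS (wsq a) x ≤
      Chebyshev.psi x - Chebyshev.theta x - Chebyshev.theta (Real.sqrt x) := by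
  classical
  rw [psi_eq, theta_sqrt hx, theta_eq, ← SS_sub, ← SS_sub, ← SS_sub, ← SS_sub]
  have key : ∀ n, 0 ≤ wpsi a n - wth a n - wsq a n ∧ wpsi a n - wth a n - wsq a n ≤
      vonMangoldt n - (if n.Prime then Real.log n else 0) -
      (if (∃ p : ℕ, p.Prime ∧ p ^ 2 = n) then vonMangoldt n else 0) := by
    intro n
    have h0 : 0 ≤ vonMangoldt n := ArithmeticFunction.vonMangoldt_nonneg
    by_cases hn : n.Prime
    · have h2 : ¬ ∃ p : ℕ, p.Prime ∧ p ^ 2 = n := by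
        rintro ⟨p, hp, rfl⟩
        exact Nat.Prime.not_prime_pow le_rfl hn
      have h3 := ArithmeticFunction.vonMangoldt_apply_prime hn
      simp only [wpsi, wth, wsq, hn, h2, if_false, true_and, if_true, h3]
      split_ifs <;> simp
    · simp only [wpsi, wth, wsq, hn, if_false, false_and]
      split_ifs <;> simp [h0]
  refine ⟨SS_nonneg (fun n => (key n).1) x, ?_⟩
  convert SS_mono (fun n => (key n).2) x using 3

lemma resid_bound : ∃ C : ℝ, 0 < C ∧ ∀ x : ℝ, 1 ≤ x →
    Chebyshev.psi x - Chebyshev.theta x - Chebyshev.theta (Real.sqrt x) ≤ C * x ^ (1 / 3 : ℝ) := by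
  obtain ⟨C, hC⟩ := Chebyshev.psi_sub_theta_le_mul_sqrt
  set L := Real.log 4 + 4
  have hL : 0 < L := by positivity
  refine ⟨|C| + 2 * L, by positivity, fun x hx => ?_⟩
  have h0 : (0 : ℝ) ≤ x := by linarith
  have h1 := Chebyshev.psi_sub_theta_le_psi_add_psi_add_psi x
  have h2 := hC (Real.sqrt x)
  have h3 := Chebyshev.psi_le_const_mul_self (x := x ^ (1 / 3 : ℝ)) (by positivity)
  have h4 := Chebyshev.psi_le_const_mul_self (x := x ^ (1 / 5 : ℝ)) (by positivity)
  have h5 : x ^ (1 / 5 : ℝ) ≤ x ^ (1 / 3 : ℝ) := Real.rpow_le_rpow_of_exponent_le hx (by norm_num)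
  have h6 : Real.sqrt (Real.sqrt x) ≤ x ^ (1 / 3 : ℝ) := by
    rw [Real.sqrt_eq_rpow, Real.sqrt_eq_rpow, ← Real.rpow_mul h0]
    exact Real.rpow_le_rpow_of_exponent_le hx (by norm_num)
  have h7 : C * Real.sqrt (Real.sqrt x) ≤ |C| * x ^ (1 / 3 : ℝ) :=
    mul_le_mul (le_abs_self C) h6 (Real.sqrt_nonneg _) (abs_nonneg _)
  have h8 := mul_le_mul_of_nonneg_left h5 hL.le
  rw [← one_div, ← one_div, ← one_div, ← Real.sqrt_eq_rpow] at h1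
  nlinarith

end S12

namespace S12
open ArithmeticFunction (vonMangoldt)

lemma AP_empty_iff {h : ℝ → ℂ} : AP ∅ h ↔ (∀ Y : ℝ, 0 ≤ Y → IntervalIntegrable h volume 0 Y) ∧
    ∀ ε : ℝ, 0 < ε → ∀ᶠ Y in atTop, ∫ y in (0:ℝ)..Y, ‖h y‖ ≤ ε * Y := by
  unfold AP
  refine and_congr_right fun _ => forall_congr' fun ε => forall_congr' fun _ => ?_
  simp

lemma AP.of_decay {h : ℝ → ℂ} (hm : Measurable h) {C δ : ℝ} (hδ : 0 < δ)
    (hb : ∀ y, 0 ≤ y → ‖h y‖ ≤ C * Real.exp (-δ * y)) : AP ∅ h := by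
  have hi : ∀ Y : ℝ, 0 ≤ Y → IntervalIntegrable h volume 0 Y := by
    intro Y hY
    have hc : IntervalIntegrable (fun y : ℝ => C * Real.exp (-δ * y)) volume 0 Y :=
      (by fun_prop : Continuous (fun y : ℝ => C * Real.exp (-δ * y))).intervalIntegrable _ _
    refine hc.mono_fun hm.aestronglyMeasurable ?_
    rw [Set.uIoc_of_le hY]
    filter_upwards [ae_restrict_mem measurableSet_Ioc] with y hy
    exact (hb y hy.1.le).trans (le_abs_self _)
  rw [AP_empty_iff]
  refine ⟨hi, fun ε hε => ?_⟩
  have hC : 0 ≤ C := by simpa using (norm_nonneg _).trans (hb 0 le_rfl)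
  filter_upwards [eventually_ge_atTop (C / δ / ε), eventually_ge_atTop 0] with Y hY hY0
  have h1 : ∫ y in (0:ℝ)..Y, ‖h y‖ ≤ ∫ y in (0:ℝ)..Y, C * Real.exp (-δ * y) := by
    apply intervalIntegral.integral_mono_on hY0 (hi Y hY0).norm
    · exact (by fun_prop : Continuous (fun y : ℝ => C * Real.exp (-δ * y))).intervalIntegrable _ _
    · intro y hy; exact hb y hy.1
  refine h1.trans ?_
  have hI : ∫ x in (0:ℝ)..Y, Real.exp (-δ * x) = (Real.exp (-δ * Y) - 1) / (-δ) := by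
    rw [intervalIntegral.integral_comp_mul_left (fun x => Real.exp x) (neg_ne_zero.mpr hδ.ne'),
      integral_exp, mul_zero, Real.exp_zero, smul_eq_mul, div_eq_inv_mul]
  rw [intervalIntegral.integral_const_mul, hI]
  have h2 : C / δ ≤ ε * Y := by
    rw [div_le_iff₀ hε] at hY; linarith
  refine le_trans ?_ h2
  rw [div_eq_mul_inv C δ]
  gcongr
  have h3 := Real.exp_pos (-δ * Y)
  rw [div_le_iff_of_neg (by linarith)]
  have h4 : δ⁻¹ * -δ = -1 := by field_simp
  rw [h4]
  linarith

lemma AP.half {h : ℝ → ℂ} (hh : AP ∅ h) : AP ∅ (fun y => h (y / 2)) := by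
  rw [AP_empty_iff] at hh ⊢
  refine ⟨fun Y hY => ?_, fun ε hε => ?_⟩
  · have := (hh.1 (Y / 2) (by positivity)).comp_mul_left (c := 1 / 2)
    simp only [zero_div, div_div_eq_mul_div, one_div] at this
    convert this using 1
    · ext y; congr 1; ring
    · ring
  · have h2 : Tendsto (fun Y : ℝ => Y / 2) atTop atTop := tendsto_id.atTop_div_const (by norm_num)
    filter_upwards [h2.eventually (hh.2 ε hε)] with Y hY
    have := intervalIntegral.integral_comp_div (a := 0) (b := Y) (fun y => ‖h y‖) (c := 2) (by norm_num)
    rw [this, zero_div, smul_eq_mul]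
    linarith

variable {q : ℕ} [NeZero q]

lemma SS_wpsi_eq {a : ZMod q} (ha : IsUnit a) (x : ℝ) :
    (SS (wpsi a) x : ℂ) = (q.totient : ℂ)⁻¹ * ∑ χ : DirichletCharacter ℂ q, χ a⁻¹ * psiC χ x := by
  have hφ : (q.totient : ℂ) ≠ 0 := by
    exact_mod_cast (Nat.totient_pos.mpr (Nat.pos_of_ne_zero (NeZero.ne q))).ne'
  rw [eq_inv_mul_iff_mul_eq₀ hφ]
  unfold SS psiC
  simp_rw [Finset.mul_sum]
  rw [Finset.sum_comm]
  push_cast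
  rw [Finset.mul_sum]
  refine Finset.sum_congr rfl fun n _ => ?_
  have := DirichletCharacter.sum_char_inv_mul_char_eq ℂ ha (n : ZMod q)
  simp_rw [← mul_assoc]
  rw [← Finset.sum_mul, this, wpsi]
  by_cases h : (n : ZMod q) = a
  · simp [h]
  · simp [h, Ne.symm h]

lemma psiC_NN (χ : DirichletCharacter ℂ q) {y : ℝ} (hy : 0 ≤ y) :
    psiC χ (Real.exp y) = NN χ y + ee χ * (cexp y - 1) := by
  simp [NN, hy]

lemma AP_psi_one {a : ZMod q} (ha : IsUnit a) :
    AP ∅ (fun y : ℝ => cexp (-y) * SS (wpsi a) (Real.exp y) - (q.totient : ℂ)⁻¹) := by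
  have h1 : AP ∅ (fun y : ℝ => (q.totient : ℂ)⁻¹ * ∑ χ : DirichletCharacter ℂ q, χ a⁻¹ * (cexp (-y) * NN χ y)) :=
    (AP.sum _ fun χ _ => (AP_one χ).const_mul (χ a⁻¹)).const_mul _
  have h2 : AP ∅ (fun y : ℝ => -(q.totient : ℂ)⁻¹ * cexp (-y)) := by
    refine AP.const_mul ?_ _
    refine AP.of_decay (C := 1) (δ := 1) (by fun_prop) one_pos fun y _ => ?_
    rw [Complex.norm_exp]; simp
  refine (h1.add h2).congr fun y hy => ?_
  rw [SS_wpsi_eq ha]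
  have e : ∀ χ : DirichletCharacter ℂ q, χ a⁻¹ * psiC χ (Real.exp y) =
      χ a⁻¹ * NN χ y + (if χ = 1 then (cexp y - 1) else 0) := by
    intro χ
    rw [psiC_NN χ hy]
    by_cases h : χ = 1
    · have hu : IsUnit a⁻¹ := by
        obtain ⟨u, rfl⟩ := ha
        rw [ZMod.inv_coe_unit]; exact Units.isUnit _
      subst h
      simp [ee, MulChar.one_apply hu]
    · simp [ee, h]
  simp_rw [e]
  rw [Finset.sum_add_distrib, Finset.sum_ite_eq' ]
  simp only [Finset.mem_univ, if_true]
  have e2 : ∑ χ : DirichletCharacter ℂ q, χ a⁻¹ * (cexp (-y) * NN χ y) =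
      cexp (-y) * ∑ χ : DirichletCharacter ℂ q, χ a⁻¹ * NN χ y := by
    rw [Finset.mul_sum]; refine Finset.sum_congr rfl fun χ _ => by ring
  rw [e2]
  have e3 : cexp (-y) * cexp y = 1 := by rw [← Complex.exp_add]; simp
  linear_combination (-(q.totient : ℂ)⁻¹) * e3

lemma wsq_nonneg (a : ZMod q) (n : ℕ) : 0 ≤ wsq a n := by
  have h0 : 0 ≤ vonMangoldt n := ArithmeticFunction.vonMangoldt_nonneg
  unfold wsq; split_ifs <;> simp [h0]

lemma SS_wsq_le (a : ZMod q) {x : ℝ} (hx : 0 ≤ x) : SS (wsq a) x ≤ Real.log 4 * Real.sqrt x := by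
  classical
  refine le_trans ?_ (Chebyshev.theta_le_log4_mul_x (Real.sqrt_nonneg x))
  rw [theta_sqrt hx]
  refine SS_mono (fun n => ?_) x
  have h0 : 0 ≤ vonMangoldt n := ArithmeticFunction.vonMangoldt_nonneg
  unfold wsq
  split_ifs <;> simp [h0]

lemma exp_sqrt (y : ℝ) : Real.sqrt (Real.exp y) = Real.exp (y / 2) := by
  rw [Real.sqrt_eq_rpow, ← Real.exp_mul]; congr 1; ring

lemma AP_th_one {a : ZMod q} (ha : IsUnit a) :
    AP ∅ (fun y : ℝ => cexp (-y) * SS (wth a) (Real.exp y) - (q.totient : ℂ)⁻¹) := by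
  obtain ⟨C, hC, hr⟩ := resid_bound
  have h2 : AP ∅ (fun y : ℝ => cexp (-y) * (SS (wth a) (Real.exp y) - SS (wpsi a) (Real.exp y))) := by
    refine AP.of_decay (C := C + Real.log 4) (δ := 1 / 2) ?_ (by norm_num) fun y hy => ?_
    · have m1 := SS_meas (wth a)
      have m2 := SS_meas (wpsi a)
      fun_prop
    · rw [norm_mul, Complex.norm_exp, ← Complex.ofReal_sub, Complex.norm_real, Real.norm_eq_abs]
      have hx : 1 ≤ Real.exp y := Real.one_le_exp hy
      have hx0 : 0 ≤ Real.exp y := by positivity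
      obtain ⟨r1, r2⟩ := resid a hx0
      have r3 := hr _ hx
      have r4 := SS_wsq_le a hx0
      have r5 := SS_nonneg (wsq_nonneg a) (Real.exp y)
      have r6 : Real.exp y ^ (1 / 3 : ℝ) ≤ Real.exp (y / 2) := by
        rw [← Real.exp_mul]; apply Real.exp_le_exp.mpr; linarith
      rw [exp_sqrt] at r4
      have r7 : |SS (wth a) (Real.exp y) - SS (wpsi a) (Real.exp y)| ≤ (C + Real.log 4) * Real.exp (y / 2) := by
        rw [abs_sub_comm, abs_of_nonneg (by linarith)]
        nlinarith
      calc _ ≤ Real.exp (-y) * ((C + Real.log 4) * Real.exp (y / 2)) := by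
            simp only [neg_re, ofReal_re]; gcongr
        _ = (C + Real.log 4) * (Real.exp (-y) * Real.exp (y / 2)) := by ring
        _ = _ := by rw [← Real.exp_add]; congr 2; ring
  refine ((AP_psi_one ha).add h2).congr fun y hy => ?_
  ring

lemma AP_sq {a : ZMod q} (ha : IsUnit a) : ∃ c : ℂ,
    AP ∅ (fun y : ℝ => cexp (-(y / 2)) * SS (wsq a) (Real.exp y) - c) := by
  classical
  have h1 : AP ∅ (fun y : ℝ => ∑ c ∈ (Finset.univ : Finset (ZMod q)).filter (fun c => c ^ 2 = a),
      (cexp (-((y / 2 : ℝ) : ℂ)) * SS (wth c) (Real.exp (y / 2)) - (q.totient : ℂ)⁻¹)) := by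
    refine AP.sum _ fun c hc => ?_
    have hu : IsUnit c := by
      have : c ^ 2 = a := by simpa using hc
      rw [← this] at ha
      exact (isUnit_pow_iff (by norm_num)).mp ha
    exact (AP_th_one hu).half
  refine ⟨∑ c ∈ (Finset.univ : Finset (ZMod q)).filter (fun c => c ^ 2 = a), (q.totient : ℂ)⁻¹, h1.congr fun y hy => ?_⟩
  rw [Finset.sum_sub_distrib, SS_wsq a (by positivity), exp_sqrt, ← Finset.mul_sum]
  push_cast
  rfl

lemma AP_sq_beta {a : ZMod q} (ha : IsUnit a) {β : ℝ} (hβ : 1 / 2 ≤ β) : ∃ c : ℂ,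
    AP ∅ (fun y : ℝ => cexp (-β * y) * SS (wsq a) (Real.exp y) - c) := by
  rcases hβ.eq_or_lt with h | h
  · obtain ⟨c, hc⟩ := AP_sq ha
    refine ⟨c, hc.congr fun y _ => ?_⟩
    rw [← h]; congr 3; push_cast; ring
  · refine ⟨0, ?_⟩
    simp only [sub_zero]
    refine AP.of_decay (C := Real.log 4) (δ := β - 1 / 2) ?_ (by linarith) fun y hy => ?_
    · have m1 := SS_meas (wsq a)
      fun_prop
    · rw [norm_mul, Complex.norm_exp, Complex.norm_real, Real.norm_eq_abs,
        abs_of_nonneg (SS_nonneg (wsq_nonneg a) _)]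
      have r4 := SS_wsq_le a (Real.exp_pos y).le
      rw [exp_sqrt] at r4
      calc _ ≤ Real.exp (-β * y) * (Real.log 4 * Real.exp (y / 2)) := by
            simp; gcongr
        _ = Real.log 4 * (Real.exp (-β * y) * Real.exp (y / 2)) := by ring
        _ = _ := by rw [← Real.exp_add]; congr 2; ring

lemma AP_resid (a : ZMod q) {β : ℝ} (hβ : 1 / 2 ≤ β) :
    AP ∅ (fun y : ℝ => cexp (-β * y) * ((SS (wpsi a) (Real.exp y) - SS (wth a) (Real.exp y) - SS (wsq a) (Real.exp y) : ℝ) : ℂ)) := by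
  obtain ⟨C, hC, hr⟩ := resid_bound
  refine AP.of_decay (C := C) (δ := 1 / 6) ?_ (by norm_num) fun y hy => ?_
  · have m1 := SS_meas (wsq a)
    have m2 := SS_meas (wpsi a)
    have m3 := SS_meas (wth a)
    fun_prop
  · obtain ⟨r1, r2⟩ := resid a (Real.exp_pos y).le
    rw [norm_mul, Complex.norm_exp, Complex.norm_real, Real.norm_eq_abs, abs_of_nonneg r1]
    have r3 := hr _ (Real.one_le_exp hy)
    rw [← Real.exp_mul] at r3
    calc _ ≤ Real.exp (-β * y) * (C * Real.exp (y * (1 / 3))) := by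
            simp only [neg_mul, neg_re, re_ofReal_mul, ofReal_re]; gcongr; linarith
      _ = C * (Real.exp (-β * y) * Real.exp (y * (1 / 3))) := by ring
      _ ≤ _ := by
        rw [← Real.exp_add]; gcongr; nlinarith

def Lam (q : ℕ) [NeZero q] : Set ℝ := {γ | γ ≠ 0 ∧ ∃ χ : DirichletCharacter ℂ q, χ ≠ 1 ∧
  χ.LFunction (betaQ q + γ * I) = 0}

lemma AP_psi_diff {a b : ZMod q} (ha : IsUnit a) (hb : IsUnit b) : ∃ c : ℂ,
    AP (Lam q) (fun y : ℝ => cexp (-(betaQ q : ℂ) * y) *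
      ((SS (wpsi a) (Real.exp y) : ℂ) - SS (wpsi b) (Real.exp y)) - c) := by
  classical
  have h1 : AP (Lam q) (fun y : ℝ => (q.totient : ℂ)⁻¹ *
    ∑ χ ∈ (Finset.univ : Finset (DirichletCharacter ℂ q)).filter (fun χ => χ ≠ 1), (χ a⁻¹ - χ b⁻¹) *
      (cexp (-(betaQ q : ℂ) * y) * NN χ y - cc (FF χ) (betaQ q) 0)) := by
    refine (AP.sum _ fun χ hχ => AP.const_mul ?_ _).const_mul _
    have hχ1 : χ ≠ 1 := by simpa using hχ
    refine AP.mono ?_ (AP_NN χ (beta_good q χ hχ1))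
    rintro γ ⟨h1, h2⟩
    refine ⟨h1, χ, hχ1, ?_⟩
    rw [← FF_zero_iff χ hχ1]; exact h2
  refine ⟨(q.totient : ℂ)⁻¹ * ∑ χ ∈ (Finset.univ : Finset (DirichletCharacter ℂ q)).filter (fun χ => χ ≠ 1),
    (χ a⁻¹ - χ b⁻¹) * cc (FF χ) (betaQ q) 0, h1.congr fun y hy => ?_⟩
  rw [SS_wpsi_eq ha, SS_wpsi_eq hb, ← mul_sub, ← Finset.sum_sub_distrib]
  have hu : ∀ c : ZMod q, IsUnit c → IsUnit c⁻¹ := by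
    rintro c ⟨u, rfl⟩
    rw [ZMod.inv_coe_unit]; exact Units.isUnit _
  have e : ∑ χ : DirichletCharacter ℂ q, (χ a⁻¹ * psiC χ (Real.exp y) - χ b⁻¹ * psiC χ (Real.exp y)) =
      ∑ χ ∈ (Finset.univ : Finset (DirichletCharacter ℂ q)).filter (fun χ => χ ≠ 1),
        (χ a⁻¹ - χ b⁻¹) * NN χ y := by
    rw [Finset.sum_filter]
    refine Finset.sum_congr rfl fun χ _ => ?_
    split_ifs with h
    · rw [psiC_NN χ hy]; simp [ee, h]; ring
    · have : χ = 1 := by simpa using h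
      rw [this, MulChar.one_apply (hu a ha), MulChar.one_apply (hu b hb)]; ring
  rw [e]
  simp_rw [mul_sub, Finset.sum_sub_distrib, Finset.mul_sum]
  rw [mul_sub, Finset.mul_sum, Finset.mul_sum]
  congr 1
  refine Finset.sum_congr rfl fun χ _ => ?_
  ring

lemma AP_th_diff {a b : ZMod q} (ha : IsUnit a) (hb : IsUnit b) (hab : a ≠ b) : ∃ c : ℂ,
    AP (Lam q) (fun y : ℝ => cexp (-(betaQ q : ℂ) * y) *
      ((SS (wth a) (Real.exp y) : ℂ) - SS (wth b) (Real.exp y)) - c) := by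
  have hβ := beta_half q (exists_nontriv q ha hb hab)
  obtain ⟨c, h⟩ := AP_psi_diff ha hb
  obtain ⟨ca, ka⟩ := AP_sq_beta ha hβ
  obtain ⟨cb, kb⟩ := AP_sq_beta hb hβ
  have ra := AP_resid a hβ
  have rb := AP_resid b hβ
  have e : (∅ : Set ℝ) ⊆ Lam q := Set.empty_subset _
  refine ⟨c - ca + cb, (((((h.add ((ka.mono e).const_mul (-1))).add (kb.mono e)).add ((ra.mono e).const_mul (-1)))).add (rb.mono e)).congr fun y hy => ?_⟩
  push_cast
  ring

end S12

namespace S12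

lemma cesaro_ibp {g : ℝ → ℝ} {β : ℝ} (hβ : 0 < β) {Y : ℝ} (hY : 0 ≤ Y)
    (hg : IntervalIntegrable g volume 0 Y) :
    ∫ y in (0:ℝ)..Y, Real.exp (-β * y) * |∫ u in (0:ℝ)..y, g u| ≤
      (1 / β) * ∫ y in (0:ℝ)..Y, Real.exp (-β * y) * |g y| := by
  have hga : IntervalIntegrable (fun u => |g u|) volume 0 Y := hg.abs
  set G : ℝ → ℝ := fun y => ∫ u in (0:ℝ)..y, |g u| with hG
  have ac2 : AbsolutelyContinuousOnInterval G 0 Y :=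
    hga.absolutelyContinuousOnInterval_intervalIntegral (by simp)
  have hfc : ContDiff ℝ 1 (fun y : ℝ => Real.exp (-β * y)) := by fun_prop
  have ac1 : AbsolutelyContinuousOnInterval (fun y : ℝ => Real.exp (-β * y)) 0 Y :=
    hfc.contDiffOn.absolutelyContinuousOnInterval
  have h := ac1.integral_mul_deriv_eq_deriv_mul ac2
  have hd : ∀ y : ℝ, deriv (fun y : ℝ => Real.exp (-β * y)) y = -β * Real.exp (-β * y) := by
    intro y
    have : HasDerivAt (fun y : ℝ => Real.exp (-β * y)) (Real.exp (-β * y) * (-β * 1)) y :=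
      ((hasDerivAt_id y).const_mul (-β)).exp
    rw [this.deriv]; ring
  have e1 : ∫ y in (0:ℝ)..Y, Real.exp (-β * y) * deriv G y = ∫ y in (0:ℝ)..Y, Real.exp (-β * y) * |g y| := by
    apply intervalIntegral.integral_congr_ae
    filter_upwards [hga.ae_hasDerivAt_integral] with y hy hm
    have := hy (Set.uIoc_subset_uIcc hm) 0 (by simp)
    rw [this.deriv]
  have hGn : ∀ y, 0 ≤ y → 0 ≤ G y := fun y hy => intervalIntegral.integral_nonneg hy fun _ _ => abs_nonneg _
  rw [e1] at h
  simp only [hd] at h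
  have e2 : ∫ y in (0:ℝ)..Y, -β * Real.exp (-β * y) * G y = -β * ∫ y in (0:ℝ)..Y, Real.exp (-β * y) * G y := by
    rw [← intervalIntegral.integral_const_mul]; congr 1; ext y; ring
  rw [e2] at h
  have hG0 : G 0 = 0 := by simp [hG]
  rw [hG0] at h
  have hGc : ContinuousOn G (Set.uIcc 0 Y) := ac2.continuousOn
  have hDc : ContinuousOn (fun y => ∫ u in (0:ℝ)..y, g u) (Set.uIcc 0 Y) :=
    (hg.absolutelyContinuousOnInterval_intervalIntegral (c := 0) (by simp)).continuousOn
  have h3 : ∫ y in (0:ℝ)..Y, Real.exp (-β * y) * |∫ u in (0:ℝ)..y, g u| ≤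
      ∫ y in (0:ℝ)..Y, Real.exp (-β * y) * G y := by
    apply intervalIntegral.integral_mono_on hY
    · exact (hfc.continuous.continuousOn.mul hDc.abs).intervalIntegrable
    · exact (hfc.continuous.continuousOn.mul hGc).intervalIntegrable
    · intro y hy
      gcongr
      exact intervalIntegral.abs_integral_le_integral_abs hy.1
  refine h3.trans ?_
  rw [one_div, ← div_eq_inv_mul, le_div_iff₀ hβ]
  have := mul_nonneg (Real.exp_pos (-β * Y)).le (hGn Y hY)
  linarith

lemma theta_to_pi {g : ℝ → ℝ} {β K : ℝ} (hβ : 0 < β)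
    (hg : ∀ Y, 0 ≤ Y → IntervalIntegrable g volume 0 Y)
    (hk : ∀ᶠ Y in atTop, ∫ y in (0:ℝ)..Y, |y * Real.exp (-β * y) * g y -
      Real.exp (-β * y) * ∫ u in (0:ℝ)..y, g u| ≤ K * Y) {ε : ℝ} (hε : 0 < ε) :
    ∀ᶠ Y in atTop, ∫ y in (0:ℝ)..Y, |Real.exp (-β * y) * ∫ u in (0:ℝ)..y, g u| ≤ ε * Y := by
  have hmul : ∀ (w : ℝ → ℝ), Continuous w → ∀ Y, 0 ≤ Y → IntervalIntegrable (fun y => w y * g y) volume 0 Y :=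
    fun w hw Y hY => (hg Y hY).continuousOn_mul hw.continuousOn
  have iE : ∀ Y, 0 ≤ Y → IntervalIntegrable (fun y => Real.exp (-β * y) * |g y|) volume 0 Y :=
    fun Y hY => (hg Y hY).abs.continuousOn_mul (by fun_prop)
  have iF : ∀ Y, 0 ≤ Y → IntervalIntegrable (fun y => y * Real.exp (-β * y) * g y) volume 0 Y :=
    hmul _ (by fun_prop)
  have iD : ∀ Y, 0 ≤ Y → IntervalIntegrable (fun y => Real.exp (-β * y) * ∫ u in (0:ℝ)..y, g u) volume 0 Y := by
    intro Y hY
    have hDc : ContinuousOn (fun y => ∫ u in (0:ℝ)..y, g u) (Set.uIcc 0 Y) :=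
      ((hg Y hY).absolutelyContinuousOnInterval_intervalIntegral (c := 0) (by simp)).continuousOn
    exact ((by fun_prop : Continuous (fun y : ℝ => Real.exp (-β * y))).continuousOn.mul hDc).intervalIntegrable
  set H : ℝ → ℝ := fun U => ∫ y in (0:ℝ)..U, Real.exp (-β * y) * |g y| with hH
  have h2 : ∀ U Y, 0 < U → U ≤ Y → H Y ≤ H U + (1 / U) * ∫ y in (0:ℝ)..Y, |y * Real.exp (-β * y) * g y| := by
    intro U Y hU hUY
    have hY : 0 ≤ Y := hU.le.trans hUY
    have i1 : IntervalIntegrable (fun y => Real.exp (-β * y) * |g y|) volume U Y :=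
      (iE U hU.le).symm.trans (iE Y hY)
    have i2 : IntervalIntegrable (fun y => |y * Real.exp (-β * y) * g y|) volume U Y :=
      (iF U hU.le).abs.symm.trans (iF Y hY).abs
    have s1 : H Y = H U + ∫ y in U..Y, Real.exp (-β * y) * |g y| :=
      (intervalIntegral.integral_add_adjacent_intervals (iE U hU.le) i1).symm
    have s2 := intervalIntegral.integral_add_adjacent_intervals (iF U hU.le).abs i2
    have s3 : 0 ≤ ∫ y in (0:ℝ)..U, |y * Real.exp (-β * y) * g y| :=
      intervalIntegral.integral_nonneg hU.le fun _ _ => abs_nonneg _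
    have s4 : ∫ y in U..Y, Real.exp (-β * y) * |g y| ≤ ∫ y in U..Y, (1 / U) * |y * Real.exp (-β * y) * g y| := by
      apply intervalIntegral.integral_mono_on hUY i1 (i2.const_mul _)
      intro y hy
      have hy0 : 0 < y := hU.trans_le hy.1
      rw [abs_mul, abs_mul, abs_of_pos hy0, abs_of_pos (Real.exp_pos _), one_div, ← div_eq_inv_mul, le_div_iff₀ hU,
        mul_comm y, mul_assoc, mul_assoc, mul_comm y]
      gcongr
      exact hy.1
    rw [intervalIntegral.integral_const_mul] at s4
    rw [s1, ← s2]
    have : 0 ≤ (1 / U) * ∫ y in (0:ℝ)..U, |y * Real.exp (-β * y) * g y| := by positivity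
    linarith [mul_add (1 / U) (∫ y in (0:ℝ)..U, |y * Real.exp (-β * y) * g y|) (∫ y in U..Y, |y * Real.exp (-β * y) * g y|)]
  have hD : ∀ Y, 0 ≤ Y → ∫ y in (0:ℝ)..Y, |Real.exp (-β * y) * ∫ u in (0:ℝ)..y, g u| ≤ (1 / β) * H Y := by
    intro Y hY
    refine le_trans (le_of_eq ?_) (cesaro_ibp hβ hY (hg Y hY))
    congr 1; ext y; rw [abs_mul, abs_of_pos (Real.exp_pos _)]
  have hF : ∀ᶠ Y in atTop, ∫ y in (0:ℝ)..Y, |y * Real.exp (-β * y) * g y| ≤ 2 * K * Y + (2 / β) * H (2 / β) := by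
    filter_upwards [hk, eventually_ge_atTop (2 / β)] with Y hk hY
    have hY0 : 0 ≤ Y := le_trans (by positivity) hY
    have a1 : ∫ y in (0:ℝ)..Y, |y * Real.exp (-β * y) * g y| ≤
        (∫ y in (0:ℝ)..Y, |y * Real.exp (-β * y) * g y - Real.exp (-β * y) * ∫ u in (0:ℝ)..y, g u|) +
        ∫ y in (0:ℝ)..Y, |Real.exp (-β * y) * ∫ u in (0:ℝ)..y, g u| := by
      rw [← intervalIntegral.integral_add ((iF Y hY0).sub (iD Y hY0)).abs (iD Y hY0).abs]
      apply intervalIntegral.integral_mono_on hY0 (iF Y hY0).abs (((iF Y hY0).sub (iD Y hY0)).abs.add (iD Y hY0).abs)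
      intro y _
      have := abs_add_le (y * Real.exp (-β * y) * g y - Real.exp (-β * y) * ∫ u in (0:ℝ)..y, g u)
        (Real.exp (-β * y) * ∫ u in (0:ℝ)..y, g u)
      simpa using this
    have a2 := hD Y hY0
    have a3 := h2 (2 / β) Y (by positivity) hY
    have a4 : (1 / β) * H Y ≤ (1 / β) * (H (2 / β) + (1 / (2 / β)) * ∫ y in (0:ℝ)..Y, |y * Real.exp (-β * y) * g y|) := by
      gcongr
    have a5 : (1 / β) * (H (2 / β) + (1 / (2 / β)) * ∫ y in (0:ℝ)..Y, |y * Real.exp (-β * y) * g y|) =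
      (1 / β) * H (2 / β) + (1 / 2) * ∫ y in (0:ℝ)..Y, |y * Real.exp (-β * y) * g y| := by
      field_simp
    have a6 : (2 / β) * H (2 / β) = 2 * ((1 / β) * H (2 / β)) := by ring
    linarith
  set K' := |K| + 1
  have hK' : 0 < K' := by positivity
  set U : ℝ := 4 * K' / (β * ε) with hU
  have hUp : 0 < U := by positivity
  set C : ℝ := (1 / β) * (H U + (1 / U) * ((2 / β) * H (2 / β)))
  filter_upwards [hF, eventually_ge_atTop U, eventually_ge_atTop (2 * C / ε)] with Y hF hYU hYC
  have hY0 : 0 ≤ Y := hUp.le.trans hYU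
  have b1 := h2 U Y hUp hYU
  calc _ ≤ (1 / β) * H Y := hD Y hY0
    _ ≤ (1 / β) * (H U + (1 / U) * (2 * K' * Y + (2 / β) * H (2 / β))) := by
      gcongr
      refine b1.trans ?_
      gcongr
      refine hF.trans ?_
      gcongr
      exact (le_abs_self K).trans (by simp [K'])
    _ = C + (ε / 2) * Y := by
      simp only [C]; rw [hU]; field_simp; ring
    _ ≤ ε * Y := by
      rw [div_le_iff₀ hε] at hYC; linarith

lemma span_bdd {Λ : Set ℝ} {P : ℝ → ℂ} (hP : P ∈ Submodule.span ℂ (ex '' Λ)) : ∃ B, ∀ y, ‖P y‖ ≤ B := by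
  induction hP using Submodule.span_induction with
  | mem x hx =>
    obtain ⟨l, _, rfl⟩ := hx
    refine ⟨1, fun y => ?_⟩
    simp [ex, Complex.norm_exp]
  | zero => exact ⟨0, by simp⟩
  | add x y _ _ h1 h2 =>
    obtain ⟨B, hB⟩ := h1; obtain ⟨C, hC⟩ := h2
    exact ⟨B + C, fun z => (norm_add_le _ _).trans (add_le_add (hB z) (hC z))⟩
  | smul a x _ h =>
    obtain ⟨B, hB⟩ := h
    refine ⟨‖a‖ * B, fun z => ?_⟩
    simp only [Pi.smul_apply, norm_smul]
    gcongr; exact hB z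

lemma AP.mean_bdd {Λ : Set ℝ} {h : ℝ → ℂ} (hh : AP Λ h) (c : ℂ) :
    ∃ K, ∀ᶠ Y in atTop, ∫ y in (0:ℝ)..Y, ‖h y + c‖ ≤ K * Y := by
  obtain ⟨P, hP, h1⟩ := hh.2 1 one_pos
  obtain ⟨B, hB⟩ := span_bdd hP
  refine ⟨1 + (B + ‖c‖), ?_⟩
  filter_upwards [h1, eventually_ge_atTop 0] with Y h1 hY
  have i1 := ((hh.1 Y hY).sub ((span_cont hP).intervalIntegrable 0 Y)).norm
  have i2 : IntervalIntegrable (fun _ : ℝ => B + ‖c‖) volume 0 Y := by simp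
  calc _ ≤ ∫ y in (0:ℝ)..Y, (‖h y - P y‖ + (B + ‖c‖)) := by
        apply intervalIntegral.integral_mono_on hY ((hh.1 Y hY).add (by simp)).norm (i1.add i2)
        intro y _
        rw [show h y + c = (h y - P y) + (P y + c) by ring]
        exact (norm_add_le _ _).trans (by gcongr; exact (norm_add_le _ _).trans (by gcongr; exact hB y))
    _ = _ := intervalIntegral.integral_add i1 i2
    _ ≤ _ := by simp; nlinarith

lemma abel (v : ℕ → ℝ) {y : ℝ} (hy : 0 ≤ y) :
    ∫ u in (0:ℝ)..y, SS v (Real.exp u) = y * SS v (Real.exp y) - SS (fun n => v n * Real.log n) (Real.exp y) := by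
  have h1 : ∀ u ∈ Set.uIcc 0 y, SS v (Real.exp u) =
      ∑ n ∈ Finset.Icc 1 ⌊Real.exp y⌋₊, (Set.Ici (Real.log n)).indicator (fun _ => v n) u := by
    intro u hu
    rw [Set.uIcc_of_le hy] at hu
    unfold SS
    have : Finset.Icc 1 ⌊Real.exp u⌋₊ = (Finset.Icc 1 ⌊Real.exp y⌋₊).filter (fun n : ℕ => Real.log n ≤ u) := by
      ext n
      simp only [Finset.mem_Icc, Finset.mem_filter, Nat.le_floor_iff (Real.exp_pos _).le]
      constructor
      · rintro ⟨h1, h2⟩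
        have hn : (0:ℝ) < n := by exact_mod_cast h1
        exact ⟨⟨h1, h2.trans (Real.exp_le_exp.mpr hu.2)⟩, (Real.log_le_iff_le_exp hn).2 h2⟩
      · rintro ⟨⟨h1, h2⟩, h3⟩
        have hn : (0:ℝ) < n := by exact_mod_cast h1
        exact ⟨h1, (Real.log_le_iff_le_exp hn).1 h3⟩
    rw [this, Finset.sum_filter]
    refine Finset.sum_congr rfl fun n _ => ?_
    simp [Set.indicator_apply]
  have hi : ∀ n : ℕ, IntervalIntegrable ((Set.Ici (Real.log n)).indicator (fun _ : ℝ => v n)) volume 0 y := by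
    intro n
    rw [intervalIntegrable_iff]
    exact (integrableOn_const (by simp)).indicator measurableSet_Ici
  rw [intervalIntegral.integral_congr h1, intervalIntegral.integral_finset_sum (fun n _ => hi n)]
  unfold SS
  rw [Finset.mul_sum, ← Finset.sum_sub_distrib]
  refine Finset.sum_congr rfl fun n hn => ?_
  simp only [Finset.mem_Icc, Nat.le_floor_iff (Real.exp_pos _).le] at hn
  have hn0 : (0:ℝ) < n := by exact_mod_cast hn.1
  have hl0 : 0 ≤ Real.log n := Real.log_nonneg (by exact_mod_cast hn.1)
  have hl1 : Real.log n ≤ y := (Real.log_le_iff_le_exp hn0).2 hn.2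
  rw [intervalIntegral.integral_of_le hy, setIntegral_indicator measurableSet_Ici]
  have : (Set.Ioc 0 y ∩ Set.Ici (Real.log n) : Set ℝ) =ᵐ[volume] (Set.Ioc (Real.log n) y : Set ℝ) := by
    have e : Set.Ioc 0 y ∩ Set.Ioi (Real.log n) = Set.Ioc (Real.log n) y := by
      ext z; simp only [Set.mem_inter_iff, Set.mem_Ioc, Set.mem_Ioi]
      constructor
      · rintro ⟨⟨_, h⟩, h'⟩; exact ⟨h', h⟩
      · rintro ⟨h, h'⟩; exact ⟨⟨hl0.trans_lt h, h'⟩, h⟩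
    rw [← e]
    exact (ae_eq_refl _).inter Ioi_ae_eq_Ici.symm
  rw [setIntegral_congr_set this, ← intervalIntegral.integral_of_le hl1]
  simp; ring

end S12

namespace S12
variable {q : ℕ} [NeZero q]

open Classical in
def wpi {q : ℕ} (a : ZMod q) (n : ℕ) : ℝ := if n.Prime ∧ (n : ZMod q) = a then 1 else 0

lemma piMod_eq (a : ZMod q) (x : ℝ) : (piMod q a x : ℝ) = SS (wpi a) x := by
  classical
  unfold piMod SS wpi
  rw [← Finset.sum_filter, Finset.sum_const, nsmul_eq_mul, mul_one]
  norm_cast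
  congr 1
  ext n
  simp only [Finset.mem_filter, Finset.mem_range, Finset.mem_Icc]
  constructor
  · rintro ⟨h1, h2, h3⟩; exact ⟨⟨h2.one_le, by omega⟩, h2, h3⟩
  · rintro ⟨⟨_, h1⟩, h2, h3⟩; exact ⟨by omega, h2, h3⟩

lemma wth_eq (a : ZMod q) (n : ℕ) : wth a n = wpi a n * Real.log n := by
  unfold wth wpi; split_ifs <;> simp

def vab (a b : ZMod q) (n : ℕ) : ℝ := wpi a n - wpi b n

lemma Eab_exp (a b : ZMod q) (y : ℝ) :
    Eab q a b (Real.exp y) = y * Real.exp (-betaQ q * y) * SS (vab a b) (Real.exp y) := by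
  unfold Eab vab
  rw [SS_sub, piMod_eq, piMod_eq, Real.log_exp, ← Real.exp_mul, div_eq_mul_inv, ← Real.exp_neg]
  congr 3
  ring

lemma wpi_bd (a : ZMod q) (n : ℕ) : 0 ≤ wpi a n ∧ wpi a n ≤ 1 := by
  unfold wpi; split_ifs <;> simp

lemma SSv_int (a b : ZMod q) {Y : ℝ} (hY : 0 ≤ Y) :
    IntervalIntegrable (fun y => SS (vab a b) (Real.exp y)) volume 0 Y := by
  have hc : IntervalIntegrable (fun y : ℝ => Real.exp y) volume 0 Y :=
    Real.continuous_exp.intervalIntegrable _ _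
  refine hc.mono_fun ((SS_meas _).comp Real.measurable_exp).aestronglyMeasurable ?_
  refine Eventually.of_forall fun y => ?_
  beta_reduce
  rw [Real.norm_eq_abs, Real.norm_eq_abs, abs_of_pos (Real.exp_pos y)]
  unfold SS
  refine (Finset.abs_sum_le_sum_abs _ _).trans ?_
  calc _ ≤ ∑ n ∈ Finset.Icc 1 ⌊Real.exp y⌋₊, (1:ℝ) := by
        refine Finset.sum_le_sum fun n _ => ?_
        unfold vab
        have h1 := wpi_bd a n; have h2 := wpi_bd b n
        rw [abs_le]; constructor <;> linarith
    _ ≤ _ := by simpa using Nat.floor_le (Real.exp_pos y).le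

lemma Eab_meas (a b : ZMod q) : Measurable (fun y => Eab q a b (Real.exp y)) := by
  simp only [Eab_exp]
  have := (SS_meas (vab a b)).comp Real.measurable_exp
  exact (by fun_prop : Measurable fun y : ℝ => y * Real.exp (-betaQ q * y)).mul this

lemma Eab_int (a b : ZMod q) {Y : ℝ} (hY : 0 ≤ Y) :
    IntervalIntegrable (fun y => Eab q a b (Real.exp y)) volume 0 Y := by
  simp only [Eab_exp]
  exact (SSv_int a b hY).continuousOn_mul (by fun_prop)

lemma AP_Eab {a b : ZMod q} (ha : IsUnit a) (hb : IsUnit b) (hab : a ≠ b) : ∃ c : ℂ,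
    AP (Lam q) (fun y => (Eab q a b (Real.exp y) : ℂ) - c) := by
  obtain ⟨c, hc⟩ := AP_th_diff ha hb hab
  have hβ : 0 < betaQ q := lt_of_lt_of_le (by norm_num) (beta_half q (exists_nontriv q ha hb hab))
  set β := betaQ q
  set g : ℝ → ℝ := fun y => SS (vab a b) (Real.exp y) with hgd
  have hg : ∀ Y, 0 ≤ Y → IntervalIntegrable g volume 0 Y := fun Y hY => SSv_int a b hY
  have key : ∀ y : ℝ, 0 ≤ y → cexp (-(β:ℂ) * y) * ((SS (wth a) (Real.exp y) : ℂ) - SS (wth b) (Real.exp y)) =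
      ((y * Real.exp (-β * y) * g y - Real.exp (-β * y) * ∫ u in (0:ℝ)..y, g u : ℝ) : ℂ) := by
    intro y hy
    have h1 := abel (vab a b) hy
    have h2 : SS (fun n => vab a b n * Real.log n) (Real.exp y) = SS (wth a) (Real.exp y) - SS (wth b) (Real.exp y) := by
      rw [← SS_sub]; unfold SS; refine Finset.sum_congr rfl fun n _ => ?_
      beta_reduce
      rw [wth_eq, wth_eq, vab]; ring
    rw [h2] at h1
    simp only [hgd]
    rw [h1]
    push_cast
    ring
  have hk : AP (Lam q) (fun y => ((y * Real.exp (-β * y) * g y - Real.exp (-β * y) * ∫ u in (0:ℝ)..y, g u : ℝ) : ℂ) - c) :=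
    hc.congr fun y hy => by rw [← key y hy]
  obtain ⟨K, hK⟩ := hk.mean_bdd c
  have hK' : ∀ᶠ Y in atTop, ∫ y in (0:ℝ)..Y, |y * Real.exp (-β * y) * g y -
      Real.exp (-β * y) * ∫ u in (0:ℝ)..y, g u| ≤ K * Y := by
    filter_upwards [hK] with Y hK
    simpa only [sub_add_cancel, Complex.norm_real, Real.norm_eq_abs] using hK
  have hD : AP ∅ (fun y => ((Real.exp (-β * y) * ∫ u in (0:ℝ)..y, g u : ℝ) : ℂ)) := by
    rw [AP_empty_iff]
    refine ⟨fun Y hY => ?_, fun ε hε => ?_⟩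
    · have hDc : ContinuousOn (fun y => ∫ u in (0:ℝ)..y, g u) (Set.uIcc 0 Y) :=
        ((hg Y hY).absolutelyContinuousOnInterval_intervalIntegral (c := 0) (by simp)).continuousOn
      have := ((by fun_prop : Continuous (fun y : ℝ => Real.exp (-β * y))).continuousOn.mul hDc)
      exact (Complex.continuous_ofReal.comp_continuousOn this).intervalIntegrable
    · simpa only [Complex.norm_real, Real.norm_eq_abs] using theta_to_pi hβ hg hK' hε
  refine ⟨c, (hk.add (hD.mono (Set.empty_subset _))).congr fun y hy => ?_⟩
  rw [Eab_exp]
  push_cast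
  ring

end S12

namespace S12
variable {q : ℕ} [NeZero q]

lemma LFunction_conj {χ : DirichletCharacter ℂ q} (hχ : χ ≠ 1) : ∃ χ' : DirichletCharacter ℂ q, χ' ≠ 1 ∧
    ∀ s, χ'.LFunction s = (starRingEnd ℂ) (χ.LFunction ((starRingEnd ℂ) s)) := by
  have hst : ∀ a, (star χ : DirichletCharacter ℂ q) a = (starRingEnd ℂ) (χ a) := fun a => rfl
  have h1 : (star χ : DirichletCharacter ℂ q) ≠ 1 := by
    intro h
    apply hχ
    ext a
    have := hst a
    rw [h] at this
    have h2 := congrArg (starRingEnd ℂ) this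
    rw [Complex.conj_conj] at h2
    rw [← h2]
    rw [MulChar.one_apply_coe]; simp
  refine ⟨star χ, h1, fun s => ?_⟩
  have d1 : Differentiable ℂ (star χ : DirichletCharacter ℂ q).LFunction := DirichletCharacter.differentiable_LFunction h1
  have d2 : Differentiable ℂ (fun s => (starRingEnd ℂ) (χ.LFunction ((starRingEnd ℂ) s))) := by
    intro s
    exact differentiableAt_conj_conj_iff.2 (DirichletCharacter.differentiable_LFunction hχ _)
  have a1 : AnalyticOnNhd ℂ (star χ : DirichletCharacter ℂ q).LFunction Set.univ := fun z _ => d1.analyticAt z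
  have a2 : AnalyticOnNhd ℂ (fun s => (starRingEnd ℂ) (χ.LFunction ((starRingEnd ℂ) s))) Set.univ :=
    fun z _ => d2.analyticAt z
  have key : ∀ s : ℂ, 1 < s.re → (star χ : DirichletCharacter ℂ q).LFunction s =
      (starRingEnd ℂ) (χ.LFunction ((starRingEnd ℂ) s)) := by
    intro s hs
    rw [DirichletCharacter.LFunction_eq_LSeries _ hs, DirichletCharacter.LFunction_eq_LSeries _ (by simpa using hs)]
    unfold LSeries
    rw [Complex.conj_tsum]
    congr 1
    ext n
    rcases eq_or_ne n 0 with rfl | hn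
    · simp
    rw [LSeries.term_of_ne_zero hn, LSeries.term_of_ne_zero hn, map_div₀, hst]
    congr 1
    rw [← Complex.conj_cpow _ _ (by rw [Complex.natCast_arg]; exact Real.pi_pos.ne), Complex.conj_natCast]
  have := a1.eq_of_eventuallyEq a2 (z₀ := 2) (by
    have : ∀ᶠ s : ℂ in 𝓝 2, 1 < s.re :=
      Complex.continuous_re.continuousAt.eventually_const_lt (by norm_num)
    filter_upwards [this] with s hs using key s hs)
  exact congrFun this s

def wt (k : ℝ →₀ ℤ) : ℝ := k.sum fun γ n => (n : ℝ) * γ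
def par (k : ℝ →₀ ℤ) : ℤ := k.sum fun _ n => n

lemma wt_add (k l : ℝ →₀ ℤ) : wt (k + l) = wt k + wt l :=
  Finsupp.sum_add_index' (by simp) (by intros; push_cast; ring)
lemma par_add (k l : ℝ →₀ ℤ) : par (k + l) = par k + par l :=
  Finsupp.sum_add_index' (by simp) (by simp)
lemma wt_neg (k : ℝ →₀ ℤ) : wt (-k) = - wt k := by
  have := wt_add k (-k); rw [add_neg_cancel] at this
  have h0 : wt 0 = 0 := Finsupp.sum_zero_index
  linarith
lemma par_neg (k : ℝ →₀ ℤ) : par (-k) = - par k := by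
  have := par_add k (-k); rw [add_neg_cancel] at this
  have h0 : par 0 = 0 := Finsupp.sum_zero_index
  linarith

/-- Integer combinations of elements of `Z` with coefficient sum of parity `e`. -/
def Mp (Z : Set ℝ) (P : ℤ → Prop) : Set ℝ := {l | ∃ k : ℝ →₀ ℤ, (k.support : Set ℝ) ⊆ Z ∧ wt k = l ∧ P (par k)}

lemma Mp_add {Z : Set ℝ} {P P' P'' : ℤ → Prop} (h : ∀ m n, P m → P' n → P'' (m + n)) {x y : ℝ}
    (hx : x ∈ Mp Z P) (hy : y ∈ Mp Z P') : x + y ∈ Mp Z P'' := by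
  classical
  obtain ⟨k, k1, rfl, k3⟩ := hx
  obtain ⟨l, l1, rfl, l3⟩ := hy
  refine ⟨k + l, ?_, wt_add _ _, by rw [par_add]; exact h _ _ k3 l3⟩
  intro z hz
  have := Finsupp.support_add hz
  rcases Finset.mem_union.1 this with h | h
  · exact k1 h
  · exact l1 h

lemma Mp_neg {Z : Set ℝ} {x : ℝ} (hx : x ∈ Mp Z Odd) : -x ∈ Mp Z Odd := by
  obtain ⟨k, k1, rfl, k3⟩ := hx
  refine ⟨-k, by rwa [Finsupp.support_neg], wt_neg _, by rw [par_neg]; exact k3.neg⟩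

lemma Mp_single {Z : Set ℝ} {x : ℝ} (hx : x ∈ Z) : x ∈ Mp Z Odd := by
  refine ⟨Finsupp.single x 1, ?_, ?_, ?_⟩
  · intro z hz
    have := Finsupp.support_single_subset hz
    rw [Finset.mem_singleton] at this
    rwa [this]
  · simp [wt]
  · simp [par]

lemma Lam_sub : Lam q ⊆ Mp (Zq q) Odd := by
  rintro γ ⟨h0, χ, hχ, hz⟩
  rcases lt_or_gt_of_ne h0 with h | h
  · rw [← neg_neg γ]
    apply Mp_neg
    apply Mp_single
    obtain ⟨χ', h1, h2⟩ := LFunction_conj hχ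
    refine ⟨by linarith, χ', h1, ?_⟩
    rw [h2]
    have : (starRingEnd ℂ) ((betaQ q : ℂ) + I * ((-γ : ℝ) : ℂ)) = (betaQ q : ℂ) + γ * I := by
      simp [mul_comm]
    rw [this, hz, map_zero]
  · apply Mp_single
    refine ⟨h, χ, hχ, ?_⟩
    rw [mul_comm I]; exact hz

lemma ex_mul (l m : ℝ) : ex l * ex m = ex (l + m) := by
  ext y; simp only [ex, Pi.mul_apply, ← Complex.exp_add]; congr 1; push_cast; ring

lemma span_mul {A B C : Set ℝ} (h : ∀ x ∈ A, ∀ y ∈ B, x + y ∈ C) {P Q : ℝ → ℂ}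
    (hP : P ∈ Submodule.span ℂ (ex '' A)) (hQ : Q ∈ Submodule.span ℂ (ex '' B)) :
    P * Q ∈ Submodule.span ℂ (ex '' C) := by
  have := Submodule.mul_mem_mul hP hQ
  rw [Submodule.span_mul_span] at this
  refine Submodule.span_mono ?_ this
  rintro _ ⟨_, ⟨x, hx, rfl⟩, _, ⟨y, hy, rfl⟩, rfl⟩
  exact ⟨x + y, h x hx y hy, (ex_mul x y).symm⟩

lemma span_conj {A : Set ℝ} (h : ∀ x ∈ A, -x ∈ A) {P : ℝ → ℂ}
    (hP : P ∈ Submodule.span ℂ (ex '' A)) : (fun y => (starRingEnd ℂ) (P y)) ∈ Submodule.span ℂ (ex '' A) := by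
  induction hP using Submodule.span_induction with
  | mem x hx =>
    obtain ⟨l, hl, rfl⟩ := hx
    refine Submodule.subset_span ⟨-l, h l hl, ?_⟩
    ext y
    simp [ex, ← Complex.exp_conj]
  | zero =>
    convert Submodule.zero_mem (Submodule.span ℂ (ex '' A)) using 1
    ext y; simp
  | add x y _ _ h1 h2 => 
    convert Submodule.add_mem _ h1 h2 using 1
    ext y; simp
  | smul a x _ h =>
    convert Submodule.smul_mem _ ((starRingEnd ℂ) a) h using 1
    ext y; simp

lemma span_re {A : Set ℝ} (h : ∀ x ∈ A, -x ∈ A) {P : ℝ → ℂ}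
    (hP : P ∈ Submodule.span ℂ (ex '' A)) : (fun y => (((P y).re : ℝ) : ℂ)) ∈ Submodule.span ℂ (ex '' A) := by
  convert Submodule.smul_mem _ (1/2 : ℂ) (Submodule.add_mem _ hP (span_conj h hP)) using 1
  ext y
  simp [Complex.re_eq_add_conj]; ring

lemma span_pow_odd {Z : Set ℝ} {R : ℝ → ℂ} (hR : R ∈ Submodule.span ℂ (ex '' (Mp Z Odd))) (n : ℕ) :
    R ^ (2 * n + 1) ∈ Submodule.span ℂ (ex '' (Mp Z Odd)) := by
  induction n with
  | zero => simpa using hR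
  | succ n ih =>
    have h2 : R * R ∈ Submodule.span ℂ (ex '' (Mp Z Even)) :=
      span_mul (fun x hx y hy => Mp_add (fun m n hm hn => hm.add_odd hn) hx hy) hR hR
    have := span_mul (C := Mp Z Odd) (fun x hx y hy => Mp_add (fun m n hm hn => hm.add_even hn) hx hy) ih h2
    convert this using 1
    ring

lemma span_mean {A : Set ℝ} (h0 : (0:ℝ) ∉ A) {P : ℝ → ℂ}
    (hP : P ∈ Submodule.span ℂ (ex '' A)) : ∃ C, ∀ Y, ‖∫ y in (0:ℝ)..Y, P y‖ ≤ C := by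
  induction hP using Submodule.span_induction with
  | mem x hx =>
    obtain ⟨l, hl, rfl⟩ := hx
    have hl0 : l ≠ 0 := fun h => h0 (h ▸ hl)
    have hc : (l * I : ℂ) ≠ 0 := mul_ne_zero (by exact_mod_cast hl0) I_ne_zero
    refine ⟨2 / ‖(l * I : ℂ)‖, fun Y => ?_⟩
    unfold ex
    rw [integral_exp_mul_complex hc, norm_div]
    gcongr
    refine (norm_sub_le _ _).trans ?_
    have : ∀ y : ℝ, ‖cexp (l * I * y)‖ = 1 := fun y => by simp [Complex.norm_exp]
    rw [this, this]; norm_num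
  | zero => exact ⟨0, by simp⟩
  | add x y hx hy h1 h2 =>
    obtain ⟨B, hB⟩ := h1; obtain ⟨C, hC⟩ := h2
    refine ⟨B + C, fun Y => ?_⟩
    simp only [Pi.add_apply]
    rw [intervalIntegral.integral_add ((span_cont hx).intervalIntegrable _ _) ((span_cont hy).intervalIntegrable _ _)]
    exact (norm_add_le _ _).trans (add_le_add (hB Y) (hC Y))
  | smul a x _ h =>
    obtain ⟨B, hB⟩ := h
    refine ⟨‖a‖ * B, fun z => ?_⟩
    simp only [Pi.smul_apply]
    rw [intervalIntegral.integral_smul, norm_smul]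
    gcongr; exact hB z

/-- `2 i sin (t R)` is uniformly approximated by trigonometric polynomials. -/
lemma sin_approx {Z : Set ℝ} {R : ℝ → ℝ} (hR : (fun y => (R y : ℂ)) ∈ Submodule.span ℂ (ex '' (Mp Z Odd)))
    (t : ℝ) {ε : ℝ} (hε : 0 < ε) : ∃ S ∈ Submodule.span ℂ (ex '' (Mp Z Odd)),
      ∀ y, ‖(Real.sin (t * R y) : ℂ) - S y‖ ≤ ε := by
  obtain ⟨B, hB⟩ := span_bdd hR
  have hB' : ∀ y, ‖(t * R y * I : ℂ)‖ ≤ |t| * |B| := by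
    intro y
    have := (hB y).trans (le_abs_self B)
    rw [norm_mul, norm_mul, Complex.norm_I, mul_one, Complex.norm_real, Real.norm_eq_abs]
    gcongr
  set X := |t| * |B|
  have hX : 0 ≤ X := by positivity
  have hlim : Tendsto (fun n : ℕ => X ^ n / n.factorial * 2) atTop (𝓝 0) := by
    simpa using (FloorSemiring.tendsto_pow_div_factorial_atTop X).mul_const (2:ℝ)
  obtain ⟨N, hN, hN2⟩ := ((hlim.eventually_le_const hε).and
    (tendsto_natCast_atTop_atTop.eventually_ge_atTop (2 * X))).exists
  refine ⟨fun y => ∑ m ∈ Finset.range N, (-I / 2) * (((t * R y * I : ℂ)) ^ m - (-(t * R y * I : ℂ)) ^ m) / m.factorial, ?_, ?_⟩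
  · have : (fun y => ∑ m ∈ Finset.range N, (-I / 2) * (((t * R y * I : ℂ)) ^ m - (-(t * R y * I : ℂ)) ^ m) / m.factorial) =
      ∑ m ∈ Finset.range N, (fun y => (-I / 2) * (((t * R y * I : ℂ)) ^ m - (-(t * R y * I : ℂ)) ^ m) / m.factorial) := by
      ext y; simp
    rw [this]
    refine Submodule.sum_mem _ fun m _ => ?_
    rcases Nat.even_or_odd' m with ⟨n, rfl | rfl⟩
    · convert Submodule.zero_mem _ using 1
      ext y
      rw [(even_two_mul n).neg_pow]; simp
    · convert Submodule.smul_mem _ ((-I / 2) * 2 * (t * I) ^ (2 * n + 1) / (2 * n + 1).factorial) (span_pow_odd hR n) using 1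
      ext y
      rw [(odd_two_mul_add_one n).neg_pow]
      simp only [Pi.smul_apply, Pi.pow_apply, smul_eq_mul]
      rw [show (t * R y * I : ℂ) = (t * I) * R y by ring, mul_pow]
      ring
  · intro y
    set z : ℂ := t * R y * I with hz
    have e1 : (Real.sin (t * R y) : ℂ) = (-I / 2) * (cexp z - cexp (-z)) := by
      rw [Complex.ofReal_sin, Complex.sin, hz]; push_cast; ring_nf
    have hzX : ‖z‖ ≤ X := hB' y
    have hc : ‖z‖ / (N.succ : ℝ) ≤ 1 / 2 := by
      rw [div_le_iff₀ (by positivity)]; push_cast; linarith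
    have b1 := Complex.exp_bound' hc
    have b2 := Complex.exp_bound' (x := -z) (by rwa [norm_neg])
    rw [norm_neg] at b2
    have b3 : ‖z‖ ^ N / N.factorial * 2 ≤ ε := by
      refine le_trans ?_ hN
      gcongr
    have e2 : (Real.sin (t * R y) : ℂ) - ∑ m ∈ Finset.range N, (-I / 2) * (z ^ m - (-z) ^ m) / m.factorial =
        (-I / 2) * ((cexp z - ∑ m ∈ Finset.range N, z ^ m / m.factorial) -
          (cexp (-z) - ∑ m ∈ Finset.range N, (-z) ^ m / m.factorial)) := by
      rw [e1, sub_sub_sub_comm, ← Finset.sum_sub_distrib, mul_sub (-I / 2) (cexp z - cexp (-z)), Finset.mul_sum]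
      congr 1
      refine Finset.sum_congr rfl fun m _ => ?_
      ring
    rw [e2, norm_mul]
    have e3 : ‖(-I / 2 : ℂ)‖ = 1 / 2 := by simp
    rw [e3]
    have := norm_sub_le (cexp z - ∑ m ∈ Finset.range N, z ^ m / m.factorial)
      (cexp (-z) - ∑ m ∈ Finset.range N, (-z) ^ m / m.factorial)
    linarith

end S12

namespace S12

lemma sin_mean {Z : Set ℝ} (h0 : (0:ℝ) ∉ Mp Z Odd) {f : ℝ → ℝ} {c : ℂ} (hm : Measurable f)
    (hf : AP (Mp Z Odd) (fun y => (f y : ℂ) - c)) (t : ℝ) {ε : ℝ} (hε : 0 < ε) :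
    ∀ᶠ Y in atTop, |∫ y in (0:ℝ)..Y, Real.sin (t * (f y - c.re))| ≤ ε * Y := by
  obtain ⟨P, hP, h1⟩ := hf.2 (ε / 3 / (|t| + 1)) (by positivity)
  have hR := span_re (fun x hx => Mp_neg hx) hP
  obtain ⟨S, hS, h2⟩ := sin_approx (R := fun y => (P y).re) hR t (ε := ε / 3) (by positivity)
  obtain ⟨C, hC⟩ := span_mean h0 hS
  filter_upwards [h1, eventually_ge_atTop 0, eventually_ge_atTop (3 * C / ε)] with Y h1 hY hYC
  have i0 : IntervalIntegrable (fun y => (Real.sin (t * (f y - c.re)) : ℂ)) volume 0 Y := by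
    have hc : IntervalIntegrable (fun _ : ℝ => (1:ℝ)) volume 0 Y := by simp
    refine hc.mono_fun (by fun_prop) (Eventually.of_forall fun y => ?_)
    beta_reduce
    rw [Complex.norm_real, Real.norm_eq_abs, norm_one]
    exact Real.abs_sin_le_one _
  have i1 := (hf.1 Y hY).sub ((span_cont hP).intervalIntegrable 0 Y)
  have iS := (span_cont hS).intervalIntegrable (μ := volume) 0 Y
  have e1 : ((∫ y in (0:ℝ)..Y, Real.sin (t * (f y - c.re)) : ℝ) : ℂ) =
      (∫ y in (0:ℝ)..Y, ((Real.sin (t * (f y - c.re)) : ℂ) - S y)) + ∫ y in (0:ℝ)..Y, S y := by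
    rw [← intervalIntegral.integral_add (i0.sub iS) iS, ← intervalIntegral.integral_ofReal]
    congr 1; ext y; simp
  have b1 : ‖∫ y in (0:ℝ)..Y, ((Real.sin (t * (f y - c.re)) : ℂ) - S y)‖ ≤
      ∫ y in (0:ℝ)..Y, (|t| * ‖(f y : ℂ) - c - P y‖ + ε / 3) := by
    have i3 : IntervalIntegrable (fun _ : ℝ => ε / 3) volume 0 Y := by simp
    apply intervalIntegral.norm_integral_le_of_norm_le hY _ ((i1.norm.const_mul |t|).add i3)
    refine Eventually.of_forall fun y _ => ?_
    have a1 : |Real.sin (t * (f y - c.re)) - Real.sin (t * (P y).re)| ≤ |t| * ‖(f y : ℂ) - c - P y‖ := by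
      refine (Real.abs_sin_sub_sin_le _ _).trans ?_
      rw [← mul_sub, abs_mul]
      gcongr
      have := Complex.abs_re_le_norm ((f y : ℂ) - c - P y)
      simpa using this
    calc _ = ‖((Real.sin (t * (f y - c.re)) - Real.sin (t * (P y).re) : ℝ) : ℂ) +
          ((Real.sin (t * (P y).re) : ℂ) - S y)‖ := by congr 1; push_cast; ring
      _ ≤ _ := by
        refine (norm_add_le _ _).trans (add_le_add ?_ (h2 y))
        rw [Complex.norm_real, Real.norm_eq_abs]; exact a1
  have b2 : ∫ y in (0:ℝ)..Y, (|t| * ‖(f y : ℂ) - c - P y‖ + ε / 3) =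
      |t| * (∫ y in (0:ℝ)..Y, ‖(f y : ℂ) - c - P y‖) + ε / 3 * Y := by
    rw [intervalIntegral.integral_add (i1.norm.const_mul |t|) (by simp), intervalIntegral.integral_const_mul]
    simp; ring
  have b3 : |t| * (∫ y in (0:ℝ)..Y, ‖(f y : ℂ) - c - P y‖) ≤ ε / 3 * Y := by
    calc _ ≤ |t| * (ε / 3 / (|t| + 1) * Y) := by gcongr
      _ = (|t| / (|t| + 1)) * (ε / 3 * Y) := by ring
      _ ≤ 1 * (ε / 3 * Y) := by
        gcongr
        rw [div_le_one (by positivity)]; linarith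
      _ = _ := one_mul _
  rw [← Real.norm_eq_abs, ← Complex.norm_real, e1]
  refine (norm_add_le _ _).trans ?_
  have := hC Y
  rw [div_le_iff₀ hε] at hYC
  linarith

lemma test_zero {μ : Measure ℝ} {F : ℝ → ℝ} (hμ : HasLimitingLogDistribution F μ)
    (hFm : Measurable fun y => F (Real.exp y)) {g : ℝ → ℝ} {C : NNReal} {B L : ℝ}
    (hg : LipschitzWith C g) (hB : ∀ x, |g x| ≤ B)
    (hm : ∀ ε, 0 < ε → ∀ᶠ Y in atTop, |∫ y in (0:ℝ)..Y, g (F (Real.exp y))| ≤ (L + ε) * Y) :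
    |∫ s, g s ∂μ| ≤ L := by
  have ht := (hμ.2 g ⟨C, hg⟩ ⟨B, hB⟩).abs
  refine le_of_forall_pos_le_add fun ε hε => ?_
  have hi : ∀ u v : ℝ, IntervalIntegrable (fun y => g (F (Real.exp y))) volume u v := by
    intro u v
    have hc : IntervalIntegrable (fun _ : ℝ => B) volume u v := by simp
    refine hc.mono_fun (hg.continuous.measurable.comp hFm).aestronglyMeasurable (Eventually.of_forall fun y => ?_)
    exact (hB _).trans (le_abs_self _)
  set J := ∫ y in (0:ℝ)..2, g (F (Real.exp y))
  refine le_of_tendsto ht ?_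
  filter_upwards [hm (ε / 2) (by positivity), eventually_gt_atTop 0, eventually_ge_atTop (2 * |J| / ε)] with Y h1 hY h2
  have e := intervalIntegral.integral_interval_sub_left (hi 0 Y) (hi 0 2)
  rw [abs_mul, abs_of_pos (by positivity : (0:ℝ) < 1 / Y), ← e, one_div, inv_mul_le_iff₀ hY]
  rw [div_le_iff₀ hε] at h2
  refine (abs_sub _ _).trans ?_
  linarith

lemma symm_of_sin {μ : Measure ℝ} [IsProbabilityMeasure μ] {c : ℝ}
    (h : ∀ t : ℝ, ∫ s, Real.sin (t * (s - c)) ∂μ = 0) : μ.map (fun s => 2 * c - s) = μ := by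
  have hme : Measurable (fun s : ℝ => 2 * c - s) := by fun_prop
  have : IsProbabilityMeasure (μ.map (fun s => 2 * c - s)) := Measure.isProbabilityMeasure_map hme.aemeasurable
  apply Measure.ext_of_charFun
  ext t
  rw [charFun_apply_real, charFun_apply_real, integral_map hme.aemeasurable (by fun_prop)]
  have hi : ∀ w : ℝ → ℝ, Measurable w → Integrable (fun s => cexp (w s * I)) μ := by
    intro w hw
    refine Integrable.of_bound (C := 1) (by fun_prop) (Eventually.of_forall fun s => ?_)
    rw [Complex.norm_exp_ofReal_mul_I]
  have i1 : Integrable (fun s : ℝ => cexp (t * ((2 * c - s : ℝ) : ℂ) * I)) μ := by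
    have := hi (fun s => t * (2 * c - s)) (by fun_prop)
    simpa using this
  have i2 : Integrable (fun s : ℝ => cexp (t * s * I)) μ := by
    have := hi (fun s => t * s) (by fun_prop)
    simpa using this
  rw [← sub_eq_zero, ← integral_sub i1 i2]
  have e : ∀ s : ℝ, cexp (t * ((2 * c - s : ℝ) : ℂ) * I) - cexp (t * s * I) =
      (-2 * I * cexp (t * c * I)) * ((Real.sin (t * (s - c)) : ℝ) : ℂ) := by
    intro s
    rw [Complex.ofReal_sin, Complex.sin]
    push_cast
    have e1 : cexp (t * (2 * c - s) * I) = cexp (t * c * I) * cexp (-(t * (s - c)) * I) := by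
      rw [← Complex.exp_add]; congr 1; ring
    have e2 : cexp (t * s * I) = cexp (t * c * I) * cexp ((t * (s - c)) * I) := by
      rw [← Complex.exp_add]; congr 1; ring
    rw [e1, e2]
    linear_combination (cexp (t * c * I) * (cexp (-(t * (s - c)) * I) - cexp ((t * (s - c)) * I))) * Complex.I_sq
  simp only [e]
  have e3 : ∫ s, ((Real.sin (t * (s - c)) : ℝ) : ℂ) ∂μ = ((∫ s, Real.sin (t * (s - c)) ∂μ : ℝ) : ℂ) :=
    integral_ofReal
  rw [integral_const_mul, e3, h t]
  simp

lemma integrable_of_min {μ : Measure ℝ} [IsProbabilityMeasure μ] {K : ℝ}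
    (h : ∀ n : ℕ, ∫ s, min |s| n ∂μ ≤ K) : Integrable (fun s : ℝ => s) μ := by
  refine ⟨by fun_prop, ?_⟩
  have h1 : ∀ n : ℕ, ∫⁻ s, ENNReal.ofReal (min |s| n) ∂μ ≤ ENNReal.ofReal K := by
    intro n
    rw [← ofReal_integral_eq_lintegral_ofReal]
    · exact ENNReal.ofReal_le_ofReal (h n)
    · refine Integrable.of_bound (C := n) (by fun_prop) (Eventually.of_forall fun s => ?_)
      rw [Real.norm_eq_abs, abs_of_nonneg (by positivity)]
      exact min_le_right _ _
    · exact Eventually.of_forall fun s => by positivity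
  have h2 : ∫⁻ s, ‖s‖ₑ ∂μ ≤ liminf (fun n : ℕ => ∫⁻ s, ENNReal.ofReal (min |s| n) ∂μ) atTop := by
    refine le_trans (lintegral_mono fun s => ?_) (lintegral_liminf_le (fun n => by fun_prop))
    refine le_of_eq (Tendsto.liminf_eq ?_).symm
    refine tendsto_const_nhds.congr' ?_
    filter_upwards [tendsto_natCast_atTop_atTop.eventually_ge_atTop |s|] with n hn
    rw [min_eq_left hn, ← Real.enorm_eq_ofReal_abs]
  refine lt_of_le_of_lt h2 (lt_of_le_of_lt (b := ENNReal.ofReal K) ?_ ENNReal.ofReal_lt_top)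
  exact liminf_le_of_le (by isBoundedDefault) fun b hb => by
    obtain ⟨n, hn⟩ := hb.exists
    exact hn.trans (h1 n)

end S12

/-- If every finitely supported integer relation `Σ k_γ γ = 0` among elements of `Z*_q`
has `Σ k_γ` even, then `μ_{q;a,b}` is symmetric about its mean `m_{q;a,b}`. -/
theorem stmt12 (q : ℕ) [NeZero q] (hq : 3 ≤ q) (a b : ZMod q)
    (ha : IsUnit a) (hb : IsUnit b) (hab : a ≠ b)
    (μ : Measure ℝ) (hμ : HasLimitingLogDistribution (Eab q a b) μ)
    (hyp : ∀ k : ℝ →₀ ℤ, (k.support : Set ℝ) ⊆ Zq q →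
      (∑ γ ∈ k.support, (k γ : ℝ) * γ) = 0 → 2 ∣ ∑ γ ∈ k.support, k γ) :
    μ.map (fun t : ℝ => 2 * (∫ s, s ∂μ) - t) = μ := by
  have := hμ.1
  have h0 : (0:ℝ) ∉ S12.Mp (Zq q) Odd := by
    rintro ⟨k, k1, k2, k3⟩
    have := hyp k k1 k2
    exact (Int.not_even_iff_odd.2 k3) (even_iff_two_dvd.2 this)
  obtain ⟨c, hc⟩ := S12.AP_Eab ha hb hab
  have hM := hc.mono S12.Lam_sub
  have hmeas := S12.Eab_meas a b
  have hsin : ∀ t : ℝ, ∫ s, Real.sin (t * (s - c.re)) ∂μ = 0 := by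
    intro t
    have hl : LipschitzWith (1 * ‖t‖₊) (fun s : ℝ => Real.sin (t * (s - c.re))) := by
      refine Real.lipschitzWith_sin.comp ?_
      refine LipschitzWith.of_dist_le_mul fun x y => ?_
      rw [Real.dist_eq, Real.dist_eq, ← mul_sub, abs_mul]
      simp
    have := S12.test_zero (L := 0) hμ hmeas hl (fun x => Real.abs_sin_le_one _) (fun ε hε => by
      simpa using S12.sin_mean h0 hmeas hM t hε)
    exact abs_nonpos_iff.1 this
  have hsym := S12.symm_of_sin hsin
  obtain ⟨K, hK⟩ := hc.mean_bdd c
  have hintg : Integrable (fun s : ℝ => s) μ := by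
    refine S12.integrable_of_min (K := K) fun n => ?_
    have hl : LipschitzWith 1 (fun s : ℝ => min |s| (n:ℝ)) := by
      refine LipschitzWith.min_const ?_ _
      exact lipschitzWith_one_norm
    refine (le_abs_self _).trans (S12.test_zero (L := K) hμ hmeas hl (B := n) (fun x => ?_) fun ε hε => ?_)
    · rw [abs_of_nonneg (by positivity)]; exact min_le_right _ _
    · filter_upwards [hK, eventually_ge_atTop 0] with Y hK hY
      simp only [sub_add_cancel, Complex.norm_real, Real.norm_eq_abs] at hK
      have hi := (S12.Eab_int a b hY).abs
      have : |∫ y in (0:ℝ)..Y, min |Eab q a b (Real.exp y)| (n:ℝ)| ≤ ∫ y in (0:ℝ)..Y, |Eab q a b (Real.exp y)| := by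
        rw [← Real.norm_eq_abs]
        apply intervalIntegral.norm_integral_le_of_norm_le hY _ hi
        refine Eventually.of_forall fun y _ => ?_
        rw [Real.norm_eq_abs, abs_of_nonneg (by positivity)]
        exact min_le_left _ _
      nlinarith
  have hmean : ∫ s, s ∂μ = c.re := by
    have h1 : ∫ s, s ∂(μ.map (fun s => 2 * c.re - s)) = ∫ s, (2 * c.re - s) ∂μ :=
      integral_map (by fun_prop) (by fun_prop)
    rw [hsym, integral_sub (integrable_const _) hintg] at h1
    simp at h1
    linarith
  rw [hmean]
  exact hsym

end
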